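/- Let n be a sufficiently large integer with n ≡ 0 (mod 4). Let F_1, ..., F_{n/4} be 4-uniform hypergraphs with F_i ⊆ binom([n],4) for each i ∈ [n/4], such that δ_1(F_i) > binom(n-1,3) - binom(3n/4,3) for every i (every vertex of [n] lies in more than binom(n-1,3) - binom(3n/4,3) edges of F_i). Then the family {F_1, ..., F_{n/4}} admits a rainbow matching, i.e., there exist pairwise disjoint edges e_1, ..., e_{n/4} with e_i ∈ F_i for each i. -/

import Mathlib

namespace RainbowMatching

/-- `s * t` style inequality behind all the nondegenerate cases. -/
lemma four_ninths_le {s t a b : ℝ} (hs0 : 0 ≤ s) (hs1 : s ≤ 1) (ht0 : 0 ≤ t) (ht1 : t ≤ 1)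
    (ha : 1 + t ≤ a) (hb : 1 + s ≤ b) :
    4 / 9 * ((a + s) * (b + t)) ≤ a * b := by
  have h1 : (a + s) * (1 + t) ≤ a * (1 + s + t) := by nlinarith
  have h2 : (b + t) * (1 + s) ≤ b * (1 + s + t) := by nlinarith
  have h3 : (a + s) * (1 + t) * ((b + t) * (1 + s)) ≤ a * (1 + s + t) * (b * (1 + s + t)) := by
    apply mul_le_mul h1 h2 <;> nlinarith
  have h4 : 4 * (1 + s + t) ^ 2 ≤ 9 * ((1 + s) * (1 + t)) := by
    nlinarith [mul_nonneg hs0 ht0, mul_nonneg (sub_nonneg.2 hs1) (sub_nonneg.2 ht1),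
      mul_nonneg hs0 (sub_nonneg.2 ht1), mul_nonneg ht0 (sub_nonneg.2 hs1),
      mul_nonneg hs0 (sub_nonneg.2 hs1), mul_nonneg ht0 (sub_nonneg.2 ht1)]
  have h5 : 0 < (1 + s + t) ^ 2 := by positivity
  have h6 : 0 ≤ (a + s) * (b + t) := by apply mul_nonneg <;> linarith
  have h7 : 4 / 9 * ((a + s) * (b + t)) * (1 + s + t) ^ 2 ≤ a * b * (1 + s + t) ^ 2 := by
    nlinarith [mul_le_mul_of_nonneg_left h4 h6]
  exact le_of_mul_le_mul_right h7 h5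

/-- The three-singletons case. -/
lemma product_ge_of_singletons {s₁ s₂ s₃ t₁ t₂ t₃ : ℝ}
    (ht₁ : 0 ≤ t₁) (ht₂ : 0 ≤ t₂) (ht₃ : 0 ≤ t₃)
    (h₁ : 1 + t₂ + t₃ ≤ s₁) (h₂ : 1 + t₁ + t₃ ≤ s₂) (h₃ : 1 + t₁ + t₂ ≤ s₃) {c : ℝ} 
    (hc : c * (1 + t₁ + t₂ + t₃) ^ 3 ≤ (1 + t₂ + t₃) * (1 + t₁ + t₃) * (1 + t₁ + t₂)) :
    c * ((s₁ + t₁) * (s₂ + t₂) * (s₃ + t₃)) ≤ s₁ * s₂ * s₃ := by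
  set S := 1 + t₁ + t₂ + t₃ with hS
  have hSp : 0 < S := by positivity
  have e1 : (s₁ + t₁) * (1 + t₂ + t₃) ≤ s₁ * S := by nlinarith
  have e2 : (s₂ + t₂) * (1 + t₁ + t₃) ≤ s₂ * S := by nlinarith
  have e3 : (s₃ + t₃) * (1 + t₁ + t₂) ≤ s₃ * S := by nlinarith
  have p1 : 0 ≤ s₁ := by linarith
  have p2 : 0 ≤ s₂ := by linarith
  have p3 : 0 ≤ s₃ := by linarith
  have e4 : (s₁ + t₁) * (1 + t₂ + t₃) * ((s₂ + t₂) * (1 + t₁ + t₃)) * ((s₃ + t₃) * (1 + t₁ + t₂))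
      ≤ s₁ * S * (s₂ * S) * (s₃ * S) := by
    gcongr
  have h6 : 0 ≤ (s₁ + t₁) * (s₂ + t₂) * (s₃ + t₃) := by positivity
  have h7 : c * ((s₁ + t₁) * (s₂ + t₂) * (s₃ + t₃)) * S ^ 3 ≤ s₁ * s₂ * s₃ * S ^ 3 := by
    calc c * ((s₁ + t₁) * (s₂ + t₂) * (s₃ + t₃)) * S ^ 3
        = (s₁ + t₁) * (s₂ + t₂) * (s₃ + t₃) * (c * S ^ 3) := by ring
      _ ≤ (s₁ + t₁) * (s₂ + t₂) * (s₃ + t₃) * ((1 + t₂ + t₃) * (1 + t₁ + t₃) * (1 + t₁ + t₂)) :=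
          mul_le_mul_of_nonneg_left hc h6
      _ = (s₁ + t₁) * (1 + t₂ + t₃) * ((s₂ + t₂) * (1 + t₁ + t₃)) *
            ((s₃ + t₃) * (1 + t₁ + t₂)) := by ring
      _ ≤ _ := e4
      _ = _ := by ring
  exact le_of_mul_le_mul_right h7 (by positivity)

lemma poly_main {x y z : ℝ} (hx : 0 ≤ x) (hy : 0 ≤ y) (hz : 0 ≤ z) (hx1 : x ≤ 1) (hy1 : y ≤ 1)
    (hz1 : z ≤ 1) :
    27 / 64 * (1 + x + y + z) ^ 3 ≤ (1 + y + z) * (1 + x + z) * (1 + x + y) := by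
  obtain ⟨a, rfl⟩ : ∃ a, x = 1 - a := ⟨1 - x, by ring⟩
  obtain ⟨b, rfl⟩ : ∃ a, y = 1 - a := ⟨1 - y, by ring⟩
  obtain ⟨c, rfl⟩ : ∃ a, z = 1 - a := ⟨1 - z, by ring⟩
  have ha : 0 ≤ a := by linarith
  have hb : 0 ≤ b := by linarith
  have hc : 0 ≤ c := by linarith
  nlinarith [mul_nonneg ha hb, mul_nonneg ha hc, mul_nonneg hb hc, mul_nonneg hx ha,
    mul_nonneg hy hb, mul_nonneg hz hc, mul_nonneg (mul_nonneg ha hb) hc, mul_nonneg hx hb,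
    mul_nonneg hx hc, mul_nonneg hy ha, mul_nonneg hy hc, mul_nonneg hz ha, mul_nonneg hz hb,
    mul_nonneg (mul_nonneg hx ha) ha, mul_nonneg (mul_nonneg hy hb) hb,
    mul_nonneg (mul_nonneg hz hc) hc]

lemma poly_gap {x y z : ℝ} (hx : 0 ≤ x) (hy : 0 ≤ y) (hz : 0 ≤ z) (hx1 : x ≤ 1/5) (hy1 : y ≤ 1)
    (hz1 : z ≤ 1) :
    (27 / 64 + 1 / 100) * (1 + x + y + z) ^ 3 ≤ (1 + y + z) * (1 + x + z) * (1 + x + y) := by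
  obtain ⟨a, rfl⟩ : ∃ a, x = 1/5 - a := ⟨1/5 - x, by ring⟩
  obtain ⟨b, rfl⟩ : ∃ a, y = 1 - a := ⟨1 - y, by ring⟩
  obtain ⟨c, rfl⟩ : ∃ a, z = 1 - a := ⟨1 - z, by ring⟩
  have ha : 0 ≤ a := by linarith
  have hb : 0 ≤ b := by linarith
  have hc : 0 ≤ c := by linarith
  nlinarith [mul_nonneg ha hb, mul_nonneg ha hc, mul_nonneg hb hc, mul_nonneg hx ha,
    mul_nonneg hy hb, mul_nonneg hz hc, mul_nonneg (mul_nonneg ha hb) hc, mul_nonneg hx hb,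
    mul_nonneg hx hc, mul_nonneg hy ha, mul_nonneg hy hc, mul_nonneg hz ha, mul_nonneg hz hb,
    mul_nonneg (mul_nonneg hx ha) ha, mul_nonneg (mul_nonneg hy hb) hb,
    mul_nonneg (mul_nonneg hz hc) hc]

lemma base_high_nonneg {p q g : ℝ} (hp : 0 ≤ p) (hp1 : p ≤ 1) (hq : 0 ≤ q) (hq1 : q ≤ 1)
    (hg0 : 0 ≤ g) (hg1 : g ≤ 1) :
    0 ≤ (p ^ 2 + q ^ 2) * (1 - 5 * g) + p * q * (2 - g) +
      g * (p + q) * (11 - 10 * g) + 5 * (2 - g) * g ^ 2 := by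
  have a1 : 0 ≤ g * (p * (1-p)) := by apply mul_nonneg hg0 (mul_nonneg hp (by linarith))
  have a2 : 0 ≤ g * (q * (1-q)) := by apply mul_nonneg hg0 (mul_nonneg hq (by linarith))
  have a3 : 0 ≤ g * g * ((1-p) * (1-q)) := by
    apply mul_nonneg (by positivity) (mul_nonneg (by linarith) (by linarith))
  have a4 : 0 ≤ g * (1- g) * ((1-p) * (1-q)) := by
    apply mul_nonneg (mul_nonneg hg0 (by linarith)) (mul_nonneg (by linarith) (by linarith))
  have a5 : 0 ≤ (1- g) * (p ^2) := by apply mul_nonneg (by linarith) (by positivity)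
  have a6 : 0 ≤ (1- g) * (q ^2) := by apply mul_nonneg (by linarith) (by positivity)
  have a7 : 0 ≤ (1- g) * (p*q) := by apply mul_nonneg (by linarith) (by positivity)
  have a8 : 0 ≤ g * (1- g) * (p) := by
    apply mul_nonneg (mul_nonneg hg0 (by linarith)) (by positivity)
  have a9 : 0 ≤ g * (1- g) * (q) := by
    apply mul_nonneg (mul_nonneg hg0 (by linarith)) (by positivity)
  have b1 : 0 ≤ g * g * (1- p) := by apply mul_nonneg (by positivity) (by linarith)
  have b2 : 0 ≤ g * g * (1- q) := by apply mul_nonneg (by positivity) (by linarith)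
  have b3 : 0 ≤ g * g * (1- g) := by apply mul_nonneg (by positivity) (by linarith)
  have b4 : 0 ≤ g * g * (p*(1- p)) := by
    apply mul_nonneg (by positivity) (mul_nonneg hp (by linarith))
  have b5 : 0 ≤ g * g * (q*(1- q)) := by
    apply mul_nonneg (by positivity) (mul_nonneg hq (by linarith))
  nlinarith

/-- The case of two bad pairs sharing the first index, with `s₁ ≤ t₁`. -/
lemma pairs_case {s₁ s₂ s₃ t₁ t₂ t₃ : ℝ} (hs₁ : 0 ≤ s₁) 
    (ht₁ : 0 ≤ t₁) (ht₂ : 0 ≤ t₂) (ht₃ : 0 ≤ t₃) (h₁ : t₁ ≤ 1) (h₂ : t₂ ≤ 1) (h₃ : t₃ ≤ 1)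
    (hst : s₁ ≤ t₁) (h12 : 1 + t₃ ≤ s₁ + s₂) (h13 : 1 + t₂ ≤ s₁ + s₃) :
    4 * (t₁ * t₂ * t₃ + s₁ * t₂ * t₃ + s₂ * t₁ * t₃ + s₃ * t₁ * t₂) ≤
    5 * (t₁ * s₂ * s₃ + t₂ * s₁ * s₃ + t₃ * s₁ * s₂ + s₁ * s₂ * s₃) := by
  obtain ⟨x, hx, rfl⟩ : ∃ x, 0 ≤ x ∧ s₂ = 1 + t₃ - s₁ + x :=
    ⟨s₂ - (1 + t₃ - s₁), by linarith, by ring⟩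
  obtain ⟨y, hy, rfl⟩ : ∃ y, 0 ≤ y ∧ s₃ = 1 + t₂ - s₁ + y :=
    ⟨s₃ - (1 + t₂ - s₁), by linarith, by ring⟩
  obtain ⟨g, rfl⟩ : ∃ g, s₁ = 1 - g := ⟨1 - s₁, by ring⟩
  have hg0 : 0 ≤ g := by linarith
  have hg1 : g ≤ 1 := by linarith
  have coef : ∀ p q : ℝ, 0 ≤ p → p ≤ 1 → 0 ≤ q → q ≤ 1 →
      0 ≤ 5 * (t₁ * (p + g) + q * (1 - g) + (1 - g) * (p + g)) - 4 * t₁ * q := by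
    intro p q hp0 hp1 hq0 hq1
    have k1 : 0 ≤ 5 * (t₁ * p + (1 - g) * p) := by positivity
    have k2 : 0 ≤ t₁ * (1 - q) := mul_nonneg ht₁ (by linarith)
    have k3 : 0 ≤ (1 - g) * (1 - t₁) := mul_nonneg hs₁ (by linarith)
    have k4 : 0 ≤ g * (1 - t₁) := mul_nonneg hg0 (by linarith)
    have k5 : 0 ≤ g * (1 - g) := mul_nonneg hg0 hs₁
    have k6 : 0 ≤ (1 - g) * (1 - q) := mul_nonneg hs₁ (by linarith)
    have k7 : 0 ≤ t₁ * g := mul_nonneg ht₁ hg0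
    have k8 : 0 ≤ q * (1 - g) := mul_nonneg hq0 hs₁
    nlinarith
  have cx := mul_nonneg hx (coef t₂ t₃ ht₂ h₂ ht₃ h₃)
  have cy := mul_nonneg hy (coef t₃ t₂ ht₃ h₃ ht₂ h₂)
  have cxy : 0 ≤ 5 * (x * y) * (t₁ + (1 - g)) := by positivity
  -- the base polynomial is affine in `t₁`
  have base_low : 0 ≤ 10 * ((t₃ + g) * (t₂ + g)) - 8 * (t₂ * t₃) + t₂ * (t₂ + g) + t₃ * (t₃ + g) := by
    nlinarith [mul_nonneg ht₂ ht₃, mul_nonneg ht₂ hg0, mul_nonneg ht₃ hg0]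
  have base_high : 0 ≤ (t₂ ^ 2 + t₃ ^ 2) * (1 - 5 * g) + t₂ * t₃ * (2 - g) +
      g * (t₂ + t₃) * (11 - 10 * g) + 5 * (2 - g) * g ^ 2 :=
    base_high_nonneg ht₂ h₂ ht₃ h₃ hg0 hg1
  have base : 0 ≤ 5 * (t₁ * (t₃ + g) * (t₂ + g) + t₂ * (1 - g) * (t₂ + g) + t₃ * (1 - g) * (t₃ + g)
      + (1 - g) * (t₃ + g) * (t₂ + g)) - 4 * (t₁ * t₂ * t₃ + (1 - g) * t₂ * t₃
      + (t₃ + g) * t₁ * t₃ + (t₂ + g) * t₁ * t₂) := by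
    rcases hg0.eq_or_lt with rfl | hg
    · obtain rfl : t₁ = 1 := by linarith
      linarith
    · refine nonneg_of_mul_nonneg_right (a := g) ?_ hg
      have k1 := mul_nonneg (sub_nonneg.2 hst) base_high
      have k2 := mul_nonneg (mul_nonneg (sub_nonneg.2 h₁) hs₁) base_low
      linarith
  linarith

/-- The unnormalised probability that three independent two-point variables with mean `1/4` have
sum less than one: the `i`-th variable takes the value `(1 - tᵢ)/4` with weight `sᵢ` and the value
`(1 + sᵢ)/4` with weight `tᵢ`. -/
noncomputable def lowWeight (s₁ t₁ s₂ t₂ s₃ t₃ : ℝ) : ℝ :=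
  s₁ * s₂ * s₃
  + (if s₁ < 1 + t₂ + t₃ then t₁ * s₂ * s₃ else 0)
  + (if s₂ < 1 + t₁ + t₃ then t₂ * s₁ * s₃ else 0)
  + (if s₃ < 1 + t₁ + t₂ then t₃ * s₁ * s₂ else 0)
  + (if s₁ + s₂ < 1 + t₃ then t₁ * t₂ * s₃ else 0)
  + (if s₁ + s₃ < 1 + t₂ then t₁ * t₃ * s₂ else 0)
  + (if s₂ + s₃ < 1 + t₁ then t₂ * t₃ * s₁ else 0)
  + (if s₁ + s₂ + s₃ < 1 then t₁ * t₂ * t₃ else 0)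

lemma lowWeight_swap12 (s₁ t₁ s₂ t₂ s₃ t₃ : ℝ) :
    lowWeight s₁ t₁ s₂ t₂ s₃ t₃ = lowWeight s₂ t₂ s₁ t₁ s₃ t₃ := by
  unfold lowWeight
  rw [add_comm s₂ s₁, add_right_comm 1 t₂ t₁]
  simp only [mul_comm, mul_left_comm]
  ring

lemma lowWeight_swap23 (s₁ t₁ s₂ t₂ s₃ t₃ : ℝ) :
    lowWeight s₁ t₁ s₂ t₂ s₃ t₃ = lowWeight s₁ t₁ s₃ t₃ s₂ t₂ := by
  unfold lowWeight
  rw [add_comm s₃ s₂, add_right_comm 1 t₃ t₂, add_right_comm s₁ s₃ s₂]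
  simp only [mul_comm, mul_left_comm]
  ring

section TwoPoint

variable {s₁ t₁ s₂ t₂ s₃ t₃ : ℝ}

lemma lowWeight_ge_of_one_bad (hs₂ : 0 ≤ s₂) (hs₃ : 0 ≤ s₃)
    (ht₁ : 0 ≤ t₁) (ht₂ : 0 ≤ t₂) (ht₃ : 0 ≤ t₃) (h₁ : t₁ ≤ 1) (h₂ : t₂ ≤ 1) (h₃ : t₃ ≤ 1)
    (b₁ : 1 + t₂ + t₃ ≤ s₁) (g₂ : s₂ < 1 + t₁ + t₃) (g₃ : s₃ < 1 + t₁ + t₂) :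
    4 / 9 * ((s₁ + t₁) * (s₂ + t₂) * (s₃ + t₃)) ≤ lowWeight s₁ t₁ s₂ t₂ s₃ t₃ := by
  have hs₁ : 1 ≤ s₁ := by linarith
  have e : lowWeight s₁ t₁ s₂ t₂ s₃ t₃ = s₁ * s₂ * s₃ + t₂ * s₁ * s₃ + t₃ * s₁ * s₂
      + if s₂ + s₃ < 1 + t₁ then t₂ * t₃ * s₁ else 0 := by
    unfold lowWeight
    rw [if_neg (by linarith), if_pos g₂, if_pos g₃, if_neg (by linarith), if_neg (by linarith),
      if_neg (c := s₁ + s₂ + s₃ < 1) (by linarith)]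
    ring
  rw [e]
  have hX : 0 ≤ (s₂ + t₂) * (s₃ + t₃) := by positivity
  split_ifs with h
  · nlinarith [mul_nonneg hX (show 0 ≤ s₁ - t₁ by linarith),
    mul_nonneg hX (show 0 ≤ s₁ by linarith)]
  · push Not at h
    obtain ⟨τ, hτ0, hτ1, hτs, key⟩ : ∃ τ, 0 ≤ τ ∧ τ ≤ 1 ∧ 1 + τ ≤ s₁ ∧
        t₂ * t₃ * (1 + t₁ + τ) ≤ τ * ((s₂ + t₂) * (s₃ + t₃)) := by
      rcases le_total t₂ t₃ with h' | h'
      · refine ⟨t₃, ht₃, h₃, by linarith, ?_⟩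
        nlinarith [mul_nonneg (mul_nonneg ht₂ ht₃) (sub_nonneg.2 h),
          mul_nonneg (mul_nonneg ht₃ hs₂) hs₃,
          mul_nonneg (mul_nonneg ht₃ hs₂) (sub_nonneg.2 h')]
      · refine ⟨t₂, ht₂, h₂, by linarith, ?_⟩
        nlinarith [mul_nonneg (mul_nonneg ht₂ ht₃) (sub_nonneg.2 h),
          mul_nonneg (mul_nonneg ht₂ hs₂) hs₃,
          mul_nonneg (mul_nonneg ht₂ hs₃) (sub_nonneg.2 h')]
    have f := four_ninths_le (a := s₁) (b := 1 + t₁) ht₁ h₁ hτ0 hτ1 hτs le_rfl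
    have f1 := mul_le_mul_of_nonneg_right f hX
    have f2 := mul_le_mul_of_nonneg_left key (show 0 ≤ s₁ by linarith)
    refine le_of_mul_le_mul_right (a := 1 + t₁ + τ) ?_ (by positivity)
    nlinarith

lemma lowWeight_ge_of_two_bad (hs₃ : 0 ≤ s₃)
    (ht₁ : 0 ≤ t₁) (ht₂ : 0 ≤ t₂) (ht₃ : 0 ≤ t₃) (h₁ : t₁ ≤ 1) (h₂ : t₂ ≤ 1)
    (b₁ : 1 + t₂ + t₃ ≤ s₁) (b₂ : 1 + t₁ + t₃ ≤ s₂) (g₃ : s₃ < 1 + t₁ + t₂) :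
    4 / 9 * ((s₁ + t₁) * (s₂ + t₂) * (s₃ + t₃)) ≤ lowWeight s₁ t₁ s₂ t₂ s₃ t₃ := by
  have e : lowWeight s₁ t₁ s₂ t₂ s₃ t₃ = s₁ * s₂ * s₃ + t₃ * s₁ * s₂ := by
    unfold lowWeight
    rw [if_neg (by linarith), if_neg (by linarith), if_pos g₃, if_neg (by linarith),
      if_neg (by linarith), if_neg (by linarith), if_neg (by linarith)]
    ring
  rw [e]
  have f := four_ninths_le (a := s₁) (b := s₂) ht₁ h₁ ht₂ h₂ (by linarith) (by linarith)
  nlinarith [mul_le_mul_of_nonneg_right f (add_nonneg hs₃ ht₃)]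

lemma lowWeight_of_three_bad
    (ht₁ : 0 ≤ t₁) (ht₂ : 0 ≤ t₂) (ht₃ : 0 ≤ t₃)
    (b₁ : 1 + t₂ + t₃ ≤ s₁) (b₂ : 1 + t₁ + t₃ ≤ s₂) (b₃ : 1 + t₁ + t₂ ≤ s₃) :
    lowWeight s₁ t₁ s₂ t₂ s₃ t₃ = s₁ * s₂ * s₃ := by
  unfold lowWeight
  rw [if_neg (by linarith), if_neg (by linarith), if_neg (by linarith), if_neg (by linarith),
      if_neg (by linarith), if_neg (by linarith), if_neg (by linarith)]
  ring

lemma lowWeight_ge_of_no_bad (hs₁ : 0 ≤ s₁) (hs₂ : 0 ≤ s₂) (hs₃ : 0 ≤ s₃)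
    (ht₁ : 0 ≤ t₁) (ht₂ : 0 ≤ t₂) (ht₃ : 0 ≤ t₃) (h₁ : t₁ ≤ 1) (h₂ : t₂ ≤ 1) (h₃ : t₃ ≤ 1)
    (g₁ : s₁ < 1 + t₂ + t₃) (g₂ : s₂ < 1 + t₁ + t₃) (g₃ : s₃ < 1 + t₁ + t₂) :
    4 / 9 * ((s₁ + t₁) * (s₂ + t₂) * (s₃ + t₃)) ≤ lowWeight s₁ t₁ s₂ t₂ s₃ t₃ := by
  unfold lowWeight
  rw [if_pos g₁, if_pos g₂, if_pos g₃]
  have c1 : 0 ≤ s₁ * s₂ * s₃ := by positivity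
  have c2 : 0 ≤ t₁ * s₂ * s₃ := by positivity
  have c3 : 0 ≤ t₂ * s₁ * s₃ := by positivity
  have c4 : 0 ≤ t₃ * s₁ * s₂ := by positivity
  have c5 : 0 ≤ t₁ * t₂ * s₃ := by positivity
  have c6 : 0 ≤ t₁ * t₃ * s₂ := by positivity
  have c7 : 0 ≤ t₂ * t₃ * s₁ := by positivity
  have c8 : 0 ≤ t₁ * t₂ * t₃ := by positivity
  have c9 : 0 ≤ if s₁ + s₂ + s₃ < 1 then t₁ * t₂ * t₃ else 0 := by split_ifs <;> simp [c8]
  have one_pair : ∀ {s t s' t' u : ℝ}, 0 ≤ s → 0 ≤ s' → 0 ≤ t → 0 ≤ t' → t ≤ 1 → t' ≤ 1 →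
      0 ≤ u → 1 ≤ s + s' → 2 * (t * t' * u) ≤ (s + t) * (s' + t') * u := by
    intro s t s' t' u p1 p2 p3 p4 p5 p6 p7 p8
    refine le_trans (le_of_eq (by ring)) (mul_le_mul_of_nonneg_right (b := 2 * (t * t')) ?_ p7)
    nlinarith [mul_nonneg p1 p2, mul_nonneg (mul_nonneg p1 p4) (sub_nonneg.2 p5),
      mul_nonneg (mul_nonneg p2 p3) (sub_nonneg.2 p6), mul_nonneg p3 p4,
      mul_nonneg (mul_nonneg p3 p4) (sub_nonneg.2 p8)]
  by_cases p12 : s₁ + s₂ < 1 + t₃ <;> by_cases p13 : s₁ + s₃ < 1 + t₂ <;>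
    by_cases p23 : s₂ + s₃ < 1 + t₁ <;>
    simp only [p12, p13, p23, if_true, if_false] <;> try simp only [not_lt] at p12 p13 p23
  · split_ifs with p
    · nlinarith
    · push Not at p
      have : t₁ * t₂ * t₃ * (1 + (s₁ + s₂ + s₃)) ≤
          t₁ * t₂ * t₃ + t₂ * t₃ * s₁ + t₁ * t₃ * s₂ + t₁ * t₂ * s₃ := by
        nlinarith [mul_nonneg c7 (sub_nonneg.2 h₁), mul_nonneg c6 (sub_nonneg.2 h₂),
          mul_nonneg c5 (sub_nonneg.2 h₃)]
      nlinarith [mul_nonneg c8 (sub_nonneg.2 p)]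
  · have := one_pair hs₂ hs₃ ht₂ ht₃ h₂ h₃ (add_nonneg hs₁ ht₁) (by linarith)
    nlinarith
  · have := one_pair hs₁ hs₃ ht₁ ht₃ h₁ h₃ (add_nonneg hs₂ ht₂) (by linarith)
    nlinarith
  · rcases le_total s₃ t₃ with h | h
    · have := pairs_case (s₁ := s₃) (t₁ := t₃) (s₂ := s₁) (t₂ := t₁) (s₃ := s₂) (t₃ := t₂)
        hs₃ ht₃ ht₁ ht₂ h₃ h₁ h₂ h (by linarith) (by linarith)
      linarith
    · have d1 := mul_le_mul_of_nonneg_left h (mul_nonneg ht₁ ht₂)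
      have d2 := mul_le_mul_of_nonneg_left h (mul_nonneg ht₁ hs₂)
      have d3 := mul_le_mul_of_nonneg_left h (mul_nonneg ht₂ hs₁)
      linarith
  · have := one_pair hs₁ hs₂ ht₁ ht₂ h₁ h₂ (add_nonneg hs₃ ht₃) (by linarith)
    nlinarith
  · rcases le_total s₂ t₂ with h | h
    · have := pairs_case (s₁ := s₂) (t₁ := t₂) (s₂ := s₁) (t₂ := t₁) (s₃ := s₃) (t₃ := t₃)
        hs₂ ht₂ ht₁ ht₃ h₂ h₁ h₃ h (by linarith) (by linarith)
      linarith
    · have d1 := mul_le_mul_of_nonneg_left h (mul_nonneg ht₁ ht₃)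
      have d2 := mul_le_mul_of_nonneg_left h (mul_nonneg ht₁ hs₃)
      have d3 := mul_le_mul_of_nonneg_left h (mul_nonneg ht₃ hs₁)
      linarith
  · rcases le_total s₁ t₁ with h | h
    · have := pairs_case (s₁ := s₁) (t₁ := t₁) (s₂ := s₂) (t₂ := t₂) (s₃ := s₃) (t₃ := t₃)
        hs₁ ht₁ ht₂ ht₃ h₁ h₂ h₃ h (by linarith) (by linarith)
      linarith
    · have d1 := mul_le_mul_of_nonneg_left h (mul_nonneg ht₂ ht₃)
      have d2 := mul_le_mul_of_nonneg_left h (mul_nonneg ht₂ hs₃)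
      have d3 := mul_le_mul_of_nonneg_left h (mul_nonneg ht₃ hs₂)
      linarith
  · rcases le_total s₁ t₁ with k₁ | k₁
    · have := pairs_case (s₁ := s₁) (t₁ := t₁) (s₂ := s₂) (t₂ := t₂) (s₃ := s₃) (t₃ := t₃)
        hs₁ ht₁ ht₂ ht₃ h₁ h₂ h₃ k₁ (by linarith) (by linarith)
      linarith
    rcases le_total s₂ t₂ with h | k₂
    · have := pairs_case (s₁ := s₂) (t₁ := t₂) (s₂ := s₁) (t₂ := t₁) (s₃ := s₃) (t₃ := t₃)
        hs₂ ht₂ ht₁ ht₃ h₂ h₁ h₃ h (by linarith) (by linarith)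
      linarith
    rcases le_total s₃ t₃ with h | k₃
    · have := pairs_case (s₁ := s₃) (t₁ := t₃) (s₂ := s₁) (t₂ := t₁) (s₃ := s₂) (t₃ := t₂)
        hs₃ ht₃ ht₁ ht₂ h₃ h₁ h₂ h (by linarith) (by linarith)
      linarith
    have d1 := mul_le_mul_of_nonneg_left k₁ (mul_nonneg ht₂ hs₃)
    have d2 := mul_le_mul_of_nonneg_left k₂ (mul_nonneg ht₃ hs₁)
    have d3 := mul_le_mul_of_nonneg_left k₃ (mul_nonneg ht₁ hs₂)
    have d4 := mul_le_mul_of_nonneg_left k₁ (mul_nonneg ht₂ ht₃)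
    have d5 := mul_le_mul_of_nonneg_left k₂ (mul_nonneg ht₃ hs₁)
    have d6 := mul_le_mul_of_nonneg_left k₃ (mul_nonneg hs₁ hs₂)
    linarith

/-- Stability version of the two-point inequality. -/
theorem lowWeight_dichotomy (hs₁ : 0 ≤ s₁) (hs₂ : 0 ≤ s₂) (hs₃ : 0 ≤ s₃)
    (ht₁ : 0 ≤ t₁) (ht₂ : 0 ≤ t₂) (ht₃ : 0 ≤ t₃) (h₁ : t₁ ≤ 1) (h₂ : t₂ ≤ 1) (h₃ : t₃ ≤ 1) :
    (27 / 64 + 1 / 100) * ((s₁ + t₁) * (s₂ + t₂) * (s₃ + t₃)) ≤ lowWeight s₁ t₁ s₂ t₂ s₃ t₃ ∨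
    (1 / 5 ≤ t₁ ∧ 1 / 5 ≤ t₂ ∧ 1 / 5 ≤ t₃ ∧
      lowWeight s₁ t₁ s₂ t₂ s₃ t₃ = s₁ * s₂ * s₃ ∧
      27 / 64 * ((s₁ + t₁) * (s₂ + t₂) * (s₃ + t₃)) ≤ lowWeight s₁ t₁ s₂ t₂ s₃ t₃) := by
  have hX : 0 ≤ (s₁ + t₁) * (s₂ + t₂) * (s₃ + t₃) := by positivity
  have weaken : 4 / 9 * ((s₁ + t₁) * (s₂ + t₂) * (s₃ + t₃)) ≤ lowWeight s₁ t₁ s₂ t₂ s₃ t₃ →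
      (27 / 64 + 1 / 100) * ((s₁ + t₁) * (s₂ + t₂) * (s₃ + t₃)) ≤
        lowWeight s₁ t₁ s₂ t₂ s₃ t₃ := fun h => by linarith
  rcases lt_or_ge s₁ (1 + t₂ + t₃) with b₁ | b₁ <;> rcases lt_or_ge s₂ (1 + t₁ + t₃) with b₂ | b₂ <;>
    rcases lt_or_ge s₃ (1 + t₁ + t₂) with b₃ | b₃
  · exact .inl (weaken (lowWeight_ge_of_no_bad hs₁ hs₂ hs₃ ht₁ ht₂ ht₃ h₁ h₂ h₃ b₁ b₂ b₃))
  · refine .inl (weaken ?_)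
    have := lowWeight_ge_of_one_bad (s₁ := s₃) (t₁ := t₃) (s₂ := s₁) (t₂ := t₁) (s₃ := s₂) (t₃ := t₂)
      hs₁ hs₂ ht₃ ht₁ ht₂ h₃ h₁ h₂ (by linarith) (by linarith) (by linarith)
    rw [lowWeight_swap12, lowWeight_swap23] at this
    linarith
  · refine .inl (weaken ?_)
    have := lowWeight_ge_of_one_bad (s₁ := s₂) (t₁ := t₂) (s₂ := s₁) (t₂ := t₁) (s₃ := s₃) (t₃ := t₃)
      hs₁ hs₃ ht₂ ht₁ ht₃ h₂ h₁ h₃ (by linarith) (by linarith) (by linarith)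
    rw [lowWeight_swap12] at this
    linarith
  · refine .inl (weaken ?_)
    have := lowWeight_ge_of_two_bad (s₁ := s₂) (t₁ := t₂) (s₂ := s₃) (t₂ := t₃) (s₃ := s₁) (t₃ := t₁)
      hs₁ ht₂ ht₃ ht₁ h₂ h₃ (by linarith) (by linarith) (by linarith)
    rw [lowWeight_swap23, lowWeight_swap12] at this
    linarith
  · exact .inl (weaken (lowWeight_ge_of_one_bad hs₂ hs₃ ht₁ ht₂ ht₃ h₁ h₂ h₃ b₁ b₂ b₃))
  · refine .inl (weaken ?_)
    have := lowWeight_ge_of_two_bad (s₁ := s₁) (t₁ := t₁) (s₂ := s₃) (t₂ := t₃) (s₃ := s₂) (t₃ := t₂)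
      hs₂ ht₁ ht₃ ht₂ h₁ h₃ (by linarith) (by linarith) (by linarith)
    rw [lowWeight_swap23] at this
    linarith
  · exact .inl (weaken (lowWeight_ge_of_two_bad hs₃ ht₁ ht₂ ht₃ h₁ h₂ b₁ b₂ b₃))
  · rw [lowWeight_of_three_bad ht₁ ht₂ ht₃ b₁ b₂ b₃]
    rcases lt_or_ge t₁ (1 / 5) with k₁ | k₁
    · exact .inl (product_ge_of_singletons ht₁ ht₂ ht₃ b₁ b₂ b₃ (poly_gap ht₁ ht₂ ht₃ k₁.le h₂ h₃))
    rcases lt_or_ge t₂ (1 / 5) with k₂ | k₂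
    · refine .inl (product_ge_of_singletons ht₁ ht₂ ht₃ b₁ b₂ b₃ ?_)
      have := poly_gap ht₂ ht₁ ht₃ k₂.le h₁ h₃
      linarith
    rcases lt_or_ge t₃ (1 / 5) with k₃ | k₃
    · refine .inl (product_ge_of_singletons ht₁ ht₂ ht₃ b₁ b₂ b₃ ?_)
      have := poly_gap ht₃ ht₁ ht₂ k₃.le h₁ h₂
      linarith
    exact .inr ⟨k₁, k₂, k₃, rfl,
      product_ge_of_singletons ht₁ ht₂ ht₃ b₁ b₂ b₃ (poly_main ht₁ ht₂ ht₃ h₁ h₂ h₃)⟩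

end TwoPoint

section LightTriples

open Finset

variable {V : Type*} [Fintype V]

/-- The number of ordered triples of total weight less than one. -/
noncomputable def lightTriples (w : V → ℝ) : ℕ :=
  #{p : V × V × V | w p.1 + w p.2.1 + w p.2.2 < 1}

/-- The number of points of weight at most `1/5`. -/
noncomputable def lightPoints (w : V → ℝ) : ℕ := #{v : V | w v ≤ 1 / 5}

lemma lightTriples_eq_sum (w : V → ℝ) : (lightTriples w : ℝ) =
    ∑ x, ∑ y, ∑ z, if w x + w y + w z < 1 then 1 else 0 := by
  rw [lightTriples, card_filter]
  push_cast
  rw [Fintype.sum_prod_type]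
  refine sum_congr rfl fun x _ => ?_
  rw [Fintype.sum_prod_type]

lemma lightPoints_eq_sum (w : V → ℝ) : (lightPoints w : ℝ) =
    ∑ x, if w x ≤ 1 / 5 then 1 else 0 := by
  rw [lightPoints, card_filter]
  push_cast
  rfl

/-- A mean `1/4` weight is a mixture of two-point distributions of mean `1/4`. -/
lemma sum_pairs_eq (w : V → ℝ) (hw : ∑ v, w v = Fintype.card V / 4) (f : V → ℝ) :
    ∑ i ∈ ({v | w v ≤ 1 / 4} : Finset V) ×ˢ ({v | ¬ w v ≤ 1 / 4} : Finset V),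
      ((4 * w i.2 - 1) * f i.1 + (1 - 4 * w i.1) * f i.2) =
    (∑ v with ¬ w v ≤ 1 / 4, (4 * w v - 1)) * ∑ v, f v := by
  have hp : ∑ v with w v ≤ 1 / 4, (1 - 4 * w v) = ∑ v with ¬ w v ≤ 1 / 4, (4 * w v - 1) := by
    have h1 : ∑ v, (1 - 4 * w v) = 0 := by
      rw [sum_sub_distrib, ← mul_sum, hw]
      simp
      ring
    rw [← sum_filter_add_sum_filter_not univ (fun v => w v ≤ 1 / 4)] at h1
    have h2 : ∑ v with ¬ w v ≤ 1 / 4, (4 * w v - 1) = - ∑ v with ¬ w v ≤ 1 / 4, (1 - 4 * w v) := by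
      rw [← sum_neg_distrib]
      exact sum_congr rfl fun _ _ => by ring
    linarith
  rw [sum_add_distrib, sum_product_right, sum_product, ← sum_filter_add_sum_filter_not univ
    (fun v => w v ≤ 1 / 4) f, mul_add]
  congr 1
  · rw [sum_mul_sum]
  · rw [← hp, sum_mul_sum]

lemma sum_triples_eq (w : V → ℝ) (hw : ∑ v, w v = Fintype.card V / 4) (g : V → V → V → ℝ) :
    let I := ({v | w v ≤ 1 / 4} : Finset V) ×ˢ ({v | ¬ w v ≤ 1 / 4} : Finset V)
    ∑ i ∈ I, ∑ j ∈ I, ∑ k ∈ I,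
      ((4 * w i.2 - 1) * (4 * w j.2 - 1) * (4 * w k.2 - 1) * g i.1 j.1 k.1
      + (1 - 4 * w i.1) * (4 * w j.2 - 1) * (4 * w k.2 - 1) * g i.2 j.1 k.1
      + (1 - 4 * w j.1) * (4 * w i.2 - 1) * (4 * w k.2 - 1) * g i.1 j.2 k.1
      + (1 - 4 * w k.1) * (4 * w i.2 - 1) * (4 * w j.2 - 1) * g i.1 j.1 k.2
      + (1 - 4 * w i.1) * (1 - 4 * w j.1) * (4 * w k.2 - 1) * g i.2 j.2 k.1
      + (1 - 4 * w i.1) * (1 - 4 * w k.1) * (4 * w j.2 - 1) * g i.2 j.1 k.2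
      + (1 - 4 * w j.1) * (1 - 4 * w k.1) * (4 * w i.2 - 1) * g i.1 j.2 k.2
      + (1 - 4 * w i.1) * (1 - 4 * w j.1) * (1 - 4 * w k.1) * g i.2 j.2 k.2) =
    (∑ v with ¬ w v ≤ 1 / 4, (4 * w v - 1)) ^ 3 * ∑ x, ∑ y, ∑ z, g x y z := by
  intro I
  set p := ∑ v with ¬ w v ≤ 1 / 4, (4 * w v - 1)
  have h1 : ∀ x y, ∑ k ∈ I, ((4 * w k.2 - 1) * g x y k.1 + (1 - 4 * w k.1) * g x y k.2) =
      p * ∑ z, g x y z := fun x y => sum_pairs_eq w hw _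
  have h2 : ∀ x, ∑ j ∈ I, ((4 * w j.2 - 1) * (p * ∑ z, g x j.1 z) +
      (1 - 4 * w j.1) * (p * ∑ z, g x j.2 z)) = p * ∑ y, p * ∑ z, g x y z :=
    fun x => sum_pairs_eq w hw (fun y => p * ∑ z, g x y z)
  have h3 := sum_pairs_eq w hw (fun x => p * ∑ y, p * ∑ z, g x y z)
  have h4 : (p ^ 3 * ∑ x, ∑ y, ∑ z, g x y z) = p * ∑ x, p * ∑ y, p * ∑ z, g x y z := by
    simp only [← mul_sum]; ring
  rw [h4, ← h3]
  refine sum_congr rfl fun i _ => ?_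
  rw [← h2, ← h2, mul_sum, mul_sum, ← sum_add_distrib]
  refine sum_congr rfl fun j _ => ?_
  simp only [← h1]
  simp only [mul_sum, ← sum_add_distrib]
  refine sum_congr rfl fun k _ => ?_
  ring

lemma lightTriples_bounds_of_sum_eq (w : V → ℝ) (hw0 : ∀ v, 0 ≤ w v)
    (hw : ∑ v, w v = Fintype.card V / 4) :
    27 / 64 * (Fintype.card V : ℝ) ^ 3 ≤ lightTriples w ∧
    (27 / 64 + 1 / 100) * (Fintype.card V : ℝ) ^ 3 ≤
      lightTriples w + 64 / 2700 * (lightPoints w : ℝ) ^ 3 := by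
  set I := ({v | w v ≤ 1 / 4} : Finset V) ×ˢ ({v | ¬ w v ≤ 1 / 4} : Finset V) with hI
  set p := ∑ v with ¬ w v ≤ 1 / 4, (4 * w v - 1) with hp
  have hp0 : 0 ≤ p := sum_nonneg fun v hv => by
    simp only [mem_filter, mem_univ, true_and, not_le] at hv
    linarith
  rcases hp0.eq_or_lt with h0 | h0
  · have hall : ∀ v, w v = 1 / 4 := by
      have hle : ∀ v, w v ≤ 1 / 4 := by
        intro v
        by_contra hv
        have := (sum_eq_zero_iff_of_nonneg (fun v hv => by
          simp only [mem_filter, mem_univ, true_and, not_le] at hv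
          linarith)).1 (hp.symm.trans h0.symm) v (by simpa using hv)
        push Not at hv
        linarith
      have h1 : ∑ v, (1 / 4 - w v) = 0 := by
        rw [sum_sub_distrib, hw]
        simp
        ring
      intro v
      have := (sum_eq_zero_iff_of_nonneg (fun v _ => by have := hle v; linarith)).1 h1 v (mem_univ v)
      linarith
    have hT : (lightTriples w : ℝ) = (Fintype.card V : ℝ) ^ 3 := by
      rw [lightTriples_eq_sum]
      simp only [hall]
      norm_num
      ring
    have : 0 ≤ (Fintype.card V : ℝ) ^ 3 := by positivity
    have : 0 ≤ (lightPoints w : ℝ) ^ 3 := by positivity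
    rw [hT]
    constructor <;> linarith
  have h3 : 0 < p ^ 3 := by positivity
  have mem : ∀ i ∈ I, 0 ≤ 4 * w i.2 - 1 ∧ 0 ≤ 1 - 4 * w i.1 ∧ 1 - 4 * w i.1 ≤ 1 := by
    intro i hi
    simp only [hI, mem_product, mem_filter, mem_univ, true_and, not_le] at hi
    have := hw0 i.1
    refine ⟨?_, ?_, ?_⟩ <;> linarith
  have e1 : ∑ i ∈ I, ∑ j ∈ I, ∑ k ∈ I, lowWeight (4 * w i.2 - 1) (1 - 4 * w i.1)
      (4 * w j.2 - 1) (1 - 4 * w j.1) (4 * w k.2 - 1) (1 - 4 * w k.1) = p ^ 3 * lightTriples w := by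
    rw [lightTriples_eq_sum]
    refine Eq.trans ?_ (sum_triples_eq w hw fun x y z => if w x + w y + w z < 1 then 1 else 0)
    refine sum_congr rfl fun i hi => sum_congr rfl fun j hj => sum_congr rfl fun k hk => ?_
    have b1 := mem i hi
    have b2 := mem j hj
    have b3 := mem k hk
    unfold lowWeight
    rw [if_pos (c := w i.1 + w j.1 + w k.1 < 1) (by linarith), mul_one]
    simp only [mul_ite, mul_one, mul_zero]
    congr 1; congr 1; congr 1; congr 1; congr 1; congr 1; congr 1
    all_goals
      refine if_congr ?_ rfl rfl
      constructor <;> intro <;> linarith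
  have e2 : ∑ i ∈ I, ∑ j ∈ I, ∑ k ∈ I, ((4 * w i.2 - 1 + (1 - 4 * w i.1)) *
      (4 * w j.2 - 1 + (1 - 4 * w j.1)) * (4 * w k.2 - 1 + (1 - 4 * w k.1))) =
      p ^ 3 * (Fintype.card V : ℝ) ^ 3 := by
    have := sum_triples_eq w hw fun _ _ _ => 1
    simp only [sum_const, card_univ, mul_one, nsmul_eq_mul] at this
    rw [show (Fintype.card V : ℝ) ^ 3 = (Fintype.card V : ℝ) * ((Fintype.card V : ℝ) *
      (Fintype.card V : ℝ)) by ring, ← this]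
    refine sum_congr rfl fun i hi => sum_congr rfl fun j hj => sum_congr rfl fun k hk => ?_
    ring
  set χ : V → ℝ := fun v => if w v ≤ 1 / 5 then 1 else 0 with hχ
  have e3 : ∑ i ∈ I, ∑ j ∈ I, ∑ k ∈ I, (((4 * w i.2 - 1) * χ i.1) *
      ((4 * w j.2 - 1) * χ j.1) * ((4 * w k.2 - 1) * χ k.1)) =
      p ^ 3 * (lightPoints w : ℝ) ^ 3 := by
    have h1 : ∑ i ∈ I, (4 * w i.2 - 1) * χ i.1 = p * lightPoints w := by
      rw [lightPoints_eq_sum, hI, sum_product_right]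
      dsimp only
      rw [← sum_mul_sum, ← hp]
      congr 1
      rw [sum_filter_of_ne]
      intro v _ hv
      by_contra h
      exact hv (if_neg (by linarith))
    simp only [← mul_sum, ← sum_mul, h1]
    ring
  constructor
  · refine le_of_mul_le_mul_left (a := p ^ 3) ?_ h3
    rw [← e1, mul_left_comm, ← e2]
    simp only [mul_sum]
    refine sum_le_sum fun i hi => sum_le_sum fun j hj => sum_le_sum fun k hk => ?_
    obtain ⟨a1, a2, a3⟩ := mem i hi
    obtain ⟨b1, b2, b3⟩ := mem j hj
    obtain ⟨c1, c2, c3⟩ := mem k hk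
    rcases lowWeight_dichotomy a1 b1 c1 a2 b2 c2 a3 b3 c3 with h | h
    · refine le_trans (mul_le_mul_of_nonneg_right (by norm_num) ?_) h
      positivity
    · exact h.2.2.2.2
  · refine le_of_mul_le_mul_left (a := p ^ 3) ?_ h3
    rw [mul_add, ← e1, mul_left_comm, mul_left_comm (p ^ 3), ← e2, ← e3]
    simp only [mul_sum, ← sum_add_distrib]
    refine sum_le_sum fun i hi => sum_le_sum fun j hj => sum_le_sum fun k hk => ?_
    obtain ⟨a1, a2, a3⟩ := mem i hi
    obtain ⟨b1, b2, b3⟩ := mem j hj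
    obtain ⟨c1, c2, c3⟩ := mem k hk
    have hχ0 : ∀ v, 0 ≤ χ v := fun v => by simp only [hχ]; split_ifs <;> norm_num
    rcases lowWeight_dichotomy a1 b1 c1 a2 b2 c2 a3 b3 c3 with h | ⟨u1, u2, u3, u4, u5⟩
    · refine le_trans h (le_add_of_nonneg_right ?_)
      have := hχ0 i.1
      have := hχ0 j.1
      have := hχ0 k.1
      positivity
    · rw [show χ i.1 = 1 from if_pos (by linarith), show χ j.1 = 1 from if_pos (by linarith),
        show χ k.1 = 1 from if_pos (by linarith)]
      rw [u4] at u5 ⊢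
      linarith

lemma lightTriples_mono {w w' : V → ℝ} (h : ∀ v, w v ≤ w' v) :
    lightTriples w' ≤ lightTriples w := by
  refine card_le_card fun p hp => ?_
  simp only [mem_filter, mem_univ, true_and] at hp ⊢
  have := h p.1
  have := h p.2.1
  have := h p.2.2
  linarith

lemma lightPoints_mono {w w' : V → ℝ} (h : ∀ v, w v ≤ w' v) :
    lightPoints w' ≤ lightPoints w := by
  refine card_le_card fun p hp => ?_
  simp only [mem_filter, mem_univ, true_and] at hp ⊢
  exact (h p).trans hp

/-- A weight of mean at most `1/4` has at least `27/64` of the triples light, with a surplus unless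
three quarters of the points are light. -/
theorem lightTriples_bounds (w : V → ℝ) (hw0 : ∀ v, 0 ≤ w v)
    (hw : ∑ v, w v ≤ Fintype.card V / 4) :
    27 / 64 * (Fintype.card V : ℝ) ^ 3 ≤ lightTriples w ∧
    (27 / 64 + 1 / 100) * (Fintype.card V : ℝ) ^ 3 ≤
      lightTriples w + 64 / 2700 * (lightPoints w : ℝ) ^ 3 := by
  classical
  rcases isEmpty_or_nonempty V with hV | ⟨⟨v₀⟩⟩
  · simp
    positivity
  set r := (Fintype.card V : ℝ) / 4 - ∑ v, w v with hr
  have hr0 : 0 ≤ r := by linarith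
  have hle : ∀ v, w v ≤ w v + if v = v₀ then r else 0 := fun v => by split_ifs <;> linarith
  obtain ⟨h1, h2⟩ := lightTriples_bounds_of_sum_eq (fun v => w v + if v = v₀ then r else 0)
    (fun v => (hw0 v).trans (hle v)) (by simp [sum_add_distrib, hr])
  have m1 : (lightTriples (fun v => w v + if v = v₀ then r else 0) : ℝ) ≤ lightTriples w := by
    exact_mod_cast lightTriples_mono hle
  have m2 : (lightPoints (fun v => w v + if v = v₀ then r else 0) : ℝ) ≤ lightPoints w := by
    exact_mod_cast lightPoints_mono hle
  refine ⟨h1.trans m1, h2.trans ?_⟩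
  gcongr

end LightTriples

section Padding

open Finset

variable {V : Type*} [Fintype V]

lemma lightTriples_sumElim_one_le (w : V → ℝ) (hw0 : ∀ v, 0 ≤ w v) (k : ℕ) :
    lightTriples (Sum.elim w fun _ : Fin k => (1 : ℝ)) ≤ lightTriples w := by
  classical
  refine (card_le_card (t := image (fun p : V × V × V => ((Sum.inl p.1, Sum.inl p.2.1, Sum.inl p.2.2) :
    (V ⊕ Fin k) × (V ⊕ Fin k) × (V ⊕ Fin k)))
    {p : V × V × V | w p.1 + w p.2.1 + w p.2.2 < 1}) ?_).trans card_image_le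
  have hnn : ∀ x, 0 ≤ Sum.elim w (fun _ : Fin k => (1 : ℝ)) x := by
    rintro (x | x)
    · exact hw0 x
    · exact zero_le_one
  rintro ⟨x, y, z⟩ h
  simp only [mem_filter, mem_univ, true_and] at h
  have h1 := hnn x
  have h2 := hnn y
  have h3 := hnn z
  rcases x with x | x
  swap
  · simp only [Sum.elim_inr] at h; linarith
  rcases y with y | y
  swap
  · simp only [Sum.elim_inr] at h; linarith
  rcases z with z | z
  swap
  · simp only [Sum.elim_inr] at h; linarith
  simp only [Sum.elim_inl] at h
  exact mem_image.2 ⟨(x, y, z), by simpa using h, rfl⟩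

lemma lightTriples_sumElim_zero_le (w : V → ℝ) (k : ℕ) :
    (lightTriples (Sum.elim w fun _ : Fin k => (0 : ℝ)) : ℝ) ≤
      lightTriples w + ((Fintype.card V + k : ℝ) ^ 3 - (Fintype.card V : ℝ) ^ 3) := by
  classical
  have hinj : Function.Injective (fun p : V × V × V => ((Sum.inl p.1, Sum.inl p.2.1, Sum.inl p.2.2) :
    (V ⊕ Fin k) × (V ⊕ Fin k) × (V ⊕ Fin k))) := by
    rintro ⟨x, y, z⟩ ⟨x', y', z'⟩ h
    simpa using h
  have h1 := card_le_card (s := image (fun p : V × V × V => ((Sum.inl p.1, Sum.inl p.2.1,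
    Sum.inl p.2.2) : (V ⊕ Fin k) × (V ⊕ Fin k) × (V ⊕ Fin k)))
    {p : V × V × V | ¬ w p.1 + w p.2.1 + w p.2.2 < 1})
    (t := {p | ¬ Sum.elim w (fun _ : Fin k => (0 : ℝ)) p.1 +
      Sum.elim w (fun _ : Fin k => (0 : ℝ)) p.2.1 +
      Sum.elim w (fun _ : Fin k => (0 : ℝ)) p.2.2 < 1}) (by
    intro q hq
    obtain ⟨p, hp, rfl⟩ := mem_image.1 hq
    simpa using hp)
  rw [card_image_of_injective _ hinj] at h1
  have h2 := card_filter_add_card_filter_not (s := (univ : Finset (V × V × V)))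
    (fun p => w p.1 + w p.2.1 + w p.2.2 < 1)
  have h3 := card_filter_add_card_filter_not
    (s := (univ : Finset ((V ⊕ Fin k) × (V ⊕ Fin k) × (V ⊕ Fin k))))
    (fun p => Sum.elim w (fun _ : Fin k => (0 : ℝ)) p.1 +
      Sum.elim w (fun _ : Fin k => (0 : ℝ)) p.2.1 +
      Sum.elim w (fun _ : Fin k => (0 : ℝ)) p.2.2 < 1)
  simp only [card_univ, Fintype.card_prod, Fintype.card_sum, Fintype.card_fin] at h2 h3
  unfold lightTriples
  have h1' := (Nat.cast_le (α := ℝ)).2 h1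
  have h2' := congrArg (Nat.cast (R := ℝ)) h2
  have h3' := congrArg (Nat.cast (R := ℝ)) h3
  push_cast at h1' h2' h3'
  linarith

/-- A weight with few light triples has mean almost `1/4`. -/
theorem sum_ge_of_lightTriples_le (w : V → ℝ) (hw0 : ∀ v, 0 ≤ w v) {ε : ℝ} (hε : 0 ≤ ε)
    (hT : (lightTriples w : ℝ) ≤ (27 / 64 + ε) * (Fintype.card V : ℝ) ^ 3) :
    (Fintype.card V : ℝ) / 4 - ε * Fintype.card V - 1 ≤ ∑ v, w v := by
  set n : ℝ := (Fintype.card V : ℝ) with hn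
  have hn0 : 0 ≤ n := by positivity
  by_contra! hlt
  set k := ⌊(n / 4 - ∑ v, w v) * (4 / 3)⌋₊ with hk
  have hk1 : (k : ℝ) ≤ (n / 4 - ∑ v, w v) * (4 / 3) := Nat.floor_le (by nlinarith)
  have hk2 : (n / 4 - ∑ v, w v) * (4 / 3) < k + 1 := Nat.lt_floor_add_one _
  have hb := (lightTriples_bounds (Sum.elim w fun _ : Fin k => (1 : ℝ))
    (by rintro (x | x); exacts [hw0 x, zero_le_one]) (by
      simp only [Fintype.sum_sum_type, Sum.elim_inl, Sum.elim_inr, Fintype.card_sum]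
      simp
      linarith)).1
  have hle := (Nat.cast_le (α := ℝ)).2 (lightTriples_sumElim_one_le w hw0 k)
  simp only [Fintype.card_sum, Fintype.card_fin, Nat.cast_add, ← hn] at hb
  have hkn : ε * n < k := by nlinarith
  have hn' : 0 < n := by
    rcases hn0.eq_or_lt with h | h
    · rw [← h] at hlt
      have := sum_nonneg fun v (_ : v ∈ univ) => hw0 v
      linarith
    · exact h
  have : n ^ 3 + 3 * n ^ 2 * (ε * n) ≤ (n + k) ^ 3 := by
    have : n ^ 2 * (ε * n) ≤ n ^ 2 * k := by gcongr
    nlinarith [mul_nonneg hn0 (sq_nonneg (k : ℝ)), pow_nonneg (Nat.cast_nonneg (α := ℝ) k) 3]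
  have hlt3 : n ^ 2 * (ε * n) < n ^ 2 * k := by gcongr
  have : n ^ 3 + 3 * (n ^ 2 * k) ≤ (n + k) ^ 3 := by
    nlinarith [mul_nonneg hn0 (sq_nonneg (k : ℝ)), pow_nonneg (Nat.cast_nonneg (α := ℝ) k) 3]
  have h0 : 0 ≤ n ^ 2 * (ε * n) := by positivity
  nlinarith

/-- A weight of mean almost `1/4` with few light triples has almost three quarters of its points
light. -/
theorem lightPoints_ge_of_lightTriples_le (w : V → ℝ) (hw0 : ∀ v, 0 ≤ w v) {ε : ℝ} (hε : 0 < ε)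
    (hn : 1 ≤ ε * Fintype.card V)
    (hw : ∑ v, w v ≤ (1 + ε) * (Fintype.card V / 4))
    (hT : (lightTriples w : ℝ) ≤ (27 / 64 + ε) * (Fintype.card V : ℝ) ^ 3) :
    (3 / 4 - 2000 * ε) * (Fintype.card V : ℝ) ≤ lightPoints w := by
  set n : ℝ := (Fintype.card V : ℝ) with hn'
  have hn0 : 0 < n := by by_contra! h; nlinarith
  rcases le_or_gt 1 (2500 * ε) with h | hεs
  · refine le_trans (mul_nonpos_of_nonpos_of_nonneg (by linarith) hn0.le) (by positivity)
  set k := ⌈ε * n⌉₊ with hk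
  have hk1 : ε * n ≤ k := Nat.le_ceil _
  have hk2 : (k : ℝ) < ε * n + 1 := Nat.ceil_lt_add_one (by positivity)
  have hb := (lightTriples_bounds (Sum.elim w fun _ : Fin k => (0 : ℝ))
    (by rintro (x | x); exacts [hw0 x, le_rfl]) (by
      simp only [Fintype.sum_sum_type, Sum.elim_inl, Sum.elim_inr, Fintype.card_sum]
      simp
      linarith)).2
  have hle := lightTriples_sumElim_zero_le w k
  have hp : (lightPoints (Sum.elim w fun _ : Fin k => (0 : ℝ)) : ℝ) = lightPoints w + k := by
    rw [lightPoints_eq_sum, lightPoints_eq_sum, Fintype.sum_sum_type]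
    simp only [Sum.elim_inl, Sum.elim_inr]
    norm_num
  rw [hp] at hb
  simp only [Fintype.card_sum, Fintype.card_fin, Nat.cast_add, ← hn'] at hb hle
  have hkn : (k : ℝ) ≤ 2 * ε * n := by linarith
  have hkn1 : (k : ℝ) ≤ n := by nlinarith
  set ℓ : ℝ := (lightPoints w : ℝ) with hℓ
  have hk0 : (0 : ℝ) ≤ k := by positivity
  have hup : (n + k) ^ 3 - n ^ 3 ≤ 7 * n ^ 2 * k := by
    nlinarith [mul_nonneg hk0 hn0.le, mul_nonneg (mul_nonneg hk0 hn0.le) (sub_nonneg.2 hkn1),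
    mul_nonneg (mul_nonneg hk0 hk0) (sub_nonneg.2 hkn1)]
  have hup2 : n ^ 2 * k ≤ 2 * ε * n ^ 3 := by
    nlinarith [mul_le_mul_of_nonneg_left hkn (sq_nonneg n)]
  have hlow : n ^ 3 ≤ (n + k) ^ 3 := by gcongr; linarith
  have hcube : 27 / 64 * (1 - 2500 * ε) * n ^ 3 ≤ (ℓ + k) ^ 3 := by
    nlinarith
  have hcube' : (3 / 4 * (1 - 2500 * ε) * n) ^ 3 ≤ (ℓ + k) ^ 3 := by
    refine le_trans ?_ hcube
    have h1 : (1 - 2500 * ε) ^ 3 ≤ 1 - 2500 * ε := by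
      have a0 : 0 ≤ 1 - 2500 * ε := by linarith
      have a1 : 1 - 2500 * ε ≤ 1 := by linarith
      simpa using pow_le_of_le_one a0 a1 (n := 3) (by norm_num)
    have := mul_le_mul_of_nonneg_right h1 (show 0 ≤ 27 / 64 * n ^ 3 by positivity)
    nlinarith
  have := le_of_pow_le_pow_left₀ (by norm_num) (by positivity) hcube'
  nlinarith [mul_pos hε hn0]

end Padding

section Duality

open Finset

/-- A Farkas-type alternative for bounded fractional perfect matchings. -/
theorem exists_bounded_solution_or_dual {P ι : Type*} [Fintype P] [Fintype ι]
    (a : ι → P → ℝ) {κ : ℝ} (hκ : 0 ≤ κ) :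
    (∃ x : ι → ℝ, (∀ e, 0 ≤ x e ∧ x e ≤ κ) ∧ ∀ p, ∑ e, x e * a e p = 1) ∨
    ∃ g : P → ℝ, κ * ∑ e, max (∑ p, g p * a e p) 0 < ∑ p, g p := by
  classical
  let load : (ι → ℝ) →ₗ[ℝ] (P → ℝ) :=
    { toFun := fun x p => ∑ e, x e * a e p
      map_add' := fun x y => by ext p; simp [add_mul, sum_add_distrib]
      map_smul' := fun c x => by ext p; simp [mul_assoc, mul_sum] }
  have hcont : Continuous load := LinearMap.continuous_of_finiteDimensional load
  set K : Set (P → ℝ) := load '' Set.Icc (fun _ => 0) (fun _ => κ) with hK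
  have hKc : IsCompact K := isCompact_Icc.image hcont
  have hKconv : Convex ℝ K := (convex_Icc _ _).linear_image load
  by_cases h1 : (fun _ => (1 : ℝ)) ∈ K
  · obtain ⟨x, hx, hx1⟩ := h1
    exact .inl ⟨x, fun e => ⟨hx.1 e, hx.2 e⟩, fun p => congrFun hx1 p⟩
  · right
    obtain ⟨f, u, hfK, hf1⟩ := geometric_hahn_banach_closed_point hKconv hKc.isClosed h1
    have hf : ∀ y, f y = ∑ p, f (Pi.single p 1) * y p := by
      intro y
      have := LinearMap.pi_apply_eq_sum_univ (f : (P → ℝ) →ₗ[ℝ] ℝ) y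
      simp only [smul_eq_mul, ContinuousLinearMap.coe_coe] at this
      rw [this]
      refine sum_congr rfl fun p _ => ?_
      rw [mul_comm]
      congr 2
      ext q
      simp [Pi.single_apply, eq_comm]
    set g : P → ℝ := fun p => f (Pi.single p 1) with hg
    refine ⟨g, ?_⟩
    set x : ι → ℝ := fun e => if 0 ≤ ∑ p, g p * a e p then κ else 0 with hx
    have hxK : load x ∈ K := by
      refine ⟨x, ⟨fun e => ?_, fun e => ?_⟩, rfl⟩ <;> simp only [hx] <;> split_ifs <;> simp [hκ]
    have h2 := hfK _ hxK
    rw [hf] at h2 hf1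
    have h3 : ∑ p, g p * load x p = κ * ∑ e, max (∑ p, g p * a e p) 0 := by
      simp only [load, LinearMap.coe_mk, AddHom.coe_mk, mul_sum]
      rw [sum_comm]
      refine sum_congr rfl fun e _ => ?_
      simp only [hx]
      split_ifs with h
      · rw [max_eq_left h, mul_sum]
        exact sum_congr rfl fun p _ => by ring
      · rw [max_eq_right (by linarith)]
        simp
    simp only [mul_one] at hf1
    linarith

end Duality

section DualObjective

open Finset

variable {Q V : Type*}

/-- Total vertex weight of an ordered coloured 4-tuple. -/
def tupleWeight (w : V → ℝ) (e : Q × V × V × V × V) : ℝ :=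
  w e.2.1 + w e.2.2.1 + w e.2.2.2.1 + w e.2.2.2.2

/-- The dual objective for bounded fractional perfect matchings. -/
noncomputable def dualObjective [Fintype Q] [Fintype V] (T : Finset (Q × V × V × V × V)) (κ : ℝ)
    (b : Q → ℝ) (w : V → ℝ) : ℝ :=
  κ * ∑ e ∈ T, max (b e.1 - tupleWeight w e) 0 - ∑ j, b j + ∑ v, w v

variable [Fintype Q] [Fintype V] {T : Finset (Q × V × V × V × V)} {κ : ℝ}

lemma dualObjective_smul {r : ℝ} (hr : 0 ≤ r) (b : Q → ℝ) (w : V → ℝ) :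
    dualObjective T κ (fun j => r * b j) (fun v => r * w v) = r * dualObjective T κ b w := by
  have h : ∀ e ∈ T, max (r * b e.1 - tupleWeight (fun v => r * w v) e) 0 =
      r * max (b e.1 - tupleWeight w e) 0 := by
    intro e _
    rw [mul_max_of_nonneg _ _ hr, mul_zero]
    unfold tupleWeight
    congr 1
    ring
  unfold dualObjective
  rw [sum_congr rfl h, ← mul_sum, ← mul_sum, ← mul_sum]
  ring

lemma dualObjective_shift (hcard : Fintype.card V = 4 * Fintype.card Q) (r : ℝ)
    (b : Q → ℝ) (w : V → ℝ) :
    dualObjective T κ (fun j => b j - 4 * r) (fun v => w v - r) = dualObjective T κ b w := by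
  have h : ∀ e ∈ T, max (b e.1 - 4 * r - tupleWeight (fun v => w v - r) e) 0 =
      max (b e.1 - tupleWeight w e) 0 := by
    intro e _
    unfold tupleWeight
    congr 1
    ring
  unfold dualObjective
  rw [sum_congr rfl h, sum_sub_distrib, sum_sub_distrib]
  simp [hcard]
  ring

lemma continuous_dualObjective :
    Continuous fun p : (Q → ℝ) × (V → ℝ) => dualObjective T κ p.1 p.2 := by
  unfold dualObjective tupleWeight
  fun_prop

/-- First-order condition for raising the weight of one vertex. -/
lemma card_first_le_of_minimal [DecidableEq V] (hκ : 0 < κ) {b : Q → ℝ} {w : V → ℝ} {v₀ : V}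
    {r : ℝ} (hr : 0 < r)
    (hmin : ∀ h, 0 ≤ h → h ≤ r →
      dualObjective T κ b w ≤ dualObjective T κ b (fun v => w v + if v = v₀ then h else 0)) :
    κ * #{e ∈ T | e.2.1 = v₀ ∧ tupleWeight w e < b e.1} ≤ 1 := by
  set S := {e ∈ T | e.2.1 = v₀ ∧ tupleWeight w e < b e.1} with hS
  obtain ⟨h, hh0, hhr, hgap⟩ : ∃ h, 0 < h ∧ h ≤ r ∧ ∀ e ∈ S, h ≤ b e.1 - tupleWeight w e := by
    rcases S.eq_empty_or_nonempty with he | hne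
    · exact ⟨r, hr, le_rfl, by simp [he]⟩
    · refine ⟨min r (S.inf' hne fun e => b e.1 - tupleWeight w e), ?_, min_le_left _ _, fun e he =>
        (min_le_right _ _).trans (inf'_le _ he)⟩
      refine lt_min hr ?_
      rw [lt_inf'_iff]
      intro e he
      have := (mem_filter.1 he).2.2
      linarith
  have h1 := hmin h hh0.le hhr
  have h2 : ∑ e ∈ T, max (b e.1 - tupleWeight (fun v => w v + if v = v₀ then h else 0) e) 0 ≤
      ∑ e ∈ T, (max (b e.1 - tupleWeight w e) 0 -
        if e.2.1 = v₀ ∧ tupleWeight w e < b e.1 then h else 0) := by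
    refine sum_le_sum fun e he => ?_
    have hnn : ∀ v, 0 ≤ if v = v₀ then h else 0 := fun v => by split_ifs <;> linarith
    have n1 := hnn e.2.1
    have n2 := hnn e.2.2.1
    have n3 := hnn e.2.2.2.1
    have n4 := hnn e.2.2.2.2
    split_ifs with hc
    · have := hgap e (mem_filter.2 ⟨he, hc⟩)
      rw [if_pos hc.1] at n1
      rw [max_eq_left (by linarith : 0 ≤ b e.1 - tupleWeight w e)]
      refine max_le ?_ (by linarith)
      unfold tupleWeight
      dsimp only
      rw [if_pos hc.1]
      linarith
    · rw [sub_zero]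
      refine max_le_max ?_ le_rfl
      unfold tupleWeight
      linarith
  rw [sum_sub_distrib, ← sum_filter, sum_const, nsmul_eq_mul] at h2
  have h3 : ∑ v, (w v + if v = v₀ then h else 0) = ∑ v, w v + h := by
    simp [sum_add_distrib]
  unfold dualObjective at h1
  rw [h3] at h1
  have h4 := mul_le_mul_of_nonneg_left h2 hκ.le
  have h5 : κ * #S * h ≤ 1 * h := by
    rw [hS]
    linarith
  exact le_of_mul_le_mul_right h5 hh0

/-- First-order condition for lowering the potential of one colour. -/
lemma card_colour_le_of_minimal [DecidableEq Q] (hκ : 0 < κ) {b : Q → ℝ} {w : V → ℝ} {j : Q} {r : ℝ}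
    (hr : 0 < r) (hmin : ∀ h, 0 ≤ h → h ≤ r →
      dualObjective T κ b w ≤ dualObjective T κ (fun i => b i - if i = j then h else 0) w) :
    κ * #{e ∈ T | e.1 = j ∧ tupleWeight w e < b e.1} ≤ 1 := by
  set S := {e ∈ T | e.1 = j ∧ tupleWeight w e < b e.1} with hS
  obtain ⟨h, hh0, hhr, hgap⟩ : ∃ h, 0 < h ∧ h ≤ r ∧ ∀ e ∈ S, h ≤ b e.1 - tupleWeight w e := by
    rcases S.eq_empty_or_nonempty with he | hne
    · exact ⟨r, hr, le_rfl, by simp [he]⟩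
    · refine ⟨min r (S.inf' hne fun e => b e.1 - tupleWeight w e), ?_, min_le_left _ _, fun e he =>
        (min_le_right _ _).trans (inf'_le _ he)⟩
      refine lt_min hr ?_
      rw [lt_inf'_iff]
      intro e he
      have := (mem_filter.1 he).2.2
      linarith
  have h1 := hmin h hh0.le hhr
  have h2 : ∑ e ∈ T, max (b e.1 - (if e.1 = j then h else 0) - tupleWeight w e) 0 ≤
      ∑ e ∈ T, (max (b e.1 - tupleWeight w e) 0 -
        if e.1 = j ∧ tupleWeight w e < b e.1 then h else 0) := by
    refine sum_le_sum fun e he => ?_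
    by_cases hc : e.1 = j ∧ tupleWeight w e < b e.1
    · have := hgap e (mem_filter.2 ⟨he, hc⟩)
      rw [if_pos hc, if_pos hc.1, max_eq_left (by linarith : 0 ≤ b e.1 - tupleWeight w e)]
      exact max_le (by linarith) (by linarith)
    · rw [if_neg hc, sub_zero]
      refine max_le_max ?_ le_rfl
      have : 0 ≤ if e.1 = j then h else 0 := by split_ifs <;> linarith
      linarith
  rw [sum_sub_distrib, ← sum_filter, sum_const, nsmul_eq_mul] at h2
  have h3 : ∑ i, (b i - if i = j then h else 0) = ∑ i, b i - h := by
    simp [sum_sub_distrib]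
  unfold dualObjective at h1
  rw [h3] at h1
  have h4 := mul_le_mul_of_nonneg_left h2 hκ.le
  have h5 : κ * #S * h ≤ 1 * h := by
    rw [hS]
    linarith
  exact le_of_mul_le_mul_right h5 hh0

/-- A negative value of the dual objective can be normalised to a nonnegative vertex weight
vanishing somewhere for which few tuples violate the dual constraints. -/
theorem exists_normalised_dual [DecidableEq Q] [DecidableEq V] [Nonempty V] (hκ : 0 < κ)
    (hcard : Fintype.card V = 4 * Fintype.card Q)
    (hT : ∀ j, 1 ≤ κ * #{e ∈ T | e.1 = j})
    (hneg : ∃ b w, dualObjective T κ b w < 0) :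
    ∃ (b : Q → ℝ) (w : V → ℝ) (v₀ : V), (∀ v, 0 ≤ w v) ∧ w v₀ = 0 ∧ ∑ v, w v < ∑ j, b j ∧
      κ * #{e ∈ T | e.2.1 = v₀ ∧ tupleWeight w e < b e.1} ≤ 1 ∧
      ∀ j, 0 < b j → κ * #{e ∈ T | e.1 = j ∧ tupleWeight w e < b e.1} ≤ 1 := by
  set K : Set ((Q → ℝ) × (V → ℝ)) :=
    Set.Icc (fun _ => -8) (fun _ => 8) ×ˢ Set.Icc (fun _ => -1) (fun _ => 1) with hK
  have hKc : IsCompact K := isCompact_Icc.prod isCompact_Icc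
  have hK0 : (0 : (Q → ℝ) × (V → ℝ)) ∈ K := by
    refine ⟨⟨fun _ => ?_, fun _ => ?_⟩, ⟨fun _ => ?_, fun _ => ?_⟩⟩ <;> norm_num
  obtain ⟨⟨b, w⟩, hbw, hmin⟩ := hKc.exists_isMinOn ⟨_, hK0⟩
    (continuous_dualObjective (T := T) (κ := κ)).continuousOn
  obtain ⟨⟨hb1, hb2⟩, ⟨hw1, hw2⟩⟩ := hbw
  dsimp only at hb1 hb2 hw1 hw2
  have hlt : dualObjective T κ b w < 0 := by
    obtain ⟨b₀, w₀, h₀⟩ := hneg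
    set s := 1 + ∑ j, |b₀ j| + ∑ v, |w₀ v| with hs
    have p1 : 0 ≤ ∑ j, |b₀ j| := sum_nonneg fun _ _ => abs_nonneg _
    have p2 : 0 ≤ ∑ v, |w₀ v| := sum_nonneg fun _ _ => abs_nonneg _
    have hs0 : 0 < s := by positivity
    have hb₀ : ∀ j, |s⁻¹ * b₀ j| ≤ 1 := fun j => by
      rw [abs_mul, abs_of_pos (inv_pos.2 hs0), inv_mul_le_iff₀ hs0]
      have := single_le_sum (fun i _ => abs_nonneg (b₀ i)) (mem_univ j)
      linarith
    have hw₀ : ∀ j, |s⁻¹ * w₀ j| ≤ 1 := fun j => by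
      rw [abs_mul, abs_of_pos (inv_pos.2 hs0), inv_mul_le_iff₀ hs0]
      have := single_le_sum (fun i _ => abs_nonneg (w₀ i)) (mem_univ j)
      linarith
    have hmem : ((fun j => s⁻¹ * b₀ j, fun v => s⁻¹ * w₀ v) : (Q → ℝ) × (V → ℝ)) ∈ K :=
      ⟨⟨fun j => by linarith [(abs_le.1 (hb₀ j)).1], fun j => by linarith [(abs_le.1 (hb₀ j)).2]⟩,
        ⟨fun v => (abs_le.1 (hw₀ v)).1, fun v => (abs_le.1 (hw₀ v)).2⟩⟩
    refine lt_of_le_of_lt (hmin hmem) ?_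
    dsimp only
    rw [dualObjective_smul (inv_pos.2 hs0).le]
    exact mul_neg_of_pos_of_neg (inv_pos.2 hs0) h₀
  have hmin' : ∀ b' w', (∀ j, -8 ≤ b' j ∧ b' j ≤ 8) → (∀ v, -1 ≤ w' v ∧ w' v ≤ 1) →
      dualObjective T κ b w ≤ dualObjective T κ b' w' := fun b' w' h1 h2 =>
    hmin (show (b', w') ∈ K from ⟨⟨fun j => (h1 j).1, fun j => (h1 j).2⟩,
      ⟨fun v => (h2 v).1, fun v => (h2 v).2⟩⟩)
  obtain ⟨v₀, -, hv₀⟩ := exists_min_image univ w univ_nonempty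
  have hv1 : w v₀ < 1 := by
    by_contra! h
    have hall : ∀ v, w v = 1 := fun v => le_antisymm (hw2 v) (h.trans (hv₀ v (mem_univ v)))
    have hsum : ∑ e ∈ T, max (b e.1 - tupleWeight w e) 0 =
        ∑ j, #{e ∈ T | e.1 = j} * max (b j - 4) 0 := by
      rw [← sum_fiberwise_of_maps_to (s := T) (t := univ) (g := fun e => e.1) (fun _ _ => mem_univ _)]
      refine sum_congr rfl fun j _ => ?_
      rw [← nsmul_eq_mul, ← sum_const]
      refine sum_congr rfl fun e he => ?_
      rw [(mem_filter.1 he).2]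
      unfold tupleWeight
      simp only [hall]
      norm_num
    have hlow : ∑ j, (b j - 4) ≤ κ * ∑ j, #{e ∈ T | e.1 = j} * max (b j - 4) 0 := by
      rw [mul_sum]
      refine sum_le_sum fun j _ => ?_
      rw [← mul_assoc]
      calc b j - 4 ≤ max (b j - 4) 0 := le_max_left _ _
        _ = 1 * max (b j - 4) 0 := (one_mul _).symm
        _ ≤ _ := mul_le_mul_of_nonneg_right (hT j) (le_max_right _ _)
    have hW : ∑ v, w v = 4 * (Fintype.card Q : ℝ) := by
      simp [hall, hcard]
    have hB : ∑ j, (b j - 4) = ∑ j, b j - 4 * (Fintype.card Q : ℝ) := by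
      simp [sum_sub_distrib]
      ring
    unfold dualObjective at hlt
    rw [hsum, hW] at hlt
    linarith
  have htw : ∀ e : Q × V × V × V × V, tupleWeight (fun v => w v - w v₀) e = tupleWeight w e - 4 * w v₀ := by
    intro e
    unfold tupleWeight
    ring
  have hcond : ∀ e : Q × V × V × V × V, (tupleWeight (fun v => w v - w v₀) e < b e.1 - 4 * w v₀) ↔
      tupleWeight w e < b e.1 := fun e => by rw [htw]; exact sub_lt_sub_iff_right _
  refine ⟨fun j => b j - 4 * w v₀, fun v => w v - w v₀, v₀, fun v => sub_nonneg.2 (hv₀ v (mem_univ v)),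
    sub_self _, ?_, ?_, fun j hj => ?_⟩
  · rw [← dualObjective_shift hcard (w v₀)] at hlt
    unfold dualObjective at hlt
    have : 0 ≤ κ * ∑ e ∈ T, max (b e.1 - 4 * w v₀ - tupleWeight (fun v => w v - w v₀) e) 0 :=
      mul_nonneg hκ.le (sum_nonneg fun _ _ => le_max_right _ _)
    linarith
  · simp only [hcond]
    refine card_first_le_of_minimal hκ (sub_pos.2 hv1) fun h h0 h1 => ?_
    refine hmin' _ _ (fun j => ⟨hb1 j, hb2 j⟩) fun v => ?_
    have := hw1 v
    have := hw2 v
    split_ifs with hv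
    · subst hv; constructor <;> linarith
    · constructor <;> linarith
  · simp only [hcond]
    have := hw1 v₀
    refine card_colour_le_of_minimal hκ (r := b j + 8) (by linarith) fun h h0 h1 => ?_
    refine hmin' _ _ (fun i => ?_) (fun v => ⟨hw1 v, hw2 v⟩)
    have := hb1 i
    have := hb2 i
    split_ifs with hi
    · subst hi; constructor <;> linarith
    · constructor <;> linarith

end DualObjective

section SparseFromDual

open Finset

lemma sum_tupleWeight {Q V : Type*} [Fintype V] (w : V → ℝ) (j : Q) :
    ∑ q : V × V × V × V, tupleWeight w (j, q) = 4 * (Fintype.card V : ℝ) ^ 3 * ∑ v, w v := by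
  unfold tupleWeight
  simp only [Fintype.sum_prod_type, sum_add_distrib, sum_const, card_univ, nsmul_eq_mul,
    ← mul_sum, Fintype.card_prod, Nat.cast_mul]
  ring

variable {Q V : Type*} [Fintype V] [DecidableEq Q] [DecidableEq V]

lemma card_filter_fst_eq {W : Type*} [Fintype W] [DecidableEq W] (T : Finset (Q × W))
    (j : Q) (P : Q × W → Prop) [DecidablePred P] :
    #{e ∈ T | e.1 = j ∧ P e} = #{q : W | (j, q) ∈ T ∧ P (j, q)} := by
  symm
  refine card_bij (fun q _ => (j, q)) ?_ ?_ ?_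
  · intro q hq
    simpa using hq
  · intro q _ q' _ h
    simpa using h
  · rintro ⟨i, q⟩ h
    obtain ⟨h1, rfl, h2⟩ := mem_filter.1 h
    exact ⟨q, by simpa using ⟨h1, h2⟩, rfl⟩

variable [Fintype Q]

lemma card_eq_sum_card_fst {W : Type*} [Fintype W] [DecidableEq W] (T : Finset (Q × W))
    (P : Q × W → Prop) [DecidablePred P] :
    #{e ∈ T | P e} = ∑ j, #{q : W | (j, q) ∈ T ∧ P (j, q)} := by
  rw [card_eq_sum_card_fiberwise (f := fun e : Q × W => e.1) (t := univ) (fun _ _ => by simp)]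
  refine sum_congr rfl fun j _ => ?_
  rw [filter_filter, ← card_filter_fst_eq]
  congr 1
  ext e
  simp [and_comm]

lemma card_filter_second_eq (T : Finset (Q × V × V × V × V)) (v₀ : V)
    (P : Q × V × V × V × V → Prop) [DecidablePred P] :
    #{e ∈ T | e.2.1 = v₀ ∧ P e} =
      ∑ j, #{p : V × V × V | (j, v₀, p) ∈ T ∧ P (j, v₀, p)} := by
  rw [card_eq_sum_card_fst]
  refine sum_congr rfl fun j _ => ?_
  have h := card_filter_fst_eq (univ.filter fun q => (j, q) ∈ T) v₀ (fun q => P (j, q))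
  simp only [mem_filter, mem_univ, true_and] at h
  rw [← h]
  congr 1
  ext e
  simp only [mem_filter, mem_univ, true_and]

lemma mul_card_pow_four_le_card {T : Finset (Q × V × V × V × V)} {c : ℝ} {j : Q}
    (hdeg : ∀ v, c * (Fintype.card V : ℝ) ^ 3 ≤ #{p : V × V × V | (j, v, p) ∈ T}) :
    c * (Fintype.card V : ℝ) ^ 4 ≤ #{q : V × V × V × V | (j, q) ∈ T} := by
  have h2 := card_eq_sum_card_fst (univ.filter fun q : V × V × V × V => (j, q) ∈ T)
    (fun _ => True)
  simp only [filter_true, mem_filter, mem_univ, true_and, and_true] at h2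
  rw [h2]
  push_cast
  calc c * (Fintype.card V : ℝ) ^ 4 = ∑ v : V, c * (Fintype.card V : ℝ) ^ 3 := by
        rw [sum_const, card_univ, nsmul_eq_mul]; ring
    _ ≤ _ := sum_le_sum fun v _ => hdeg v

set_option maxHeartbeats 1000000 in
/-- A normalised dual certificate forces a sparse set of almost three quarters of the vertices. -/
theorem exists_sparse_of_dual {T : Finset (Q × V × V × V × V)} {ε : ℝ} (hε : 0 < ε)
    (hε1 : ε ≤ 1 / 100) (hn : 1 ≤ ε * Fintype.card V)
    (hcard : Fintype.card V = 4 * Fintype.card Q)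
    (hdeg : ∀ j v, (37 / 64 - ε) * (Fintype.card V : ℝ) ^ 3 ≤
      #{p : V × V × V | (j, v, p) ∈ T})
    {b : Q → ℝ} {w : V → ℝ} {v₀ : V} (hw0 : ∀ v, 0 ≤ w v) (hv₀ : w v₀ = 0)
    (hsum : ∑ v, w v < ∑ j, b j)
    (hv : 100 / ε ^ 2 / (Fintype.card V : ℝ) ^ 4 *
      #{e ∈ T | e.2.1 = v₀ ∧ tupleWeight w e < b e.1} ≤ 1)
    (hj : ∀ j, 0 < b j → 100 / ε ^ 2 / (Fintype.card V : ℝ) ^ 4 *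
      #{e ∈ T | e.1 = j ∧ tupleWeight w e < b e.1} ≤ 1) :
    ∃ U : Finset V, (3 / 4 - 4000 * ε) * (Fintype.card V : ℝ) ≤ #U ∧
      (#{e ∈ T | e.2.1 ∈ U ∧ e.2.2.1 ∈ U ∧ e.2.2.2.1 ∈ U ∧ e.2.2.2.2 ∈ U} : ℝ) ≤
        17 * ε * (Fintype.card V : ℝ) ^ 5 := by
  set n : ℝ := (Fintype.card V : ℝ) with hn'
  set m : ℝ := (Fintype.card Q : ℝ) with hm'
  have hnm : n = 4 * m := by rw [hn', hcard, hm']; push_cast; ring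
  have hn0 : 0 < n := by by_contra! h; nlinarith
  have hm0 : 0 < m := by linarith
  have conv : ∀ x : ℝ, 100 / ε ^ 2 / n ^ 4 * x ≤ 1 → x ≤ ε ^ 2 / 100 * n ^ 4 := by
    intro x hx
    rw [div_div, div_mul_eq_mul_div, div_le_one (by positivity)] at hx
    linarith
  have hj' : ∀ j, 0 < b j → (#{q : V × V × V × V | (j, q) ∈ T ∧ tupleWeight w (j, q) < b j} : ℝ)
      ≤ ε ^ 2 / 100 * n ^ 4 := by
    intro j hbj
    have := conv _ (hj j hbj)
    rwa [card_filter_fst_eq T j (fun e => tupleWeight w e < b e.1)] at this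
  -- few colours see many violated triples at `v₀`
  set B : Finset Q := {j | ε * n ^ 3 < #{p : V × V × V | (j, v₀, p) ∈ T ∧
    tupleWeight w (j, v₀, p) < b j}} with hB
  have hBcard : (#B : ℝ) ≤ ε / 25 * m := by
    have h1 := conv _ hv
    rw [card_filter_second_eq T v₀ (fun e => tupleWeight w e < b e.1)] at h1
    push_cast at h1
    have h2 : (#B : ℝ) * (ε * n ^ 3) ≤ ∑ j, (#{p : V × V × V | (j, v₀, p) ∈ T ∧
        tupleWeight w (j, v₀, p) < b j} : ℝ) := by
      rw [← nsmul_eq_mul, ← sum_const]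
      exact (sum_le_sum fun j hj => ((mem_filter.1 hj).2).le).trans
        (sum_le_sum_of_subset_of_nonneg (subset_univ _) fun _ _ _ => Nat.cast_nonneg _)
    have h3 : (#B : ℝ) * (ε * n ^ 3) ≤ (ε / 25 * m) * (ε * n ^ 3) := by
      refine h2.trans (h1.trans (le_of_eq ?_))
      rw [hnm]; ring
    exact le_of_mul_le_mul_right h3 (by positivity)
  have hW0 : 0 ≤ ∑ v, w v := sum_nonneg fun v _ => hw0 v
  have hQ : (univ : Finset Q).Nonempty := by
    rw [univ_nonempty_iff, ← Fintype.card_pos_iff]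
    rw [hm'] at hm0
    exact_mod_cast hm0
  obtain ⟨j₁, -, hj₁⟩ := exists_max_image univ b hQ
  set β := b j₁ with hβ
  have hsumle : ∑ j, b j ≤ m * β := by
    have := sum_le_card_nsmul univ b β (fun j hj => hj₁ j hj)
    simpa using this
  have hβ0 : 0 < β := by
    by_contra! h
    nlinarith
  have hWβ : β * m / 4 ≤ ∑ v, w v := by
    have h1 : ((37 / 64 - ε) * n ^ 4 : ℝ) ≤ #{q : V × V × V × V | (j₁, q) ∈ T} :=
      mul_card_pow_four_le_card (hdeg j₁)
    have h3 : (#{q : V × V × V × V | (j₁, q) ∈ T} : ℝ) * β -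
        #{q : V × V × V × V | (j₁, q) ∈ T ∧ tupleWeight w (j₁, q) < b j₁} * β ≤
        ∑ q : V × V × V × V, tupleWeight w (j₁, q) := by
      rw [card_filter, card_filter]
      push_cast
      rw [sum_mul, sum_mul, ← sum_sub_distrib]
      refine sum_le_sum fun q _ => ?_
      have hq : 0 ≤ tupleWeight w (j₁, q) := by
        unfold tupleWeight
        have := hw0 q.1
        have := hw0 q.2.1
        have := hw0 q.2.2.1
        have := hw0 q.2.2.2
        positivity
      by_cases c1 : (j₁, q) ∈ T <;> by_cases c2 : tupleWeight w (j₁, q) < b j₁ <;>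
        simp only [c1, c2, and_true, and_false, if_true, if_false] <;> linarith
    rw [sum_tupleWeight, ← hn'] at h3
    have h4 := hj' j₁ hβ0
    have h5 : n ^ 3 * (n / 4 * β) ≤ n ^ 3 * (4 * ∑ v, w v) := by
      have h6 : 1 / 4 * n ^ 4 ≤ (37 / 64 - ε) * n ^ 4 - ε ^ 2 / 100 * n ^ 4 := by
        rw [← sub_mul]
        refine mul_le_mul_of_nonneg_right ?_ (by positivity)
        nlinarith
      have h7 : 1 / 4 * n ^ 4 * β ≤ (#{q : V × V × V × V | (j₁, q) ∈ T} : ℝ) * β -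
        #{q : V × V × V × V | (j₁, q) ∈ T ∧ tupleWeight w (j₁, q) < b j₁} * β := by
        rw [← sub_mul]
        refine mul_le_mul_of_nonneg_right ?_ hβ0.le
        linarith
      linarith
    have h8 := le_of_mul_le_mul_left h5 (by positivity)
    rw [hnm] at h8
    linarith
  have hBm : (#B : ℝ) < m := by nlinarith
  have hG : (Bᶜ : Finset Q).Nonempty := by
    rw [← card_pos, card_compl, Nat.sub_pos_iff_lt]
    rw [hm'] at hBm
    exact_mod_cast hBm
  obtain ⟨j₂, hj₂B, hj₂⟩ := exists_max_image Bᶜ b hG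
  set β' := b j₂ with hβ'
  have hsplit : ∑ j, b j = ∑ j ∈ B, b j + ∑ j ∈ Bᶜ, b j := (sum_add_sum_compl B b).symm
  have hBsum : ∑ j ∈ B, b j ≤ #B * β := by
    have := sum_le_card_nsmul B b β (fun j _ => hj₁ j (mem_univ j))
    simpa using this
  have hGsum : ∑ j ∈ Bᶜ, b j ≤ #Bᶜ * β' := by
    have := sum_le_card_nsmul Bᶜ b β' hj₂
    simpa using this
  have hBc : (#Bᶜ : ℝ) ≤ m := (Nat.cast_le (α := ℝ)).2 (card_le_univ _)
  have hBβ : #B * β ≤ ε / 25 * m * β := mul_le_mul_of_nonneg_right hBcard hβ0.le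
  have hmβ : 0 < m * β := by positivity
  have hβ'0 : 0 < β' := by
    by_contra! h
    have : (#Bᶜ : ℝ) * β' ≤ 0 := mul_nonpos_of_nonneg_of_nonpos (by positivity) h
    nlinarith
  have hGm : (#Bᶜ : ℝ) * β' ≤ m * β' := mul_le_mul_of_nonneg_right hBc hβ'0.le
  have hββ : β ≤ 5 * β' := by
    have : m * β ≤ m * (5 * β') := by nlinarith
    exact le_of_mul_le_mul_left this hm0
  have hBβ' : #B * β ≤ ε / 5 * (m * β') := by
    nlinarith [mul_le_mul_of_nonneg_left hββ (show 0 ≤ ε / 25 * m by positivity)]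
  -- rescale by `β'`
  set ŵ : V → ℝ := fun v => w v / β' with hŵ
  have hŵ0 : ∀ v, 0 ≤ ŵ v := fun v => div_nonneg (hw0 v) hβ'0.le
  have hŵsum : ∑ v, ŵ v = (∑ v, w v) / β' := (sum_div _ _ _).symm
  have hT : (lightTriples ŵ : ℝ) ≤ (27 / 64 + 2 * ε) * n ^ 3 := by
    have h1 : (#{p : V × V × V | (j₂, v₀, p) ∈ T ∧ tupleWeight w (j₂, v₀, p) < b j₂} : ℝ) ≤
        ε * n ^ 3 := by
      by_contra! h
      exact (mem_compl.1 hj₂B) (mem_filter.2 ⟨mem_univ _, h⟩)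
    have h2 : lightTriples ŵ + #{p : V × V × V | (j₂, v₀, p) ∈ T} ≤
        #{p : V × V × V | (j₂, v₀, p) ∈ T ∧ tupleWeight w (j₂, v₀, p) < b j₂} +
          Fintype.card (V × V × V) := by
      have h3 := card_union_add_card_inter {p : V × V × V | ŵ p.1 + ŵ p.2.1 + ŵ p.2.2 < 1}
        {p : V × V × V | (j₂, v₀, p) ∈ T}
      rw [lightTriples, ← h3, add_comm]
      refine Nat.add_le_add (card_le_card fun p hp => ?_) (card_le_univ _)
      simp only [mem_inter, mem_filter, mem_univ, true_and] at hp ⊢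
      refine ⟨hp.2, ?_⟩
      have h4 := hp.1
      simp only [hŵ] at h4
      rw [← add_div, ← add_div, div_lt_one hβ'0] at h4
      unfold tupleWeight
      dsimp only
      rw [hv₀]
      linarith
    have h3 := (Nat.cast_le (α := ℝ)).2 h2
    simp only [Fintype.card_prod] at h3
    push_cast at h3
    have h4 := hdeg j₂ v₀
    rw [← hn'] at h3
    have h5 : n * (n * n) = n ^ 3 := by ring
    rw [h5] at h3
    linarith
  have hUp : ∑ v, ŵ v ≤ (1 + 2 * ε) * (n / 4) := by
    rw [hŵsum, div_le_iff₀ hβ'0, hnm]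
    nlinarith [mul_pos hm0 hβ'0]
  have hLow := sum_ge_of_lightTriples_le ŵ hŵ0 (by positivity) hT
  have hPts := lightPoints_ge_of_lightTriples_le ŵ hŵ0 (ε := 2 * ε) (by positivity) (by linarith)
    hUp hT
  rw [hŵsum, le_div_iff₀ hβ'0, ← hn'] at hLow
  -- few colours have small potential
  set J : Finset Q := {j | b j ≤ 4 / 5 * β'} with hJ
  have hJcard : (#J : ℝ) ≤ 65 * ε * m := by
    have h1 : ∑ j, b j ≤ ∑ j, (β' - (if j ∈ J then β' / 5 else 0) + if j ∈ B then β else 0) := by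
      refine sum_le_sum fun j _ => ?_
      by_cases hjB : j ∈ B
      · rw [if_pos hjB]
        have := hj₁ j (mem_univ j)
        split_ifs <;> linarith
      · rw [if_neg hjB]
        split_ifs with h
        · have := (mem_filter.1 h).2
          linarith
        · have := hj₂ j (mem_compl.2 hjB)
          linarith
    have h2 : ∑ j, (β' - (if j ∈ J then β' / 5 else 0) + if j ∈ B then β else 0) =
        m * β' - #J * (β' / 5) + #B * β := by
      simp [sum_add_distrib, sum_sub_distrib, hm']
    have h3 : (#J : ℝ) * (β' / 5) ≤ 65 * ε * m * (β' / 5) := by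
      have : 1 * β' ≤ ε * n * β' := mul_le_mul_of_nonneg_right hn hβ'0.le
      rw [hnm] at hLow this
      nlinarith
    exact le_of_mul_le_mul_right h3 (by positivity)
  refine ⟨univ.filter fun v => ŵ v ≤ 1 / 5, ?_, ?_⟩
  · refine le_trans ?_ hPts
    rw [show 2000 * (2 * ε) = 4000 * ε by ring]
  · rw [card_eq_sum_card_fst]
    push_cast
    have h1 : ∀ j, (#{q : V × V × V × V | (j, q) ∈ T ∧
        q.1 ∈ univ.filter (fun v => ŵ v ≤ 1 / 5) ∧ q.2.1 ∈ univ.filter (fun v => ŵ v ≤ 1 / 5) ∧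
        q.2.2.1 ∈ univ.filter (fun v => ŵ v ≤ 1 / 5) ∧
        q.2.2.2 ∈ univ.filter (fun v => ŵ v ≤ 1 / 5)} : ℝ) ≤
        ε ^ 2 / 100 * n ^ 4 + if j ∈ J then n ^ 4 else 0 := by
      intro j
      by_cases hjJ : j ∈ J
      · rw [if_pos hjJ]
        refine le_trans ((Nat.cast_le (α := ℝ)).2 (card_le_univ _)) ?_
        simp only [Fintype.card_prod]
        push_cast
        rw [← hn']
        have : 0 ≤ ε ^ 2 / 100 * n ^ 4 := by positivity
        nlinarith
      · rw [if_neg hjJ, add_zero]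
        have hbj : 4 / 5 * β' < b j := by
          by_contra! h
          exact hjJ (mem_filter.2 ⟨mem_univ _, h⟩)
        refine le_trans ?_ (hj' j (by linarith))
        refine (Nat.cast_le (α := ℝ)).2 (card_le_card fun q hq => ?_)
        simp only [mem_filter, mem_univ, true_and, hŵ, div_le_iff₀ hβ'0] at hq ⊢
        refine ⟨hq.1, ?_⟩
        unfold tupleWeight
        dsimp only
        linarith [hq.2.1, hq.2.2.1, hq.2.2.2.1, hq.2.2.2.2]
    refine (sum_le_sum fun j _ => h1 j).trans ?_
    rw [sum_add_distrib]
    simp only [sum_const, card_univ, nsmul_eq_mul, sum_ite_mem, univ_inter]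
    have h2 : (#J : ℝ) * n ^ 4 ≤ 65 * ε * m * n ^ 4 :=
      mul_le_mul_of_nonneg_right hJcard (by positivity)
    have h3 : ε ^ 2 / 100 ≤ ε := by nlinarith
    have h4 : m * (ε ^ 2 / 100 * n ^ 4) ≤ m * (ε * n ^ 4) := by gcongr
    have h5 : m = n / 4 := by linarith
    rw [h5] at h2 h4
    rw [← hm', h5]
    have h6 : 0 ≤ ε * n ^ 5 := by positivity
    nlinarith

/-- Either there is a bounded fractional perfect matching, or almost three quarters of the vertices
span few edges. -/
theorem exists_fractional_or_sparse {T : Finset (Q × V × V × V × V)} {ε : ℝ} (hε : 0 < ε)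
    (hε1 : ε ≤ 1 / 100) (hn : 1 ≤ ε * Fintype.card V)
    (hcard : Fintype.card V = 4 * Fintype.card Q)
    (hdeg : ∀ j v, (37 / 64 - ε) * (Fintype.card V : ℝ) ^ 3 ≤
      #{p : V × V × V | (j, v, p) ∈ T}) :
    (∃ x : Q × V × V × V × V → ℝ,
      (∀ e, 0 ≤ x e ∧ x e ≤ 100 / ε ^ 2 / (Fintype.card V : ℝ) ^ 4) ∧ (∀ e, e ∉ T → x e = 0) ∧
      (∀ j, ∑ e, x e * (if e.1 = j then 1 else 0) = 1) ∧
      ∀ v, ∑ e, x e * ((if e.2.1 = v then 1 else 0) + (if e.2.2.1 = v then 1 else 0) +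
        (if e.2.2.2.1 = v then 1 else 0) + (if e.2.2.2.2 = v then 1 else 0)) = 1) ∨
    ∃ U : Finset V, (3 / 4 - 4000 * ε) * (Fintype.card V : ℝ) ≤ #U ∧
      (#{e ∈ T | e.2.1 ∈ U ∧ e.2.2.1 ∈ U ∧ e.2.2.2.1 ∈ U ∧ e.2.2.2.2 ∈ U} : ℝ) ≤
        17 * ε * (Fintype.card V : ℝ) ^ 5 := by
  have hn0 : 0 < (Fintype.card V : ℝ) := by by_contra! h; nlinarith
  have : Nonempty V := Fintype.card_pos_iff.1 (by exact_mod_cast hn0)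
  set κ : ℝ := 100 / ε ^ 2 / (Fintype.card V : ℝ) ^ 4 with hκ
  have hκ0 : 0 < κ := by positivity
  set a : Q × V × V × V × V → Q ⊕ V → ℝ := fun e => Sum.elim
    (fun j => if e ∈ T then (if e.1 = j then 1 else 0) else 0)
    (fun v => if e ∈ T then ((if e.2.1 = v then 1 else 0) + (if e.2.2.1 = v then 1 else 0) +
        (if e.2.2.2.1 = v then 1 else 0) + (if e.2.2.2.2 = v then 1 else 0)) else 0) with ha
  rcases exists_bounded_solution_or_dual a hκ0.le with ⟨x, hx, hload⟩ | ⟨g, hg⟩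
  · left
    refine ⟨fun e => if e ∈ T then x e else 0, fun e => ?_, fun e he => if_neg he, fun j => ?_,
      fun v => ?_⟩
    · dsimp only
      split_ifs
      · exact hx e
      · exact ⟨le_rfl, hκ0.le⟩
    · refine Eq.trans ?_ (hload (Sum.inl j))
      refine sum_congr rfl fun e _ => ?_
      simp only [ha, Sum.elim_inl]
      by_cases he : e ∈ T <;> simp [he]
    · refine Eq.trans ?_ (hload (Sum.inr v))
      refine sum_congr rfl fun e _ => ?_
      simp only [ha, Sum.elim_inr]
      by_cases he : e ∈ T <;> simp [he]
  · right
    have hobj : ∃ b w, dualObjective T κ b w < 0 := by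
      refine ⟨fun j => g (Sum.inl j), fun v => - g (Sum.inr v), ?_⟩
      have h1 : ∑ e, max (∑ p, g p * a e p) 0 =
          ∑ e ∈ T, max (g (Sum.inl e.1) - tupleWeight (fun v => - g (Sum.inr v)) e) 0 := by
        rw [← sum_filter_add_sum_filter_not univ (fun e => e ∈ T)]
        rw [sum_eq_zero (s := univ.filter fun e => ¬ e ∈ T), add_zero]
        · refine sum_congr (by ext; simp) fun e he => ?_
          congr 1
          rw [Fintype.sum_sum_type]
          simp only [ha, Sum.elim_inl, Sum.elim_inr, if_pos he, mul_add, sum_add_distrib, mul_ite,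
            mul_one, mul_zero, sum_ite_eq, mem_univ, if_true, tupleWeight]
          ring
        · intro e he
          have he' : e ∉ T := by simpa using he
          rw [Fintype.sum_sum_type]
          simp [ha, he']
      unfold dualObjective
      rw [← h1, sum_neg_distrib]
      rw [Fintype.sum_sum_type] at hg
      linarith
    obtain ⟨b, w, v₀, h1, h2, h3, h4, h5⟩ := exists_normalised_dual hκ0 hcard (fun j => by
      have h1 := mul_card_pow_four_le_card (hdeg j)
      have h2 := card_filter_fst_eq T j (fun _ => True)
      simp only [and_true] at h2
      rw [h2, hκ]
      refine le_trans ?_ (mul_le_mul_of_nonneg_left h1 (by positivity))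
      rw [div_div, div_mul_eq_mul_div, le_div_iff₀ (by positivity), one_mul]
      have h3 : ε ^ 2 ≤ 100 * (37 / 64 - ε) := by nlinarith
      nlinarith [mul_le_mul_of_nonneg_right h3 (show 0 ≤ (Fintype.card V : ℝ) ^ 4 by positivity)])
      hobj
    exact exists_sparse_of_dual hε hε1 hn hcard hdeg h1 h2 h3 h4 h5

end SparseFromDual

section Tiling

open Finset

/-- `Tiled s A` says that `A` is a disjoint union of some of the sets `s i`. -/
inductive Tiled {P ι : Type*} [DecidableEq P] (s : ι → Finset P) : Finset P → Prop
  | empty : Tiled s ∅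
  | cons (A : Finset P) (i : ι) : Tiled s A → Disjoint A (s i) → Tiled s (A ∪ s i)

variable {P ι : Type*} [DecidableEq P] {s : ι → Finset P}

lemma Tiled.union {A B : Finset P} (hA : Tiled s A) (hB : Tiled s B) (hAB : Disjoint A B) :
    Tiled s (A ∪ B) := by
  induction hB with
  | empty => simpa using hA
  | cons B i _ hi ih =>
    rw [disjoint_union_right] at hAB
    rw [← union_assoc]
    exact Tiled.cons _ i (ih hAB.1) (disjoint_union_left.2 ⟨hAB.2, hi⟩)

lemma Tiled.of_edge (i : ι) : Tiled s (s i) := by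
  simpa using Tiled.cons ∅ i Tiled.empty (disjoint_empty_left _)

end Tiling

section GreedyMatching

open Finset

variable {P ι : Type*} [DecidableEq P] [Fintype ι] (s : ι → Finset P) (x : ι → ℝ)

/-- Indices of the edges contained in `A`. -/
def edgesIn (A : Finset P) : Finset ι := {i | s i ⊆ A}

/-- Weighted degree of `v` in the hypergraph induced on `A`. -/
def wdeg (A : Finset P) (v : P) : ℝ := ∑ i ∈ edgesIn s A, if v ∈ s i then x i else 0

/-- Weighted codegree of `u` and `v` in the hypergraph induced on `A`. -/
def wcodeg (A : Finset P) (u v : P) : ℝ :=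
  ∑ i ∈ edgesIn s A, if v ∈ s i then (if u ∈ s i then x i else 0) else 0

/-- Weighted degree of a triple of points. -/
def wtriple (u u' v : P) : ℝ :=
  ∑ i, if v ∈ s i then (if u ∈ s i ∧ u' ∈ s i then x i else 0) else 0

/-- Sum over the points of an edge of their codegrees with `v`. -/
def wloss (A : Finset P) (v : P) (i : ι) : ℝ := ∑ u ∈ (s i).erase v, wcodeg s x A u v

variable {s x}

lemma wdeg_nonneg (hx : ∀ i, 0 ≤ x i) (A : Finset P) (v : P) : 0 ≤ wdeg s x A v :=
  sum_nonneg fun i _ => by split_ifs <;> simp [hx]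

lemma wdeg_le_univ [Fintype P] (hx : ∀ i, 0 ≤ x i) (A : Finset P) (v : P) :
    wdeg s x A v ≤ wdeg s x univ v :=
  sum_le_sum_of_subset_of_nonneg (fun i _ => by simp [edgesIn])
    fun i _ _ => by split_ifs <;> simp [hx]

lemma wcodeg_nonneg (hx : ∀ i, 0 ≤ x i) (A : Finset P) (u v : P) : 0 ≤ wcodeg s x A u v :=
  sum_nonneg fun i _ => by split_ifs <;> simp [hx]

lemma wcodeg_le_univ [Fintype P] (hx : ∀ i, 0 ≤ x i) (A : Finset P) (u v : P) :
    wcodeg s x A u v ≤ wcodeg s x univ u v :=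
  sum_le_sum_of_subset_of_nonneg (fun i _ => by simp [edgesIn])
    fun i _ _ => by split_ifs <;> simp [hx]

lemma sum_wdeg (hs : ∀ i, #(s i) = 5) (A : Finset P) :
    ∑ v ∈ A, wdeg s x A v = 5 * ∑ i ∈ edgesIn s A, x i := by
  unfold wdeg
  rw [sum_comm, mul_sum]
  refine sum_congr rfl fun i hi => ?_
  rw [← sum_filter, filter_mem_eq_inter, inter_eq_right.2 (by simpa [edgesIn] using hi), sum_const,
    hs, nsmul_eq_mul]
  norm_num

lemma sum_wcodeg (hs : ∀ i, #(s i) = 5) (A : Finset P) (v : P) :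
    ∑ u ∈ A.erase v, wcodeg s x A u v = 4 * wdeg s x A v := by
  unfold wcodeg wdeg
  rw [sum_comm, mul_sum]
  refine sum_congr rfl fun i hi => ?_
  by_cases hv : v ∈ s i
  · simp only [hv, if_true]
    rw [← sum_filter, filter_mem_eq_inter, erase_inter,
      inter_eq_right.2 (by simpa [edgesIn] using hi), sum_const, card_erase_of_mem hv, hs,
      nsmul_eq_mul]
    norm_num
  · simp [hv]

lemma sum_mul_wloss (A : Finset P) (v : P) :
    ∑ i ∈ edgesIn s A, x i * wloss s x A v i =
      ∑ u ∈ A.erase v, wdeg s x A u * wcodeg s x A u v := by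
  unfold wloss wdeg
  simp only [sum_mul]
  rw [sum_comm]
  refine sum_congr rfl fun i hi => ?_
  have : (s i).erase v = (A.erase v).filter fun u => u ∈ s i := by
    rw [filter_mem_eq_inter, erase_inter, inter_eq_right.2 (by simpa [edgesIn] using hi)]
  rw [this, sum_filter, mul_sum]
  refine sum_congr rfl fun u _ => ?_
  split_ifs <;> simp

lemma wdeg_sdiff_bounds (hx : ∀ i, 0 ≤ x i) (A : Finset P) {v : P} {i : ι} (hv : v ∉ s i) :
    wdeg s x A v - wloss s x A v i ≤ wdeg s x (A \ s i) v ∧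
    wdeg s x (A \ s i) v ≤ wdeg s x A v - wloss s x A v i +
      ∑ u ∈ s i, ∑ u' ∈ (s i).erase u, wtriple s x u u' v := by
  have hsub : edgesIn s (A \ s i) = (edgesIn s A).filter fun f => Disjoint (s f) (s i) := by
    ext f; simp [edgesIn, subset_sdiff]
  have h1 : wdeg s x (A \ s i) v = ∑ f ∈ edgesIn s A,
      if v ∈ s f then (if Disjoint (s f) (s i) then x f else 0) else 0 := by
    unfold wdeg
    rw [hsub, sum_filter]
    refine sum_congr rfl fun f _ => ?_
    split_ifs <;> rfl
  have h2 : wloss s x A v i = ∑ f ∈ edgesIn s A,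
      if v ∈ s f then (#(s f ∩ s i) : ℝ) * x f else 0 := by
    unfold wloss wcodeg
    rw [sum_comm, erase_eq_of_notMem hv]
    refine sum_congr rfl fun f _ => ?_
    by_cases hvf : v ∈ s f
    · simp only [hvf, if_true]
      rw [← sum_filter, filter_mem_eq_inter, sum_const, nsmul_eq_mul, inter_comm]
    · simp [hvf]
  have h3 : ∑ f ∈ edgesIn s A, (if v ∈ s f then
      (#(s f ∩ s i) : ℝ) * ((#(s f ∩ s i) : ℝ) - 1) * x f else 0) ≤
      ∑ u ∈ s i, ∑ u' ∈ (s i).erase u, wtriple s x u u' v := by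
    have h4 : ∑ u ∈ s i, ∑ u' ∈ (s i).erase u, wtriple s x u u' v =
        ∑ f, (if v ∈ s f then
          (#(s f ∩ s i) : ℝ) * ((#(s f ∩ s i) : ℝ) - 1) * x f else 0) := by
      unfold wtriple
      simp_rw [sum_comm (s := (s i).erase _)]
      rw [sum_comm]
      refine sum_congr rfl fun f _ => ?_
      by_cases hvf : v ∈ s f
      · simp only [hvf, if_true]
        have h5 : ∀ u ∈ s i, ∑ u' ∈ (s i).erase u, (if u ∈ s f ∧ u' ∈ s f then x f else 0) =
            if u ∈ s f then ((#(s f ∩ s i) : ℝ) - 1) * x f else 0 := by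
          intro u hu
          by_cases huf : u ∈ s f
          · simp only [huf, true_and, if_true]
            rw [← sum_filter, filter_mem_eq_inter, erase_inter, sum_const, nsmul_eq_mul,
              card_erase_of_mem (by simp [hu, huf]), inter_comm (s i)]
            have : 1 ≤ #(s f ∩ s i) := card_pos.2 ⟨u, by simp [hu, huf]⟩
            push_cast [this]
            rfl
          · simp [huf]
        rw [sum_congr rfl h5, ← sum_filter, filter_mem_eq_inter, sum_const, nsmul_eq_mul,
          inter_comm (s i)]
        ring
      · simp [hvf]
    rw [h4]
    refine sum_le_sum_of_subset_of_nonneg (subset_univ _) fun f _ _ => ?_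
    split_ifs
    · refine mul_nonneg ?_ (hx f)
      rcases Nat.eq_zero_or_pos #(s f ∩ s i) with h | h
      · simp [h]
      · have : (1 : ℝ) ≤ #(s f ∩ s i) := by exact_mod_cast h
        nlinarith
    · exact le_rfl
  have h6 : wdeg s x A v = ∑ f ∈ edgesIn s A, if v ∈ s f then x f else 0 := rfl
  have key : ∀ f, (if v ∈ s f then x f else 0) -
        (if v ∈ s f then (#(s f ∩ s i) : ℝ) * x f else 0) ≤
        (if v ∈ s f then (if Disjoint (s f) (s i) then x f else 0) else 0) ∧
      (if v ∈ s f then (if Disjoint (s f) (s i) then x f else 0) else 0) ≤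
        (if v ∈ s f then x f else 0) - (if v ∈ s f then (#(s f ∩ s i) : ℝ) * x f else 0) +
        (if v ∈ s f then (#(s f ∩ s i) : ℝ) * ((#(s f ∩ s i) : ℝ) - 1) * x f else 0) := by
    intro f
    by_cases hvf : v ∈ s f
    · simp only [hvf, if_true]
      by_cases hd : Disjoint (s f) (s i)
      · simp [hd, disjoint_iff_inter_eq_empty.1 hd]
      · simp only [hd, if_false]
        have : (1 : ℝ) ≤ #(s f ∩ s i) := by
          exact_mod_cast card_pos.2 (not_disjoint_iff_nonempty_inter.1 hd)
        have := hx f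
        constructor
        · nlinarith
        · have : 0 ≤ ((#(s f ∩ s i) : ℝ) - 1) ^ 2 * x f := by positivity
          nlinarith
    · simp [hvf]
  constructor
  · rw [h1, h2, h6, ← sum_sub_distrib]
    exact sum_le_sum fun f _ => (key f).1
  · refine le_trans ?_ (add_le_add_right h3 _)
    rw [h1, h2, h6, ← sum_sub_distrib, ← sum_add_distrib]
    exact sum_le_sum fun f _ => (key f).2

end GreedyMatching

section GreedyStep

open Finset

variable {P ι : Type*} [Fintype P] [DecidableEq P] [Fintype ι] (s : ι → Finset P) (x : ι → ℝ)

/-- Sum of squared deviations of the degrees in `A` from their ideal value. -/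
noncomputable def degDeviation (A : Finset P) : ℝ :=
  ∑ v ∈ A, (wdeg s x A v - ((#A : ℝ) / Fintype.card P) ^ 4) ^ 2

variable {s x}

lemma sq_add_le_of_abs_le {p r B R : ℝ} (hp : |p| ≤ B) (hr : |r| ≤ R) :
    (p + r) ^ 2 ≤ p ^ 2 + (2 * B * R + R ^ 2) := by
  have h1 : p * r ≤ B * R := by
    calc p * r ≤ |p * r| := le_abs_self _
      _ = |p| * |r| := abs_mul _ _
      _ ≤ B * R := mul_le_mul hp hr (abs_nonneg _) ((abs_nonneg _).trans hp)
  have h2 : r ^ 2 ≤ R ^ 2 := by rw [← sq_abs r]; gcongr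
  nlinarith

lemma pow_four_sub_bounds {y h : ℝ} (hy1 : y ≤ 1) (hh : 0 ≤ h) (hyh : h ≤ y) :
    |y ^ 4 - (y - h) ^ 4 - 4 * y ^ 3 * h| ≤ 6 * h ^ 2 ∧
    0 ≤ y ^ 4 - (y - h) ^ 4 ∧ y ^ 4 - (y - h) ^ 4 ≤ 4 * h := by
  have hy0 : 0 ≤ y := hh.trans hyh
  obtain ⟨z, rfl⟩ : ∃ z, y = z + h := ⟨y - h, by ring⟩
  have hz : 0 ≤ z := by linarith
  have h2 : (z + h) ^ 2 ≤ 1 := pow_le_one₀ hy0 hy1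
  have h3 : (z + h) ^ 3 ≤ 1 := pow_le_one₀ hy0 hy1
  have e1 : (z + h) ^ 4 - (z + h - h) ^ 4 - 4 * (z + h) ^ 3 * h =
      - (h ^ 2 * (6 * z ^ 2 + 8 * z * h + 3 * h ^ 2)) := by ring
  have e2 : h ^ 2 * (6 * z ^ 2 + 8 * z * h + 3 * h ^ 2) ≤ h ^ 2 * 6 := by
    gcongr
    nlinarith [mul_nonneg hz hh, sq_nonneg h]
  have e3 : 0 ≤ h ^ 2 * (6 * z ^ 2 + 8 * z * h + 3 * h ^ 2) := by positivity
  have e4 : (z + h) ^ 4 - (z + h - h) ^ 4 = h * (4 * z ^ 3 + 6 * z ^ 2 * h + 4 * z * h ^ 2 + h ^ 3) := by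
    ring
  refine ⟨?_, ?_, ?_⟩
  · rw [e1, abs_neg, abs_of_nonneg e3]; linarith
  · rw [e4]; positivity
  · have : (z + h) ^ 3 * h ≤ 1 * h := by gcongr
    linarith

/-- Degree and codegree hypotheses under which random greedy selection stays balanced. -/
structure SpreadWeights (s : ι → Finset P) (x : ι → ℝ) (c : ℝ) : Prop where
  card_edge : ∀ i, #(s i) = 5
  nonneg : ∀ i, 0 ≤ x i
  deg_eq : ∀ v, wdeg s x univ v = 1
  codeg_le : ∀ u v, u ≠ v → wcodeg s x univ u v ≤ c / Fintype.card P
  triple_le : ∀ u u' v, u ≠ u' → u ≠ v → u' ≠ v → wtriple s x u u' v ≤ c / Fintype.card P ^ 2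

namespace SpreadWeights

variable {c : ℝ}

lemma wdeg_le_one (H : SpreadWeights s x c) (A : Finset P) (v : P) : wdeg s x A v ≤ 1 :=
  (wdeg_le_univ H.nonneg A v).trans (H.deg_eq v).le

lemma wloss_bounds (H : SpreadWeights s x c) (hc : 0 ≤ c) (A : Finset P) (v : P) (i : ι) :
    0 ≤ wloss s x A v i ∧ wloss s x A v i ≤ 5 * c / Fintype.card P := by
  constructor
  · exact sum_nonneg fun u _ => wcodeg_nonneg H.nonneg A u v
  · calc wloss s x A v i ≤ ∑ u ∈ (s i).erase v, c / Fintype.card P :=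
          sum_le_sum fun u hu => (wcodeg_le_univ H.nonneg A u v).trans
            (H.codeg_le u v (ne_of_mem_erase hu))
      _ ≤ ∑ u ∈ s i, c / Fintype.card P :=
          sum_le_sum_of_subset_of_nonneg (erase_subset _ _) fun _ _ _ => by positivity
      _ = _ := by rw [sum_const, H.card_edge, nsmul_eq_mul]; push_cast; ring

lemma sum_triple_le (H : SpreadWeights s x c) {v : P} {i : ι} (hv : v ∉ s i) :
    ∑ u ∈ s i, ∑ u' ∈ (s i).erase u, wtriple s x u u' v ≤ 20 * c / Fintype.card P ^ 2 := by
  calc ∑ u ∈ s i, ∑ u' ∈ (s i).erase u, wtriple s x u u' v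
      ≤ ∑ u ∈ s i, ∑ u' ∈ (s i).erase u, c / (Fintype.card P : ℝ) ^ 2 := by
        refine sum_le_sum fun u hu => sum_le_sum fun u' hu' => ?_
        refine H.triple_le u u' v (ne_of_mem_erase hu').symm ?_ ?_
        · rintro rfl; exact hv hu
        · rintro rfl; exact hv (mem_of_mem_erase hu')
    _ = ∑ u ∈ s i, 4 * (c / (Fintype.card P : ℝ) ^ 2) := by
        refine sum_congr rfl fun u hu => ?_
        rw [sum_const, card_erase_of_mem hu, H.card_edge, nsmul_eq_mul]
        norm_num
    _ = _ := by rw [sum_const, H.card_edge, nsmul_eq_mul]; push_cast; ring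

lemma sq_deviation_sdiff_le (H : SpreadWeights s x c) (hc : 0 ≤ c) (A : Finset P)
    {v : P} {i : ι} (hv : v ∉ s i) {d' : ℝ}
    (hd0 : 0 ≤ d') (hd1 : d' ≤ 1) (hn : 1 ≤ (Fintype.card P : ℝ)) :
    (wdeg s x (A \ s i) v - d') ^ 2 ≤ (wdeg s x A v - d' - wloss s x A v i) ^ 2 +
      (40 * c + 600 * c ^ 2) / Fintype.card P ^ 2 := by
  set n : ℝ := (Fintype.card P : ℝ)
  obtain ⟨h1, h2⟩ := wdeg_sdiff_bounds H.nonneg A hv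
  obtain ⟨h3, h4⟩ := H.wloss_bounds hc A v i
  have h5 := H.sum_triple_le hv
  have h6 := H.wdeg_le_one A v
  have h7 := wdeg_nonneg (s := s) H.nonneg A v
  have h8 : 5 * c / n ≤ 5 * c := div_le_self (by positivity) hn
  have key := sq_add_le_of_abs_le (p := wdeg s x A v - d' - wloss s x A v i)
    (r := wdeg s x (A \ s i) v - (wdeg s x A v - wloss s x A v i)) (B := 1 + 5 * c)
    (R := 20 * c / n ^ 2) (abs_le.2 ⟨by linarith, by linarith⟩) (abs_le.2 ⟨?_, by linarith⟩)
  · calc _ = (wdeg s x A v - d' - wloss s x A v i +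
          (wdeg s x (A \ s i) v - (wdeg s x A v - wloss s x A v i))) ^ 2 := by ring
      _ ≤ _ := key
      _ ≤ _ := by
        gcongr
        have : (20 * c / n ^ 2) ^ 2 ≤ 400 * c ^ 2 / n ^ 2 := by
          rw [div_pow, show (20 * c) ^ 2 = 400 * c ^ 2 by ring]
          gcongr
          nlinarith [one_le_pow₀ (n := 2) hn]
        calc _ ≤ 2 * (1 + 5 * c) * (20 * c / n ^ 2) + 400 * c ^ 2 / n ^ 2 := by gcongr
          _ = _ := by ring
  · have : 0 ≤ 20 * c / n ^ 2 := by positivity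
    linarith

lemma sum_mul_sq_deviation_le (H : SpreadWeights s x c) (hc : 0 ≤ c) (A : Finset P) {v : P} {y : ℝ}
    (hn : 1 ≤ (Fintype.card P : ℝ)) (hy : y = #A / Fintype.card P)
    (hA : 5 ≤ #A) :
    ∑ i ∈ edgesIn s A, x i * (wdeg s x A v - (y - 5 / Fintype.card P) ^ 4 - wloss s x A v i) ^ 2 ≤
      (∑ i ∈ edgesIn s A, x i) * ((wdeg s x A v - y ^ 4) ^ 2 +
        (300 + (20 + 5 * c) ^ 2) / Fintype.card P ^ 2) +
      2 * |wdeg s x A v - y ^ 4| * (4 * |wdeg s x A v - y ^ 4| +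
        (4 + c) / Fintype.card P * ∑ u ∈ A, |wdeg s x A u - y ^ 4|) := by
  set n : ℝ := (Fintype.card P : ℝ) with hndef
  set X := ∑ i ∈ edgesIn s A, x i with hX
  set D := wdeg s x A with hD
  set L := wloss s x A v with hL
  set z : P → ℝ := fun u => D u - y ^ 4 with hz
  have hn0 : 0 < n := by linarith
  have hX0 : 0 ≤ X := sum_nonneg fun i _ => H.nonneg i
  have hAn : (#A : ℝ) ≤ n := Nat.cast_le.2 (card_le_univ A)
  have hA5 : (5 : ℝ) ≤ #A := by exact_mod_cast hA
  have hy1 : y ≤ 1 := by rw [hy]; exact div_le_one_of_le₀ hAn hn0.le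
  have hy5 : 5 / n ≤ y := by rw [hy]; gcongr
  have hy0 : 0 ≤ y := le_trans (by positivity) hy5
  have hyn : (#A : ℝ) = y * n := by rw [hy]; field_simp
  obtain ⟨g1, g2, g3⟩ := pow_four_sub_bounds hy1 (by positivity : 0 ≤ 5 / n) hy5
  set g := y ^ 4 - (y - 5 / n) ^ 4 with hg
  have hz1 : |z v| ≤ 1 := by
    have h1 := H.wdeg_le_one A v
    have h2 := wdeg_nonneg (s := s) H.nonneg A v
    have h3 : y ^ 4 ≤ 1 := pow_le_one₀ hy0 hy1
    have h4 : 0 ≤ y ^ 4 := by positivity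
    exact abs_le.2 ⟨by simp only [hz, hD]; linarith, by simp only [hz, hD]; linarith⟩
  have hZ : ∑ u ∈ A, D u = 5 * X := sum_wdeg H.card_edge A
  have hZ' : ∑ u ∈ A, z u = 5 * X - y * n * y ^ 4 := by
    simp only [hz, sum_sub_distrib, hZ, sum_const, nsmul_eq_mul, hyn]
  have hcod := sum_wcodeg (x := x) H.card_edge A v
  have hloss : ∑ i ∈ edgesIn s A, x i * L i =
      y ^ 4 * (4 * D v) + ∑ u ∈ A.erase v, z u * wcodeg s x A u v := by
    rw [hL, sum_mul_wloss, ← hcod, mul_sum, ← sum_add_distrib]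
    refine sum_congr rfl fun u _ => ?_
    simp only [hz]; ring
  have hW : |∑ u ∈ A.erase v, z u * wcodeg s x A u v| ≤ c / n * ∑ u ∈ A, |z u| := by
    calc _ ≤ ∑ u ∈ A.erase v, |z u * wcodeg s x A u v| := abs_sum_le_sum_abs _ _
      _ ≤ ∑ u ∈ A.erase v, c / n * |z u| := by
        refine sum_le_sum fun u hu => ?_
        rw [abs_mul, abs_of_nonneg (wcodeg_nonneg H.nonneg A u v), mul_comm]
        gcongr
        exact (wcodeg_le_univ H.nonneg A u v).trans (H.codeg_le u v (ne_of_mem_erase hu))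
      _ ≤ ∑ u ∈ A, c / n * |z u| :=
        sum_le_sum_of_subset_of_nonneg (erase_subset _ _) fun _ _ _ => by positivity
      _ = _ := by rw [mul_sum]
  have hdrift : |X * (4 * y ^ 3 * (5 / n)) - ∑ i ∈ edgesIn s A, x i * L i| ≤
      4 * |z v| + (4 + c) / n * ∑ u ∈ A, |z u| := by
    have e : X * (4 * y ^ 3 * (5 / n)) - ∑ i ∈ edgesIn s A, x i * L i =
        4 * (y ^ 3 / n) * ∑ u ∈ A, z u + (- (4 * y ^ 4 * z v) +
          - ∑ u ∈ A.erase v, z u * wcodeg s x A u v) := by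
      rw [hloss, hZ']
      simp only [hz]
      field_simp
      ring
    have e1 : |4 * (y ^ 3 / n) * ∑ u ∈ A, z u| ≤ 4 / n * ∑ u ∈ A, |z u| := by
      rw [abs_mul, abs_of_nonneg (by positivity)]
      have : y ^ 3 ≤ 1 := pow_le_one₀ hy0 hy1
      have h3 : 4 * (y ^ 3 / n) ≤ 4 / n := by rw [mul_div_assoc']; gcongr; linarith
      exact mul_le_mul h3 (abs_sum_le_sum_abs _ _) (abs_nonneg _) (by positivity)
    have e2 : |- (4 * y ^ 4 * z v)| ≤ 4 * |z v| := by
      rw [abs_neg, abs_mul, abs_of_nonneg (by positivity)]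
      have : y ^ 4 ≤ 1 := pow_le_one₀ hy0 hy1
      gcongr; linarith
    rw [e]
    calc _ ≤ |4 * (y ^ 3 / n) * ∑ u ∈ A, z u| + (|- (4 * y ^ 4 * z v)| +
          |- ∑ u ∈ A.erase v, z u * wcodeg s x A u v|) :=
          (abs_add_le _ _).trans (add_le_add_right (abs_add_le _ _) _)
      _ ≤ 4 / n * ∑ u ∈ A, |z u| + (4 * |z v| + c / n * ∑ u ∈ A, |z u|) := by
          rw [abs_neg (∑ u ∈ A.erase v, _)]
          gcongr
      _ = _ := by ring
  have hpoint : ∀ i ∈ edgesIn s A, x i * (D v - (y - 5 / n) ^ 4 - L i) ^ 2 ≤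
      x i * ((z v) ^ 2 + (300 + (20 + 5 * c) ^ 2) / n ^ 2) +
        2 * z v * (x i * (4 * y ^ 3 * (5 / n)) - x i * L i) := by
    intro i _
    obtain ⟨l1, l2⟩ := H.wloss_bounds hc A v i
    have t1 : z v * (g - 4 * y ^ 3 * (5 / n)) ≤ 150 / n ^ 2 := by
      calc _ ≤ |z v * (g - 4 * y ^ 3 * (5 / n))| := le_abs_self _
        _ = |z v| * |g - 4 * y ^ 3 * (5 / n)| := abs_mul _ _
        _ ≤ 1 * (6 * (5 / n) ^ 2) := by gcongr
        _ = 150 / n ^ 2 := by ring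
    have t2 : (g - L i) ^ 2 ≤ (20 + 5 * c) ^ 2 / n ^ 2 := by
      rw [← div_pow, ← sq_abs]
      gcongr
      rw [abs_le, add_div]
      have : 4 * (5 / n) = 20 / n := by ring
      have : 0 ≤ 20 / n := by positivity
      have : 0 ≤ 5 * c / n := by positivity
      constructor <;> simp only [hL] <;> linarith
    have t3 : (D v - (y - 5 / n) ^ 4 - L i) ^ 2 ≤ (z v) ^ 2 +
        (300 + (20 + 5 * c) ^ 2) / n ^ 2 + 2 * z v * (4 * y ^ 3 * (5 / n) - L i) := by
      have e : (D v - (y - 5 / n) ^ 4 - L i) ^ 2 = (z v) ^ 2 +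
        2 * (z v * (g - 4 * y ^ 3 * (5 / n))) + 2 * z v * (4 * y ^ 3 * (5 / n) - L i) +
          (g - L i) ^ 2 := by simp only [hz, hg]; ring
      rw [e, add_div, show (300 : ℝ) / n ^ 2 = 2 * (150 / n ^ 2) by ring]
      linarith
    calc _ ≤ x i * _ := mul_le_mul_of_nonneg_left t3 (H.nonneg i)
      _ = _ := by ring
  calc _ ≤ _ := sum_le_sum hpoint
    _ = X * ((z v) ^ 2 + (300 + (20 + 5 * c) ^ 2) / n ^ 2) +
        2 * (z v * (X * (4 * y ^ 3 * (5 / n)) - ∑ i ∈ edgesIn s A, x i * L i)) := by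
      rw [sum_add_distrib, ← sum_mul, ← mul_sum, sum_sub_distrib, ← sum_mul]
      ring
    _ ≤ X * ((z v) ^ 2 + (300 + (20 + 5 * c) ^ 2) / n ^ 2) +
        2 * (|z v| * (4 * |z v| + (4 + c) / n * ∑ u ∈ A, |z u|)) := by
      refine add_le_add_right (mul_le_mul_of_nonneg_left ?_ zero_le_two) _
      refine (le_abs_self _).trans ?_
      rw [abs_mul]
      gcongr
    _ = _ := by simp only [hz]; ring

end SpreadWeights

end GreedyStep

section GreedyIteration

open Finset

variable {P ι : Type*} [Fintype P] [DecidableEq P] [Fintype ι] {s : ι → Finset P} {x : ι → ℝ}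

/-- Growth rate of the degree deviation under greedy selection. -/
noncomputable def growthRate (c ξ : ℝ) : ℝ :=
  300 + (20 + 5 * c) ^ 2 + (40 * c + 600 * c ^ 2) + 20 * (8 + c) / ξ ^ 5

lemma growthRate_nonneg {c ξ : ℝ} (hc : 0 ≤ c) (hξ : 0 < ξ) : 0 ≤ growthRate c ξ := by
  unfold growthRate; positivity

namespace SpreadWeights

variable {c : ℝ}

lemma exists_edge_degDeviation_le (H : SpreadWeights s x c) (hc : 0 ≤ c) {ξ : ℝ}
    (hξ : 0 < ξ) (hn : 1 ≤ (Fintype.card P : ℝ))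
    {A : Finset P} (hA : ξ * Fintype.card P ≤ #A)
    (hdev : degDeviation s x A ≤ ξ ^ 10 * Fintype.card P / 16) :
    ∃ i, s i ⊆ A ∧ degDeviation s x (A \ s i) + 1 ≤
      (degDeviation s x A + 1) * (1 + growthRate c ξ / Fintype.card P) := by
  set n : ℝ := (Fintype.card P : ℝ) with hndef
  set X := ∑ i ∈ edgesIn s A, x i with hX
  set y : ℝ := #A / n with hy
  set Φ := degDeviation s x A with hΦ
  have hn0 : 0 < n := by linarith
  have hAn : (#A : ℝ) ≤ n := Nat.cast_le.2 (card_le_univ A)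
  have hyn : (#A : ℝ) = y * n := by rw [hy]; field_simp
  have hyξ : ξ ≤ y := by rw [hy, le_div_iff₀ hn0]; exact hA
  have hy1 : y ≤ 1 := div_le_one_of_le₀ hAn hn0.le
  have hΦ0 : 0 ≤ Φ := sum_nonneg fun v _ => sq_nonneg _
  set S := ∑ u ∈ A, |wdeg s x A u - y ^ 4| with hS
  have hS0 : 0 ≤ S := sum_nonneg fun v _ => abs_nonneg _
  have hSΦ : S ^ 2 ≤ n * Φ := by
    calc S ^ 2 ≤ #A * ∑ u ∈ A, |wdeg s x A u - y ^ 4| ^ 2 := sq_sum_le_card_mul_sum_sq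
      _ = #A * Φ := by simp only [sq_abs]; rfl
      _ ≤ n * Φ := by gcongr
  have hS4 : S ≤ ξ ^ 5 * n / 4 := by
    refine le_of_sq_le_sq ?_ (by positivity)
    calc S ^ 2 ≤ n * (ξ ^ 10 * n / 16) := hSΦ.trans (by gcongr)
      _ = _ := by ring
  have h5X : y ^ 5 * n - S ≤ 5 * X := by
    rw [hX, ← sum_wdeg H.card_edge A]
    have e : ∑ u ∈ A, wdeg s x A u = y ^ 5 * n + ∑ u ∈ A, (wdeg s x A u - y ^ 4) := by
      rw [sum_sub_distrib, sum_const, nsmul_eq_mul, hyn]; ring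
    have := neg_abs_le (∑ u ∈ A, (wdeg s x A u - y ^ 4))
    have := abs_sum_le_sum_abs (fun u => wdeg s x A u - y ^ 4) A
    rw [e]; linarith
  have hXlow : ξ ^ 5 * n / 10 ≤ X := by
    have : ξ ^ 5 * n ≤ y ^ 5 * n := by gcongr
    have : 0 ≤ ξ ^ 5 * n := by positivity
    linarith
  have hX0 : 0 < X := lt_of_lt_of_le (by positivity) hXlow
  obtain ⟨i0, hi0, -⟩ : ∃ i ∈ edgesIn s A, x i ≠ 0 := by
    by_contra! h
    exact hX0.ne' (sum_eq_zero h)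
  have hA5 : 5 ≤ #A := by
    rw [← H.card_edge i0]
    exact card_le_card (by simpa [edgesIn] using hi0)
  have hdev' : ∀ i ∈ edgesIn s A, degDeviation s x (A \ s i) ≤
      ∑ v ∈ A, ((wdeg s x A v - (y - 5 / n) ^ 4 - wloss s x A v i) ^ 2 +
        (40 * c + 600 * c ^ 2) / n ^ 2) := by
    intro i hi
    have hi' : s i ⊆ A := by simpa [edgesIn] using hi
    have hcard : (#(A \ s i) : ℝ) / n = y - 5 / n := by
      rw [card_sdiff_of_subset hi', H.card_edge, Nat.cast_sub hA5, hy]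
      push_cast; ring
    unfold degDeviation
    rw [hcard]
    have h0 : 0 ≤ y - 5 / n := hcard ▸ div_nonneg (Nat.cast_nonneg _) hn0.le
    have h1 : y - 5 / n ≤ 1 := by
      have : 0 ≤ 5 / n := by positivity
      linarith
    refine le_trans (sum_le_sum fun v hv => H.sq_deviation_sdiff_le hc A (mem_sdiff.1 hv).2
      (pow_nonneg h0 4) (pow_le_one₀ h0 h1) hn) ?_
    exact sum_le_sum_of_subset_of_nonneg sdiff_subset fun v _ _ => by positivity
  have hS2 : (4 + c) / n * S ^ 2 ≤ (4 + c) * Φ := by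
    calc (4 + c) / n * S ^ 2 ≤ (4 + c) / n * (n * Φ) := by gcongr
      _ = (4 + c) * Φ := by field_simp
  have havg : ∑ i ∈ edgesIn s A, x i * degDeviation s x (A \ s i) ≤
      X * (Φ * (1 + 20 * (8 + c) / ξ ^ 5 / n) +
        (300 + (20 + 5 * c) ^ 2 + (40 * c + 600 * c ^ 2)) / n) := by
    calc ∑ i ∈ edgesIn s A, x i * degDeviation s x (A \ s i)
        ≤ ∑ i ∈ edgesIn s A, x i * ∑ v ∈ A,
          ((wdeg s x A v - (y - 5 / n) ^ 4 - wloss s x A v i) ^ 2 +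
            (40 * c + 600 * c ^ 2) / n ^ 2) :=
          sum_le_sum fun i hi => mul_le_mul_of_nonneg_left (hdev' i hi) (H.nonneg i)
      _ = ∑ v ∈ A, (∑ i ∈ edgesIn s A,
            x i * (wdeg s x A v - (y - 5 / n) ^ 4 - wloss s x A v i) ^ 2 +
          X * ((40 * c + 600 * c ^ 2) / n ^ 2)) := by
          simp_rw [mul_sum, mul_add]
          rw [sum_comm]
          refine sum_congr rfl fun v _ => ?_
          rw [sum_add_distrib, ← sum_mul]
      _ ≤ ∑ v ∈ A, (X * ((wdeg s x A v - y ^ 4) ^ 2 + (300 + (20 + 5 * c) ^ 2) / n ^ 2) +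
          2 * |wdeg s x A v - y ^ 4| * (4 * |wdeg s x A v - y ^ 4| + (4 + c) / n * S) +
          X * ((40 * c + 600 * c ^ 2) / n ^ 2)) :=
          sum_le_sum fun v _ => add_le_add_left
            (H.sum_mul_sq_deviation_le hc A hn hy hA5) _
      _ = X * Φ + 8 * Φ + 2 * ((4 + c) / n * S ^ 2) +
          #A * (X * ((300 + (20 + 5 * c) ^ 2 + (40 * c + 600 * c ^ 2)) / n ^ 2)) := by
          have e : ∀ v, X * ((wdeg s x A v - y ^ 4) ^ 2 + (300 + (20 + 5 * c) ^ 2) / n ^ 2) +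
            2 * |wdeg s x A v - y ^ 4| * (4 * |wdeg s x A v - y ^ 4| + (4 + c) / n * S) +
            X * ((40 * c + 600 * c ^ 2) / n ^ 2) =
            (X + 8) * (wdeg s x A v - y ^ 4) ^ 2 +
              (2 * ((4 + c) / n * S)) * |wdeg s x A v - y ^ 4| +
              X * ((300 + (20 + 5 * c) ^ 2 + (40 * c + 600 * c ^ 2)) / n ^ 2) := by
            intro v
            rw [← sq_abs (wdeg s x A v - y ^ 4)]
            ring
          simp_rw [e, sum_add_distrib, ← mul_sum, sum_const, nsmul_eq_mul]
          rw [← hS]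
          have : ∑ v ∈ A, (wdeg s x A v - y ^ 4) ^ 2 = Φ := rfl
          rw [this]
          ring
      _ ≤ X * Φ + 8 * Φ + 2 * ((4 + c) * Φ) +
          n * (X * ((300 + (20 + 5 * c) ^ 2 + (40 * c + 600 * c ^ 2)) / n ^ 2)) := by
          gcongr
      _ = X * Φ + (ξ ^ 5 * n / 10) * (20 * (8 + c) / ξ ^ 5 / n * Φ) +
          X * ((300 + (20 + 5 * c) ^ 2 + (40 * c + 600 * c ^ 2)) / n) := by
          field_simp
          ring
      _ ≤ X * Φ + X * (20 * (8 + c) / ξ ^ 5 / n * Φ) +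
          X * ((300 + (20 + 5 * c) ^ 2 + (40 * c + 600 * c ^ 2)) / n) := by
          gcongr
      _ = _ := by ring
  obtain ⟨i, hi, hle⟩ : ∃ i ∈ edgesIn s A, degDeviation s x (A \ s i) ≤
      Φ * (1 + 20 * (8 + c) / ξ ^ 5 / n) +
        (300 + (20 + 5 * c) ^ 2 + (40 * c + 600 * c ^ 2)) / n := by
    by_contra! h
    refine absurd havg (not_le.2 ?_)
    rw [hX, sum_mul]
    obtain ⟨i1, hi1, hne⟩ : ∃ i ∈ edgesIn s A, x i ≠ 0 := by
      by_contra! h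
      exact hX0.ne' (sum_eq_zero h)
    refine sum_lt_sum (fun i hi => mul_le_mul_of_nonneg_left (h i hi).le (H.nonneg i))
      ⟨i1, hi1, mul_lt_mul_of_pos_left (h i1 hi1) ((H.nonneg i1).lt_of_ne' hne)⟩
  refine ⟨i, by simpa [edgesIn] using hi, ?_⟩
  have hK : growthRate c ξ / n = (300 + (20 + 5 * c) ^ 2 + (40 * c + 600 * c ^ 2)) / n +
      20 * (8 + c) / ξ ^ 5 / n := by unfold growthRate; ring
  rw [hK]
  have p1 : 0 ≤ Φ * ((300 + (20 + 5 * c) ^ 2 + (40 * c + 600 * c ^ 2)) / n) := by positivity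
  have p2 : 0 ≤ 20 * (8 + c) / ξ ^ 5 / n := by positivity
  nlinarith

/-- A spread fractional perfect matching yields an almost perfect matching. -/
theorem exists_tiled_compl_card_le (H : SpreadWeights s x c) (hc : 0 ≤ c) {ξ : ℝ} (hξ : 0 < ξ)
    (hn : 1 ≤ (Fintype.card P : ℝ))
    (hlarge : Real.exp (growthRate c ξ) ≤ ξ ^ 10 * Fintype.card P / 16) :
    ∃ A : Finset P, Tiled s Aᶜ ∧ (#A : ℝ) ≤ ξ * Fintype.card P := by
  set n : ℝ := (Fintype.card P : ℝ) with hndef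
  have hn0 : 0 < n := by linarith
  set K := growthRate c ξ with hK
  have hK0 : 0 ≤ K := growthRate_nonneg hc hξ
  by_contra! hno
  have main : ∀ t : ℕ, ∃ A : Finset P, Tiled s Aᶜ ∧ #A + 5 * t ≤ Fintype.card P ∧
      degDeviation s x A + 1 ≤ (1 + K / n) ^ t := by
    intro t
    induction t with
    | zero =>
      refine ⟨univ, by simpa using Tiled.empty, by simp, ?_⟩
      have : degDeviation s x univ = 0 := by
        refine sum_eq_zero fun v _ => ?_
        rw [H.deg_eq, card_univ, div_self hn0.ne']
        norm_num
      simp [this]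
    | succ t ih =>
      obtain ⟨A, hA, hcard, hdev⟩ := ih
      have ht : (t : ℝ) ≤ n := Nat.cast_le.2 (by omega)
      have hpow : (1 + K / n) ^ t ≤ Real.exp K := by
        calc (1 + K / n) ^ t ≤ (Real.exp (K / n)) ^ t := by
              gcongr
              linarith [Real.add_one_le_exp (K / n)]
          _ = Real.exp (t * (K / n)) := by rw [Real.exp_nat_mul]
          _ ≤ Real.exp (n * (K / n)) := by gcongr
          _ = Real.exp K := by congr 1; field_simp
      obtain ⟨i, hi, hstep⟩ := H.exists_edge_degDeviation_le hc hξ hn (hno A hA).le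
        (by linarith)
      refine ⟨A \ s i, ?_, ?_, ?_⟩
      · have : (A \ s i)ᶜ = Aᶜ ∪ s i := by
          ext v; simp only [mem_compl, mem_sdiff, mem_union]; tauto
        rw [this]
        exact Tiled.cons _ i hA (disjoint_compl_left.mono_right hi)
      · rw [card_sdiff_of_subset hi, H.card_edge]
        have := card_le_card hi
        rw [H.card_edge] at this
        omega
      · rw [pow_succ]
        exact hstep.trans (by gcongr)
  obtain ⟨A, -, h, -⟩ := main (Fintype.card P + 1)
  omega

end SpreadWeights

end GreedyIteration

section TupleEdges

open Finset

variable {Q V : Type*}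

/-- The five points of a tuple, as a function on coordinates. -/
def tuplePoint (e : Q × V × V × V × V) : Fin 5 → Q ⊕ V :=
  ![Sum.inl e.1, Sum.inr e.2.1, Sum.inr e.2.2.1, Sum.inr e.2.2.2.1, Sum.inr e.2.2.2.2]

lemma tuplePoint_injective : Function.Injective (tuplePoint : Q × V × V × V × V → _) := by
  rintro ⟨j, a, b, c, d⟩ ⟨j', a', b', c', d'⟩ h
  have h0 := congrFun h 0
  have h1 := congrFun h 1
  have h2 := congrFun h 2
  have h3 := congrFun h 3
  have h4 := congrFun h 4
  simp [tuplePoint] at h0 h1 h2 h3 h4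
  simp [h0, h1, h2, h3, h4]

variable [DecidableEq Q] [DecidableEq V]

/-- The set of points of a tuple. -/
def tupleEdge (e : Q × V × V × V × V) : Finset (Q ⊕ V) := univ.image (tuplePoint e)

lemma mem_tupleEdge {e : Q × V × V × V × V} {u : Q ⊕ V} :
    u ∈ tupleEdge e ↔ ∃ p, tuplePoint e p = u := by simp [tupleEdge]

lemma inl_mem_tupleEdge {e : Q × V × V × V × V} {j : Q} :
    Sum.inl j ∈ tupleEdge e ↔ e.1 = j := by
  simp [mem_tupleEdge, Fin.exists_fin_succ, tuplePoint]

lemma inr_mem_tupleEdge {e : Q × V × V × V × V} {v : V} :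
    Sum.inr v ∈ tupleEdge e ↔ e.2.1 = v ∨ e.2.2.1 = v ∨ e.2.2.2.1 = v ∨ e.2.2.2.2 = v := by
  simp [mem_tupleEdge, Fin.exists_fin_succ, tuplePoint]

variable [Fintype Q] [Fintype V]

lemma card_two_points_le {α : Type*} [Fintype α] [DecidableEq α] (p q : Fin 5) (hpq : p ≠ q)
    (u v : α) : #{f : Fin 5 → α | f p = u ∧ f q = v} ≤ Fintype.card α ^ 3 := by
  have : ({f : Fin 5 → α | f p = u ∧ f q = v} : Finset _) ⊆ Fintype.piFinset fun i =>
      if i = p then {u} else if i = q then {v} else univ := by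
    intro f hf
    simp only [mem_filter, mem_univ, true_and] at hf
    rw [Fintype.mem_piFinset]
    intro i
    split_ifs with h1 h2
    · simp [h1, hf.1]
    · simp [h2, hf.2]
    · simp
  refine (card_le_card this).trans ?_
  rw [Fintype.card_piFinset]
  have : ∀ i, #(if i = p then {u} else if i = q then {v} else univ : Finset α) =
      if i = p ∨ i = q then 1 else Fintype.card α := by
    intro i
    by_cases h1 : i = p <;> by_cases h2 : i = q <;> simp [h1, h2, hpq.symm]
  simp_rw [this, prod_ite, prod_const, one_pow, one_mul]
  refine le_of_eq ?_
  congr 1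
  clear * - hpq
  revert p q
  decide

lemma card_three_points_le {α : Type*} [Fintype α] [DecidableEq α] (p q r : Fin 5) (hpq : p ≠ q)
    (hpr : p ≠ r) (hqr : q ≠ r) (u v w : α) :
    #{f : Fin 5 → α | f p = u ∧ f q = v ∧ f r = w} ≤ Fintype.card α ^ 2 := by
  have : ({f : Fin 5 → α | f p = u ∧ f q = v ∧ f r = w} : Finset _) ⊆ Fintype.piFinset fun i =>
      if i = p then {u} else if i = q then {v} else if i = r then {w} else univ := by
    intro f hf
    simp only [mem_filter, mem_univ, true_and] at hf
    rw [Fintype.mem_piFinset]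
    intro i
    split_ifs with h1 h2 h3
    · simp [h1, hf.1]
    · simp [h2, hf.2.1]
    · simp [h3, hf.2.2]
    · simp
  refine (card_le_card this).trans ?_
  rw [Fintype.card_piFinset]
  have : ∀ i, #(if i = p then {u} else if i = q then {v} else if i = r then {w} else univ :
      Finset α) = if i = p ∨ i = q ∨ i = r then 1 else Fintype.card α := by
    intro i
    by_cases h1 : i = p <;> by_cases h2 : i = q <;> by_cases h3 : i = r <;>
      simp [h1, h2, h3, hpq.symm, hpr.symm, hqr.symm]
  simp_rw [this, prod_ite, prod_const, one_pow, one_mul]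
  refine le_of_eq ?_
  congr 1
  clear * - hpq hpr hqr
  revert p q r
  decide

variable {T : Finset (Q × V × V × V × V)}

lemma card_tuples_two_le (T : Finset (Q × V × V × V × V)) {u v : Q ⊕ V} (huv : u ≠ v) :
    #{i : T | u ∈ tupleEdge i.1 ∧ v ∈ tupleEdge i.1} ≤ 25 * Fintype.card (Q ⊕ V) ^ 3 := by
  have hsub : ({i : T | u ∈ tupleEdge i.1 ∧ v ∈ tupleEdge i.1} : Finset _).image
      (fun i => tuplePoint i.1) ⊆ (univ : Finset (Fin 5 × Fin 5)).biUnion fun p =>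
        if p.1 = p.2 then ∅ else univ.filter fun f : Fin 5 → Q ⊕ V => f p.1 = u ∧ f p.2 = v := by
    intro f hf
    simp only [mem_image, mem_filter, mem_univ, true_and, mem_tupleEdge] at hf
    obtain ⟨i, ⟨⟨p, hp⟩, ⟨q, hq⟩⟩, rfl⟩ := hf
    refine mem_biUnion.2 ⟨(p, q), mem_univ _, ?_⟩
    rw [if_neg]
    · simp [hp, hq]
    · intro h
      have h' : p = q := h
      subst h'
      exact huv (hp.symm.trans hq)
  rw [← card_image_of_injective _ (tuplePoint_injective.comp Subtype.val_injective)]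
  refine (card_le_card hsub).trans (card_biUnion_le.trans ?_)
  calc _ ≤ ∑ _p : Fin 5 × Fin 5, Fintype.card (Q ⊕ V) ^ 3 := by
        refine sum_le_sum fun p _ => ?_
        split_ifs with h
        · simp
        · exact card_two_points_le _ _ h u v
    _ = _ := by simp

lemma card_tuples_three_le (T : Finset (Q × V × V × V × V)) {u v w : Q ⊕ V} (huv : u ≠ v)
    (huw : u ≠ w) (hvw : v ≠ w) :
    #{i : T | u ∈ tupleEdge i.1 ∧ v ∈ tupleEdge i.1 ∧ w ∈ tupleEdge i.1} ≤
      125 * Fintype.card (Q ⊕ V) ^ 2 := by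
  have hsub : ({i : T | u ∈ tupleEdge i.1 ∧ v ∈ tupleEdge i.1 ∧ w ∈ tupleEdge i.1} :
      Finset _).image (fun i => tuplePoint i.1) ⊆
        (univ : Finset (Fin 5 × Fin 5 × Fin 5)).biUnion fun p =>
        if p.1 = p.2.1 ∨ p.1 = p.2.2 ∨ p.2.1 = p.2.2 then ∅
        else univ.filter fun f : Fin 5 → Q ⊕ V => f p.1 = u ∧ f p.2.1 = v ∧ f p.2.2 = w := by
    intro f hf
    simp only [mem_image, mem_filter, mem_univ, true_and, mem_tupleEdge] at hf
    obtain ⟨i, ⟨⟨p, hp⟩, ⟨q, hq⟩, ⟨r, hr⟩⟩, rfl⟩ := hf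
    refine mem_biUnion.2 ⟨(p, q, r), mem_univ _, ?_⟩
    rw [if_neg]
    · simp [hp, hq, hr]
    · rintro (h | h | h) <;> simp only at h <;> subst h
      · exact huv (hp.symm.trans hq)
      · exact huw (hp.symm.trans hr)
      · exact hvw (hq.symm.trans hr)
  rw [← card_image_of_injective _ (tuplePoint_injective.comp Subtype.val_injective)]
  refine (card_le_card hsub).trans (card_biUnion_le.trans ?_)
  calc _ ≤ ∑ _p : Fin 5 × Fin 5 × Fin 5, Fintype.card (Q ⊕ V) ^ 2 := by
        refine sum_le_sum fun p _ => ?_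
        split_ifs with h
        · simp
        · push Not at h
          exact card_three_points_le _ _ _ h.1 h.2.1 h.2.2 u v w
    _ = _ := by simp

lemma spreadWeights_of_fractional {ε : ℝ} (hε : 0 < ε) (hV : Fintype.card V = 4 * Fintype.card Q)
    (hQ : 0 < Fintype.card Q) (hT : ∀ e ∈ T, #(tupleEdge e) = 5) (x : Q × V × V × V × V → ℝ)
    (hx : ∀ e, 0 ≤ x e ∧ x e ≤ 100 / ε ^ 2 / (Fintype.card V : ℝ) ^ 4)
    (hxT : ∀ e, e ∉ T → x e = 0)
    (hxQ : ∀ j, ∑ e, x e * (if e.1 = j then 1 else 0) = 1)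
    (hxV : ∀ v, ∑ e, x e * ((if e.2.1 = v then 1 else 0) + (if e.2.2.1 = v then 1 else 0) +
        (if e.2.2.2.1 = v then 1 else 0) + (if e.2.2.2.2 = v then 1 else 0)) = 1) :
    SpreadWeights (fun i : T => tupleEdge i.1) (fun i => x i.1) (40000 / ε ^ 2) := by
  have hN : (Fintype.card (Q ⊕ V) : ℝ) = 5 / 4 * Fintype.card V := by
    rw [Fintype.card_sum, hV]; push_cast; ring
  have hV0 : (0 : ℝ) < Fintype.card V := by exact_mod_cast (by omega : 0 < Fintype.card V)
  have hdist : ∀ e ∈ T, e.2.1 ≠ e.2.2.1 ∧ e.2.1 ≠ e.2.2.2.1 ∧ e.2.1 ≠ e.2.2.2.2 ∧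
      e.2.2.1 ≠ e.2.2.2.1 ∧ e.2.2.1 ≠ e.2.2.2.2 ∧ e.2.2.2.1 ≠ e.2.2.2.2 := by
    intro e he
    have hinj : Function.Injective (tuplePoint e) := by
      have := hT e he
      unfold tupleEdge at this
      exact Set.injOn_univ.1 (by simpa using card_image_iff.1 (this.trans (by simp)))
    have key : ∀ p q : Fin 5, p ≠ q → tuplePoint e p ≠ tuplePoint e q := fun p q h h' => h (hinj h')
    have k1 := key 1 2 (by decide)
    have k2 := key 1 3 (by decide)
    have k3 := key 1 4 (by decide)
    have k4 := key 2 3 (by decide)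
    have k5 := key 2 4 (by decide)
    have k6 := key 3 4 (by decide)
    simp [tuplePoint] at k1 k2 k3 k4 k5 k6
    exact ⟨k1, k2, k3, k4, k5, k6⟩
  refine ⟨fun i => hT i.1 i.2, fun i => (hx i.1).1, ?_, ?_, ?_⟩
  · intro u
    have h1 : wdeg (fun i : T => tupleEdge i.1) (fun i => x i.1) univ u =
        ∑ e, if u ∈ tupleEdge e then x e else 0 := by
      unfold wdeg edgesIn
      simp only [subset_univ, filter_true]
      rw [sum_coe_sort T (fun e => if u ∈ tupleEdge e then x e else 0)]
      refine sum_subset (subset_univ _) fun e _ he => ?_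
      simp [hxT e he]
    rw [h1]
    rcases u with j | v
    · rw [← hxQ j]
      refine sum_congr rfl fun e _ => ?_
      simp [inl_mem_tupleEdge]
    · refine Eq.trans ?_ (hxV v)
      refine sum_congr rfl fun e _ => ?_
      by_cases he : e ∈ T
      · obtain ⟨k1, k2, k3, k4, k5, k6⟩ := hdist e he
        simp only [inr_mem_tupleEdge]
        by_cases h1 : e.2.1 = v
        · subst h1; simp [k1.symm, k2.symm, k3.symm]
        by_cases h2 : e.2.2.1 = v
        · subst h2; simp [h1, k4.symm, k5.symm]
        by_cases h3 : e.2.2.2.1 = v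
        · subst h3; simp [h1, h2, k6.symm]
        by_cases h4 : e.2.2.2.2 = v
        · subst h4; simp [h1, h2, h3]
        simp [h1, h2, h3, h4]
      · simp [hxT e he]
  · intro u v huv
    have h1 : wcodeg (fun i : T => tupleEdge i.1) (fun i => x i.1) univ u v ≤
        ∑ i : T, if u ∈ tupleEdge i.1 ∧ v ∈ tupleEdge i.1 then
          100 / ε ^ 2 / (Fintype.card V : ℝ) ^ 4 else 0 := by
      unfold wcodeg edgesIn
      simp only [subset_univ, filter_true]
      refine sum_le_sum fun i _ => ?_
      have := hx i.1
      by_cases h : u ∈ tupleEdge i.1 <;> by_cases h' : v ∈ tupleEdge i.1 <;> simp [h, h', this.2]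
    refine h1.trans ?_
    rw [← sum_filter, sum_const, nsmul_eq_mul]
    have h2 : (#{i : T | u ∈ tupleEdge i.1 ∧ v ∈ tupleEdge i.1} : ℝ) ≤
        25 * (Fintype.card (Q ⊕ V) : ℝ) ^ 3 := by exact_mod_cast card_tuples_two_le T huv
    refine (mul_le_mul_of_nonneg_right h2 (by positivity)).trans ?_
    rw [hN]
    have e1 : 25 * (5 / 4 * (Fintype.card V : ℝ)) ^ 3 * (100 / ε ^ 2 / (Fintype.card V : ℝ) ^ 4) =
        (25 * (5 / 4) ^ 4 * 100) / ε ^ 2 / (5 / 4 * Fintype.card V) := by field_simp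
    rw [e1]
    gcongr
    norm_num
  · intro u u' v h1 h2 h3
    have h4 : wtriple (fun i : T => tupleEdge i.1) (fun i => x i.1) u u' v ≤
        ∑ i : T, if u ∈ tupleEdge i.1 ∧ u' ∈ tupleEdge i.1 ∧ v ∈ tupleEdge i.1 then
          100 / ε ^ 2 / (Fintype.card V : ℝ) ^ 4 else 0 := by
      unfold wtriple
      refine sum_le_sum fun i _ => ?_
      have := hx i.1
      by_cases h : u ∈ tupleEdge i.1 <;> by_cases h' : u' ∈ tupleEdge i.1 <;>
        by_cases h'' : v ∈ tupleEdge i.1 <;> simp [h, h', h'', this.2]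
    refine h4.trans ?_
    rw [← sum_filter, sum_const, nsmul_eq_mul]
    have h5 : (#{i : T | u ∈ tupleEdge i.1 ∧ u' ∈ tupleEdge i.1 ∧ v ∈ tupleEdge i.1} : ℝ) ≤
        125 * (Fintype.card (Q ⊕ V) : ℝ) ^ 2 := by exact_mod_cast card_tuples_three_le T h1 h2 h3
    refine (mul_le_mul_of_nonneg_right h5 (by positivity)).trans ?_
    rw [hN]
    have e1 : 125 * (5 / 4 * (Fintype.card V : ℝ)) ^ 2 * (100 / ε ^ 2 / (Fintype.card V : ℝ) ^ 4) =
        (125 * (5 / 4) ^ 4 * 100) / ε ^ 2 / (5 / 4 * Fintype.card V) ^ 2 := by field_simp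
    rw [e1]
    gcongr
    norm_num

/-- Either there is an almost perfect matching or a large sparse vertex set. -/
theorem exists_almost_tiled_or_sparse {ε ξ : ℝ} (hε : 0 < ε) (hε' : ε ≤ 1 / 100) (hξ : 0 < ξ) :
    ∃ N : ℕ, ∀ (Q V : Type) [Fintype Q] [Fintype V] [DecidableEq Q] [DecidableEq V]
      (T : Finset (Q × V × V × V × V)), Fintype.card V = 4 * Fintype.card Q →
      N ≤ Fintype.card V → (∀ e ∈ T, #(tupleEdge e) = 5) →
      (∀ j v, (37 / 64 - ε) * (Fintype.card V : ℝ) ^ 3 ≤ #{p : V × V × V | (j, v, p) ∈ T}) →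
      (∃ A : Finset (Q ⊕ V), Tiled (fun i : T => tupleEdge i.1) Aᶜ ∧
        (#A : ℝ) ≤ ξ * Fintype.card V) ∨
      ∃ U : Finset V, (3 / 4 - 4000 * ε) * (Fintype.card V : ℝ) ≤ #U ∧
        (#{e ∈ T | e.2.1 ∈ U ∧ e.2.2.1 ∈ U ∧ e.2.2.2.1 ∈ U ∧ e.2.2.2.2 ∈ U} : ℝ) ≤
          17 * ε * (Fintype.card V : ℝ) ^ 5 := by
  set ξ' : ℝ := 4 / 5 * ξ with hξ'
  obtain ⟨N, hN⟩ := exists_nat_ge (1 / ε +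
    Real.exp (growthRate (40000 / ε ^ 2) ξ') * 16 / ξ' ^ 10)
  refine ⟨max N 4, ?_⟩
  intro Q V _ _ _ _ T hV hVN hT hdeg
  have hNV : (N : ℝ) ≤ Fintype.card V := Nat.cast_le.2 ((le_max_left _ _).trans hVN)
  have h4V : 4 ≤ Fintype.card V := (le_max_right _ _).trans hVN
  have p1 : 0 < 1 / ε := by positivity
  have p2 : 0 < Real.exp (growthRate (40000 / ε ^ 2) ξ') * 16 / ξ' ^ 10 := by positivity
  have h1 : 1 ≤ ε * Fintype.card V := by
    have : 1 / ε ≤ Fintype.card V := by linarith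
    rwa [div_le_iff₀ hε, mul_comm] at this
  have hcP : (Fintype.card (Q ⊕ V) : ℝ) = 5 / 4 * Fintype.card V := by
    rw [Fintype.card_sum, hV]; push_cast; ring
  rcases exists_fractional_or_sparse hε hε' h1 hV hdeg with ⟨x, hx, hxT, hxQ, hxV⟩ | h
  · left
    have H := spreadWeights_of_fractional hε hV (by omega) hT x hx hxT hxQ hxV
    have h4V' : (4 : ℝ) ≤ Fintype.card V := by exact_mod_cast h4V
    obtain ⟨A, hA, hAc⟩ := H.exists_tiled_compl_card_le (ξ := ξ') (by positivity) (by positivity)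
      (by rw [hcP]; linarith) (by
        have : Real.exp (growthRate (40000 / ε ^ 2) ξ') * 16 / ξ' ^ 10 ≤
          Fintype.card (Q ⊕ V) := by rw [hcP]; linarith
        rw [div_le_iff₀ (by positivity)] at this
        linarith)
    refine ⟨A, hA, hAc.trans (le_of_eq ?_)⟩
    rw [hcP, hξ']; ring
  · exact Or.inr h

end TupleEdges

section DisjointFamily

open Finset

/-- Greedy selection of pairwise disjoint gadgets so that each target is served by many of them. -/
lemma exists_disjoint_serving_family {Ab Tg Pt : Type*} [Fintype Ab] [Fintype Tg] [DecidableEq Ab]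
    [DecidableEq Pt] [Nonempty Tg] (supp : Ab → Finset Pt) (valid : Ab → Prop)
    (serves : Ab → Tg → Prop) [DecidablePred valid] [∀ a t, Decidable (serves a t)] {K N : ℕ} {p : ℝ}
    (hp : 0 < p) (hne : ∀ a, (supp a).Nonempty) (hK : ∀ a, #(supp a) ≤ K) (hAb : Nonempty Ab)
    (h : ∀ (Z : Finset Pt) (t : Tg), #Z ≤ K * N → p * Fintype.card Ab ≤
      #{a | valid a ∧ serves a t ∧ Disjoint (supp a) Z}) :
    ∃ S : Finset Ab, #S ≤ N ∧ (∀ a ∈ S, valid a) ∧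
      (∀ a ∈ S, ∀ b ∈ S, a ≠ b → Disjoint (supp a) (supp b)) ∧
      ∀ t, (1 / 2 : ℝ) ^ #{a ∈ S | serves a t} ≤ Fintype.card Tg * (1 - p / 2) ^ N := by
  have hM : (0 : ℝ) < Fintype.card Ab := by exact_mod_cast Fintype.card_pos
  have hp1 : p ≤ 1 := by
    obtain ⟨t⟩ := ‹Nonempty Tg›
    have h1 := h ∅ t (by simp)
    have h2 : (#{a | valid a ∧ serves a t ∧ Disjoint (supp a) ∅} : ℝ) ≤ Fintype.card Ab :=
      Nat.cast_le.2 (card_le_univ _)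
    exact le_of_mul_le_mul_right (by linarith) hM
  have main : ∀ k ≤ N, ∃ S : Finset Ab, #S ≤ k ∧ (∀ a ∈ S, valid a) ∧
      (∀ a ∈ S, ∀ b ∈ S, a ≠ b → Disjoint (supp a) (supp b)) ∧
      ∑ t, (1 / 2 : ℝ) ^ #{a ∈ S | serves a t} ≤ Fintype.card Tg * (1 - p / 2) ^ k := by
    intro k
    induction k with
    | zero => exact fun _ => ⟨∅, by simp, by simp, by simp, by simp⟩
    | succ k ih =>
      intro hk
      obtain ⟨S, hSk, hval, hdisj, hsum⟩ := ih (by omega)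
      set Z := S.biUnion supp with hZ
      have hZc : #Z ≤ K * N := by
        calc #Z ≤ ∑ a ∈ S, #(supp a) := card_biUnion_le
          _ ≤ ∑ _a ∈ S, K := sum_le_sum fun a _ => hK a
          _ = #S * K := by simp
          _ ≤ K * N := by rw [mul_comm]; exact Nat.mul_le_mul_left _ (by omega)
      set G : Finset Ab := {a | valid a ∧ Disjoint (supp a) Z} with hG
      set w : Tg → ℝ := fun t => (1 / 2 : ℝ) ^ #{a ∈ S | serves a t} with hw
      have hw0 : ∀ t, 0 ≤ w t := fun t => by positivity
      have hGM : (#G : ℝ) ≤ Fintype.card Ab := Nat.cast_le.2 (card_le_univ _)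
      have hserve : ∀ t, p * #G ≤ #{a ∈ G | serves a t} := by
        intro t
        have e : G.filter (fun a => serves a t) =
            univ.filter fun a => valid a ∧ serves a t ∧ Disjoint (supp a) Z := by
          ext a; simp only [hG, mem_filter, mem_univ, true_and]; tauto
        rw [e]
        exact le_trans (by gcongr) (h Z t hZc)
      have hGne : G.Nonempty := by
        obtain ⟨t⟩ := ‹Nonempty Tg›
        have h1 := h Z t hZc
        have h2 : 0 < #{a | valid a ∧ serves a t ∧ Disjoint (supp a) Z} := by
          have : (0 : ℝ) < #{a | valid a ∧ serves a t ∧ Disjoint (supp a) Z} :=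
            lt_of_lt_of_le (by positivity) h1
          exact_mod_cast this
        obtain ⟨a, ha⟩ := card_pos.1 h2
        simp only [mem_filter, mem_univ, true_and] at ha
        exact ⟨a, by simp [hG, ha.1, ha.2.2]⟩
      obtain ⟨a, haG, ha⟩ : ∃ a ∈ G, ∑ t, w t * (if serves a t then 1 / 2 else 1) ≤
          (1 - p / 2) * ∑ t, w t := by
        refine exists_le_of_sum_le hGne ?_
        rw [sum_comm, sum_const, nsmul_eq_mul, mul_sum, mul_sum]
        refine sum_le_sum fun t _ => ?_
        rw [← mul_sum]
        have e : ∑ a ∈ G, (if serves a t then (1 / 2 : ℝ) else 1) =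
            #G - 1 / 2 * #{a ∈ G | serves a t} := by
          rw [← sum_boole (fun a => serves a t) G, mul_sum, ← nsmul_one #G, ← sum_const,
            ← sum_sub_distrib]
          refine sum_congr rfl fun a _ => ?_
          split_ifs <;> norm_num
        rw [e]
        nlinarith [mul_le_mul_of_nonneg_left (hserve t) (hw0 t)]
      have haZ : valid a ∧ Disjoint (supp a) Z := by simpa [hG] using haG
      have hdisja : ∀ b ∈ S, Disjoint (supp a) (supp b) := fun b hb =>
        haZ.2.mono_right (subset_biUnion_of_mem supp hb)
      have haS : a ∉ S := fun haS => (hne a).ne_empty (disjoint_self_iff_empty _ |>.1 (hdisja a haS))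
      refine ⟨insert a S, ?_, ?_, ?_, ?_⟩
      · rw [card_insert_of_notMem haS]; omega
      · intro b hb
        rcases mem_insert.1 hb with rfl | hb
        exacts [haZ.1, hval b hb]
      · intro b hb b' hb' hbb
        rw [mem_insert] at hb hb'
        rcases hb with rfl | hb <;> rcases hb' with rfl | hb'
        · exact absurd rfl hbb
        · exact hdisja b' hb'
        · exact (hdisja b hb).symm
        · exact hdisj b hb b' hb' hbb
      · calc ∑ t, (1 / 2 : ℝ) ^ #{b ∈ insert a S | serves b t}
            = ∑ t, w t * (if serves a t then 1 / 2 else 1) := by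
              refine sum_congr rfl fun t _ => ?_
              rw [filter_insert]
              split_ifs
              · rw [card_insert_of_notMem (by simp [haS]), pow_succ]
              · rw [mul_one]
          _ ≤ (1 - p / 2) * ∑ t, w t := ha
          _ ≤ (1 - p / 2) * (Fintype.card Tg * (1 - p / 2) ^ k) := by
              have : 0 ≤ 1 - p / 2 := by linarith
              gcongr
          _ = _ := by ring
  obtain ⟨S, h1, h2, h3, h4⟩ := main N le_rfl
  refine ⟨S, h1, h2, h3, fun t => le_trans ?_ h4⟩
  exact single_le_sum (f := fun t => (1 / 2 : ℝ) ^ #{a ∈ S | serves a t})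
    (fun t _ => by positivity) (mem_univ t)

end DisjointFamily

section Gadgets

open Finset

lemma Tiled.four_inserts {P ι : Type*} [DecidableEq P] {s : ι → Finset P} {p₁ p₂ p₃ p₄ : P}
    {l₁ l₂ l₃ l₄ : Finset P} (h₁ : Tiled s (insert p₁ l₁)) (h₂ : Tiled s (insert p₂ l₂))
    (h₃ : Tiled s (insert p₃ l₃)) (h₄ : Tiled s (insert p₄ l₄)) (hp : #{p₁, p₂, p₃, p₄} = 4)
    (hpl : Disjoint {p₁, p₂, p₃, p₄} (l₁ ∪ l₂ ∪ l₃ ∪ l₄)) (d₂ : Disjoint l₂ l₁)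
    (d₃ : Disjoint l₃ (l₁ ∪ l₂)) (d₄ : Disjoint l₄ (l₁ ∪ l₂ ∪ l₃)) :
    Tiled s ({p₁, p₂, p₃, p₄} ∪ (l₁ ∪ l₂ ∪ l₃ ∪ l₄)) := by
  have hdist : p₁ ≠ p₂ ∧ p₁ ≠ p₃ ∧ p₁ ≠ p₄ ∧ p₂ ≠ p₃ ∧ p₂ ≠ p₄ ∧ p₃ ≠ p₄ := by
    refine ⟨?_, ?_, ?_, ?_, ?_, ?_⟩ <;> rintro rfl <;>
      refine absurd hp (ne_of_lt (lt_of_le_of_lt ?_ (by norm_num : 3 < 4)))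
    · simpa using card_le_three (a := p₁) (b := p₃) (c := p₄)
    · rw [show ({p₁, p₂, p₁, p₄} : Finset P) = {p₁, p₂, p₄} by ext; simp; tauto]
      exact card_le_three
    · rw [show ({p₁, p₂, p₃, p₁} : Finset P) = {p₁, p₂, p₃} by ext; simp; tauto]
      exact card_le_three
    · simpa using card_le_three (a := p₁) (b := p₂) (c := p₄)
    · rw [show ({p₁, p₂, p₃, p₂} : Finset P) = {p₁, p₂, p₃} by ext; simp; tauto]
      exact card_le_three
    · simpa using card_le_three (a := p₁) (b := p₂) (c := p₃)
  obtain ⟨n₁, n₂, n₃, n₄, n₅, n₆⟩ := hdist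
  simp only [disjoint_union_right, disjoint_insert_left, disjoint_singleton_left] at hpl d₃ d₄
  obtain ⟨⟨⟨⟨a1, a2, a3, a4⟩, ⟨b1, b2, b3, b4⟩⟩, ⟨c1, c2, c3, c4⟩⟩, ⟨e1, e2, e3, e4⟩⟩ := hpl
  have e : ({p₁, p₂, p₃, p₄} ∪ (l₁ ∪ l₂ ∪ l₃ ∪ l₄) : Finset P) =
      insert p₁ l₁ ∪ insert p₂ l₂ ∪ insert p₃ l₃ ∪ insert p₄ l₄ := by
    ext; simp only [mem_union, mem_insert, mem_singleton]; tauto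
  rw [e]
  refine ((h₁.union h₂ ?_).union h₃ ?_).union h₄ ?_ <;>
    simp only [disjoint_union_left, disjoint_insert_left, disjoint_insert_right, mem_insert,
      not_or, *, d₂.symm, d₃.1.symm, d₃.2.symm, d₄.1.1.symm, d₄.1.2.symm, d₄.2.symm] <;>
    simp_all [n₁.symm, n₂.symm, n₃.symm, n₄.symm, n₅.symm, n₆.symm]

variable {Q V : Type*} [DecidableEq Q] [DecidableEq V]

/-- The points of a quadruple of vertices. -/
def quadPoints (u : V × V × V × V) : Finset (Q ⊕ V) :=
  {Sum.inr u.1, Sum.inr u.2.1, Sum.inr u.2.2.1, Sum.inr u.2.2.2}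

/-- The points of a colour together with three vertices. -/
def linkPoints (x : Q × V × V × V) : Finset (Q ⊕ V) :=
  {Sum.inl x.1, Sum.inr x.2.1, Sum.inr x.2.2.1, Sum.inr x.2.2.2}

lemma tupleEdge_eq_insert_linkPoints (x : Q × V × V × V) (v : V) :
    tupleEdge (x.1, v, x.2) = insert (Sum.inr v) (linkPoints x) := by
  ext p
  rcases p with j | w
  · simp [inl_mem_tupleEdge, linkPoints, eq_comm]
  · simp [inr_mem_tupleEdge, linkPoints, eq_comm]

lemma tupleEdge_eq_insert_quadPoints (i : Q) (u : V × V × V × V) :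
    tupleEdge (i, u) = insert (Sum.inl i) (quadPoints u) := by
  ext p
  rcases p with j | w
  · simp [inl_mem_tupleEdge, quadPoints, eq_comm]
  · simp [inr_mem_tupleEdge, quadPoints, eq_comm]

lemma card_quadPoints_of_card_tupleEdge {i : Q} {u : V × V × V × V}
    (h : #(tupleEdge (i, u)) = 5) : #(quadPoints u : Finset (Q ⊕ V)) = 4 := by
  rw [tupleEdge_eq_insert_quadPoints, card_insert_of_notMem (by simp [quadPoints])] at h
  omega

/-- Absorbing gadgets: a quadruple of vertices with a link for each of them. -/
abbrev Gadget (Q V : Type*) :=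
  (V × V × V × V) × (Q × V × V × V) × (Q × V × V × V) × (Q × V × V × V) × (Q × V × V × V)

/-- The union of the four links of a gadget. -/
def gadgetLinks (a : Gadget Q V) : Finset (Q ⊕ V) :=
  linkPoints a.2.1 ∪ linkPoints a.2.2.1 ∪ linkPoints a.2.2.2.1 ∪ linkPoints a.2.2.2.2

/-- All points of a gadget. -/
def gadgetPoints (a : Gadget Q V) : Finset (Q ⊕ V) := quadPoints a.1 ∪ gadgetLinks a

/-- The quadruple `v` is joined to the links of the gadget `a`. -/
def Linked (T : Finset (Q × V × V × V × V)) (a : Gadget Q V) (v : V × V × V × V) : Prop :=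
  (a.2.1.1, v.1, a.2.1.2) ∈ T ∧ (a.2.2.1.1, v.2.1, a.2.2.1.2) ∈ T ∧
  (a.2.2.2.1.1, v.2.2.1, a.2.2.2.1.2) ∈ T ∧ (a.2.2.2.2.1, v.2.2.2, a.2.2.2.2.2) ∈ T

/-- The parts of the gadget `a` are disjoint and its own quadruple is joined to its links. -/
def GadgetValid (T : Finset (Q × V × V × V × V)) (a : Gadget Q V) : Prop :=
  #(quadPoints a.1 : Finset (Q ⊕ V)) = 4 ∧ Linked T a a.1 ∧
  Disjoint (linkPoints a.2.1) (quadPoints a.1) ∧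
  Disjoint (linkPoints a.2.2.1) (quadPoints a.1 ∪ linkPoints a.2.1) ∧
  Disjoint (linkPoints a.2.2.2.1)
    (quadPoints a.1 ∪ linkPoints a.2.1 ∪ linkPoints a.2.2.1) ∧
  Disjoint (linkPoints a.2.2.2.2)
    (quadPoints a.1 ∪ linkPoints a.2.1 ∪ linkPoints a.2.2.1 ∪ linkPoints a.2.2.2.1)

/-- The gadget `a` can absorb the colour and the four vertices of `t`. -/
def Serves (T : Finset (Q × V × V × V × V)) (a : Gadget Q V) (t : Q × V × V × V × V) : Prop :=
  (t.1, a.1) ∈ T ∧ Linked T a t.2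

variable {T : Finset (Q × V × V × V × V)}

lemma tiled_of_mem {e : Q × V × V × V × V} (he : e ∈ T) :
    Tiled (fun i : T => tupleEdge i.1) (tupleEdge e) :=
  Tiled.of_edge (s := fun i : T => tupleEdge i.1) ⟨e, he⟩

lemma tiled_quadPoints_union_gadgetLinks {a : Gadget Q V} (ha : GadgetValid T a)
    {v : V × V × V × V} (hv : Linked T a v) (hcard : #(quadPoints v : Finset (Q ⊕ V)) = 4)
    (hd : Disjoint (quadPoints v) (gadgetLinks a)) :
    Tiled (fun i : T => tupleEdge i.1) (quadPoints v ∪ gadgetLinks a) := by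
  obtain ⟨-, -, -, h2, h3, h4⟩ := ha
  simp only [disjoint_union_right] at h2 h3 h4
  obtain ⟨v1, v2, v3, v4⟩ := hv
  refine Tiled.four_inserts ?_ ?_ ?_ ?_ hcard hd h2.2 ?_ ?_
  · rw [← tupleEdge_eq_insert_linkPoints]; exact tiled_of_mem v1
  · rw [← tupleEdge_eq_insert_linkPoints]; exact tiled_of_mem v2
  · rw [← tupleEdge_eq_insert_linkPoints]; exact tiled_of_mem v3
  · rw [← tupleEdge_eq_insert_linkPoints]; exact tiled_of_mem v4
  · rw [disjoint_union_right]; exact ⟨h3.1.2, h3.2⟩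
  · rw [disjoint_union_right, disjoint_union_right]; exact ⟨⟨h4.1.1.2, h4.1.2⟩, h4.2⟩

lemma GadgetValid.disjoint {a : Gadget Q V} (ha : GadgetValid T a) :
    Disjoint (quadPoints a.1) (gadgetLinks a) := by
  obtain ⟨-, -, h1, h2, h3, h4⟩ := ha
  simp only [disjoint_union_right] at h2 h3 h4
  simp only [gadgetLinks, disjoint_union_right]
  exact ⟨⟨⟨h1.symm, h2.1.symm⟩, h3.1.1.symm⟩, h4.1.1.1.symm⟩

lemma GadgetValid.tiled {a : Gadget Q V} (ha : GadgetValid T a) :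
    Tiled (fun i : T => tupleEdge i.1) (gadgetPoints a) :=
  tiled_quadPoints_union_gadgetLinks ha ha.2.1 ha.1 ha.disjoint

lemma GadgetValid.tiled_union {a : Gadget Q V} (ha : GadgetValid T a) {t : Q × V × V × V × V}
    (ht : Serves T a t) (hcard : #(tupleEdge t) = 5)
    (hd : Disjoint (tupleEdge t) (gadgetPoints a)) :
    Tiled (fun i : T => tupleEdge i.1) (tupleEdge t ∪ gadgetPoints a) := by
  obtain ⟨i, v⟩ := t
  have hq := card_quadPoints_of_card_tupleEdge hcard
  rw [tupleEdge_eq_insert_quadPoints] at hd ⊢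
  have h1 := tiled_quadPoints_union_gadgetLinks ha ht.2 hq
    (hd.mono (subset_insert _ _) subset_union_right)
  have h2 := tiled_of_mem ht.1
  rw [tupleEdge_eq_insert_quadPoints] at h2
  have e : insert (Sum.inl i) (quadPoints v) ∪ gadgetPoints a =
      (quadPoints v ∪ gadgetLinks a) ∪ insert (Sum.inl i) (quadPoints a.1) := by
    ext; simp only [mem_union, mem_insert, gadgetPoints]; tauto
  rw [e]
  refine h1.union h2 ?_
  have h3 := hd.mono_right (subset_union_left : quadPoints a.1 ⊆ gadgetPoints a)
  have h4 := hd.mono_right (subset_union_right : gadgetLinks a ⊆ gadgetPoints a)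
  rw [disjoint_insert_left] at h3 h4
  rw [disjoint_insert_right, disjoint_union_left]
  refine ⟨?_, h3.2, ha.disjoint.symm⟩
  rw [mem_union, not_or]
  exact ⟨by simp [quadPoints], h4.1⟩

end Gadgets

section GadgetCount

open Finset

lemma mul_le_card_filter_prod {α β : Type*} [Fintype α] [Fintype β] {P : α → Prop}
    {R : α → β → Prop} [DecidablePred P] [∀ a b, Decidable (R a b)] {A B : ℝ} (hB : 0 ≤ B)
    (hP : A ≤ #{a | P a}) (hR : ∀ a, P a → B ≤ #{b | R a b}) :
    A * B ≤ #{p : α × β | P p.1 ∧ R p.1 p.2} := by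
  have e : (#{p : α × β | P p.1 ∧ R p.1 p.2} : ℝ) = ∑ a with P a, (#{b | R a b} : ℝ) := by
    rw [← Nat.cast_sum, card_filter, Fintype.sum_prod_type, sum_filter]
    congr 1
    refine sum_congr rfl fun a _ => ?_
    by_cases h : P a
    · simp only [h, true_and, if_true, card_filter]
    · simp [h]
  rw [e]
  calc A * B ≤ #{a | P a} * B := by gcongr
    _ = ∑ a with P a, B := by rw [sum_const, nsmul_eq_mul]
    _ ≤ _ := sum_le_sum fun a ha => hR a (mem_filter.1 ha).2

variable {Q V : Type*} [DecidableEq Q] [DecidableEq V]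

lemma card_quadPoints_le (u : V × V × V × V) : #(quadPoints u : Finset (Q ⊕ V)) ≤ 4 := card_le_four

lemma card_linkPoints_le (x : Q × V × V × V) : #(linkPoints x) ≤ 4 := card_le_four

variable [Fintype V]

lemma card_quadPoints_mem_le (z : Q ⊕ V) :
    #{u : V × V × V × V | z ∈ (quadPoints u : Finset (Q ⊕ V))} ≤ 4 * Fintype.card V ^ 3 := by
  rcases z with j | v
  · simp [quadPoints]
  · calc _ ≤ #(({v} : Finset V) ×ˢ (univ : Finset (V × V × V)) ∪
          (univ : Finset V) ×ˢ ({v} : Finset V) ×ˢ (univ : Finset (V × V)) ∪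
          (univ : Finset V) ×ˢ (univ : Finset V) ×ˢ ({v} : Finset V) ×ˢ (univ : Finset V) ∪
          (univ : Finset V) ×ˢ (univ : Finset V) ×ˢ (univ : Finset V) ×ˢ ({v} : Finset V)) := by
          refine card_le_card fun x hx => ?_
          simp [quadPoints] at hx
          simp only [mem_union, mem_product, mem_univ, mem_singleton, true_and, and_true]
          rcases hx with h | h | h | h <;> simp [h]
      _ ≤ _ := by
          refine (card_union_le _ _).trans (Nat.add_le_add_right ((card_union_le _ _).trans
            (Nat.add_le_add_right (card_union_le _ _) _)) _) |>.trans ?_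
          simp only [card_product, card_univ, card_singleton, Fintype.card_prod]
          refine le_of_eq ?_
          ring

lemma card_quadPoints_not_disjoint_le (Z : Finset (Q ⊕ V)) :
    #{u : V × V × V × V | ¬ Disjoint (quadPoints u) Z} ≤ #Z * (4 * Fintype.card V ^ 3) := by
  calc _ ≤ #(Z.biUnion fun z => univ.filter fun u : V × V × V × V =>
          z ∈ (quadPoints u : Finset (Q ⊕ V))) := by
        refine card_le_card fun x hx => ?_
        simp only [mem_filter, mem_univ, true_and, not_disjoint_iff] at hx
        obtain ⟨z, h1, h2⟩ := hx
        exact mem_biUnion.2 ⟨z, h2, by simp [h1]⟩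
    _ ≤ ∑ z ∈ Z, 4 * Fintype.card V ^ 3 :=
        card_biUnion_le.trans (sum_le_sum fun z _ => card_quadPoints_mem_le z)
    _ = _ := by simp

variable [Fintype Q]

lemma card_linkPoints_mem_le (hV : Fintype.card V = 4 * Fintype.card Q) (z : Q ⊕ V) :
    #{x : Q × V × V × V | z ∈ linkPoints x} ≤ Fintype.card V ^ 3 := by
  rcases z with j | v
  · calc _ ≤ #(({j} : Finset Q) ×ˢ (univ : Finset (V × V × V))) := by
          refine card_le_card fun x hx => ?_
          simp [linkPoints] at hx
          simp [hx]
      _ = _ := by simp; ring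
  · calc _ ≤ #((univ : Finset Q) ×ˢ ({v} : Finset V) ×ˢ (univ : Finset (V × V)) ∪
          (univ : Finset Q) ×ˢ (univ : Finset V) ×ˢ ({v} : Finset V) ×ˢ (univ : Finset V) ∪
          (univ : Finset Q) ×ˢ (univ : Finset V) ×ˢ (univ : Finset V) ×ˢ ({v} : Finset V)) := by
          refine card_le_card fun x hx => ?_
          simp [linkPoints] at hx
          simp only [mem_union, mem_product, mem_univ, mem_singleton, true_and, and_true]
          rcases hx with h | h | h <;> simp [h]
      _ ≤ _ := by
          refine (card_union_le _ _).trans (Nat.add_le_add_right (card_union_le _ _) _) |>.trans ?_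
          simp only [card_product, card_univ, card_singleton, Fintype.card_prod, hV]
          ring_nf
          nlinarith [Nat.zero_le (Fintype.card Q ^ 3)]

lemma card_linkPoints_not_disjoint_le (hV : Fintype.card V = 4 * Fintype.card Q)
    (Z : Finset (Q ⊕ V)) :
    #{x : Q × V × V × V | ¬ Disjoint (linkPoints x) Z} ≤ #Z * Fintype.card V ^ 3 := by
  calc _ ≤ #(Z.biUnion fun z => univ.filter fun x : Q × V × V × V => z ∈ linkPoints x) := by
        refine card_le_card fun x hx => ?_
        simp only [mem_filter, mem_univ, true_and, not_disjoint_iff] at hx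
        obtain ⟨z, h1, h2⟩ := hx
        exact mem_biUnion.2 ⟨z, h2, by simp [h1]⟩
    _ ≤ ∑ z ∈ Z, Fintype.card V ^ 3 :=
        card_biUnion_le.trans (sum_le_sum fun z _ => card_linkPoints_mem_le hV z)
    _ = _ := by simp

lemma card_sub_le_card_and {α : Type*} [Fintype α] (P R : α → Prop) [DecidablePred P]
    [DecidablePred R] : (#{a | P a} : ℝ) - #{a | ¬ R a} ≤ #{a | P a ∧ R a} := by
  classical
  rw [sub_le_iff_le_add]
  have : #{a | P a} ≤ #{a | P a ∧ R a} + #{a | ¬ R a} := by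
    refine (card_le_card fun a ha => ?_).trans (card_union_le _ _)
    simp only [mem_union, mem_filter, mem_univ, true_and] at ha ⊢
    by_cases h : R a <;> simp [h, ha]
  exact_mod_cast this

variable {T : Finset (Q × V × V × V × V)}

open scoped Classical in
lemma card_common_links_ge (hV : Fintype.card V = 4 * Fintype.card Q)
    (hdeg : ∀ j v, 9 / 16 * (Fintype.card V : ℝ) ^ 3 ≤ #{p : V × V × V | (j, v, p) ∈ T})
    {Z : Finset (Q ⊕ V)} (hZ : (#Z : ℝ) ≤ Fintype.card V / 128) (u v : V) :
    (Fintype.card V : ℝ) ^ 4 / 64 ≤ #{x : Q × V × V × V | ((x.1, u, x.2) ∈ T ∧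
      (x.1, v, x.2) ∈ T) ∧ Disjoint (linkPoints x) Z} := by
  have h4 : (#{x : Q × V × V × V | ¬ Disjoint (linkPoints x) Z} : ℝ) ≤
      #Z * (Fintype.card V : ℝ) ^ 3 := by
    exact_mod_cast card_linkPoints_not_disjoint_le hV Z
  set n : ℝ := (Fintype.card V : ℝ) with hn
  have hm : (Fintype.card Q : ℝ) = n / 4 := by rw [hn, hV]; push_cast; ring
  have h1 : ∀ j : Q, n ^ 3 / 8 ≤ #{p : V × V × V | (j, u, p) ∈ T ∧ (j, v, p) ∈ T} := by
    intro j
    refine le_trans ?_ (card_sub_le_card_and (fun p : V × V × V => (j, u, p) ∈ T)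
      (fun p => (j, v, p) ∈ T))
    have h2 : (#{p : V × V × V | (j, v, p) ∈ T} : ℝ) + #{p : V × V × V | ¬ (j, v, p) ∈ T} =
        n ^ 3 := by
      rw [← Nat.cast_add, card_filter_add_card_filter_not]
      simp [hn]; ring
    have := hdeg j u
    have := hdeg j v
    linarith
  have h3 : n / 4 * (n ^ 3 / 8) ≤
      #{x : Q × V × V × V | (x.1, u, x.2) ∈ T ∧ (x.1, v, x.2) ∈ T} := by
    have := mul_le_card_filter_prod (P := fun _ : Q => True) (A := n / 4) (B := n ^ 3 / 8)
      (R := fun (j : Q) (p : V × V × V) => (j, u, p) ∈ T ∧ (j, v, p) ∈ T) (by positivity)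
      (by simp [hm]) (fun j _ => h1 j)
    simpa using this
  have h5 : (#Z : ℝ) * n ^ 3 ≤ n / 128 * n ^ 3 := by gcongr
  have h6 := card_sub_le_card_and (fun x : Q × V × V × V => (x.1, u, x.2) ∈ T ∧
    (x.1, v, x.2) ∈ T) (fun x => Disjoint (linkPoints x) Z)
  refine le_trans ?_ (h6.trans_eq (by congr!))
  have h7 : n / 4 * (n ^ 3 / 8) = n ^ 4 / 32 := by ring
  have h8 : n / 128 * n ^ 3 = n ^ 4 / 128 := by ring
  have : 0 ≤ n ^ 4 := by positivity
  linarith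

lemma card_quads_ge
    (hdeg : ∀ j v, 9 / 16 * (Fintype.card V : ℝ) ^ 3 ≤ #{p : V × V × V | (j, v, p) ∈ T})
    {Z : Finset (Q ⊕ V)} (hZ : (#Z : ℝ) ≤ Fintype.card V / 128) (i : Q) :
    (Fintype.card V : ℝ) ^ 4 / 2 ≤
      #{u : V × V × V × V | (i, u) ∈ T ∧ Disjoint (quadPoints u) Z} := by
  have h4 : (#{u : V × V × V × V | ¬ Disjoint (quadPoints u) Z} : ℝ) ≤
      #Z * (4 * (Fintype.card V : ℝ) ^ 3) := by
    exact_mod_cast card_quadPoints_not_disjoint_le Z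
  set n : ℝ := (Fintype.card V : ℝ) with hn
  have h3 : n * (9 / 16 * n ^ 3) ≤ #{u : V × V × V × V | (i, u) ∈ T} := by
    have := mul_le_card_filter_prod (P := fun _ : V => True) (A := n) (B := 9 / 16 * n ^ 3)
      (R := fun (v : V) (p : V × V × V) => (i, v, p) ∈ T) (by positivity)
      (by simp [hn]) (fun j _ => hdeg i j)
    simpa using this
  have h5 : (#Z : ℝ) * (4 * n ^ 3) ≤ n / 128 * (4 * n ^ 3) := by gcongr
  refine le_trans ?_ (card_sub_le_card_and _ _)
  have : 0 ≤ n ^ 4 := by positivity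
  nlinarith

/-- The link `x` is joined to both `u` and `v` and avoids `Z` and `W`. -/
def FreeLink (T : Finset (Q × V × V × V × V)) (Z : Finset (Q ⊕ V)) (u v : V)
    (W : Finset (Q ⊕ V)) (x : Q × V × V × V) : Prop :=
  ((x.1, u, x.2) ∈ T ∧ (x.1, v, x.2) ∈ T) ∧ Disjoint (linkPoints x) (Z ∪ W)

open scoped Classical in
lemma card_serving_gadgets_ge (hV : Fintype.card V = 4 * Fintype.card Q)
    (hT : ∀ e ∈ T, #(tupleEdge e) = 5)
    (hdeg : ∀ j v, 9 / 16 * (Fintype.card V : ℝ) ^ 3 ≤ #{p : V × V × V | (j, v, p) ∈ T})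
    {Z : Finset (Q ⊕ V)} (hZ : (#Z : ℝ) + 16 ≤ Fintype.card V / 128) (t : Q × V × V × V × V) :
    1 / 131072 * (Fintype.card (Gadget Q V) : ℝ) ≤
      #{a : Gadget Q V | GadgetValid T a ∧ Serves T a t ∧ Disjoint (gadgetPoints a) Z} := by
  obtain ⟨i, v₁, v₂, v₃, v₄⟩ := t
  have hquad : (Fintype.card V : ℝ) ^ 4 / 2 ≤
      #{u : V × V × V × V | (i, u) ∈ T ∧ Disjoint (quadPoints u) Z} := by
    convert card_quads_ge hdeg (le_trans (by linarith) hZ : (#Z : ℝ) ≤ _) i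
  have hlink : ∀ (W : Finset (Q ⊕ V)) (u v : V), #W ≤ 16 →
      (Fintype.card V : ℝ) ^ 4 / 64 ≤ #{x : Q × V × V × V | FreeLink T Z u v W x} := by
    intro W u v hW
    have : (#(Z ∪ W) : ℝ) ≤ #Z + #W := by exact_mod_cast card_union_le Z W
    have : (#W : ℝ) ≤ 16 := by exact_mod_cast hW
    convert card_common_links_ge hV hdeg (Z := Z ∪ W) (by linarith) u v
    exact Iff.rfl
  have hm : (Fintype.card Q : ℝ) = (Fintype.card V : ℝ) / 4 := by rw [hV]; push_cast; ring
  set n : ℝ := (Fintype.card V : ℝ) with hn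
  set B : ℝ := n ^ 4 / 64 with hB
  have hB0 : 0 ≤ B := by positivity
  have hu := card_quadPoints_le (Q := Q) (V := V)
  have hx := card_linkPoints_le (Q := Q) (V := V)
  have h₁ : ∀ (W : Finset (Q ⊕ V)) (u : V × V × V × V), #W ≤ 16 →
      B ≤ #{x | FreeLink T Z u.2.2.2 v₄ W x} := fun W u hW => hlink W _ _ hW
  have h₂ : ∀ (W : Finset (Q ⊕ V)) (u : V × V × V × V), #W ≤ 12 → B * B ≤
      #{x : (Q × V × V × V) × Q × V × V × V | FreeLink T Z u.2.2.1 v₃ W x.1 ∧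
        FreeLink T Z u.2.2.2 v₄ (W ∪ linkPoints x.1) x.2} := by
    intro W u hW
    refine mul_le_card_filter_prod (P := FreeLink T Z u.2.2.1 v₃ W)
      (R := fun x y => FreeLink T Z u.2.2.2 v₄ (W ∪ linkPoints x) y) hB0
      (hlink W _ _ (by omega)) fun x _ => h₁ _ u ?_
    have := card_union_le W (linkPoints x)
    have := hx x
    omega
  have h₃ : ∀ (W : Finset (Q ⊕ V)) (u : V × V × V × V), #W ≤ 8 → B * (B * B) ≤
      #{x : (Q × V × V × V) × (Q × V × V × V) × Q × V × V × V | FreeLink T Z u.2.1 v₂ W x.1 ∧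
        FreeLink T Z u.2.2.1 v₃ (W ∪ linkPoints x.1) x.2.1 ∧
        FreeLink T Z u.2.2.2 v₄ (W ∪ linkPoints x.1 ∪ linkPoints x.2.1) x.2.2} := by
    intro W u hW
    refine mul_le_card_filter_prod (P := FreeLink T Z u.2.1 v₂ W)
      (R := fun x (y : (Q × V × V × V) × Q × V × V × V) =>
        FreeLink T Z u.2.2.1 v₃ (W ∪ linkPoints x) y.1 ∧
        FreeLink T Z u.2.2.2 v₄ (W ∪ linkPoints x ∪ linkPoints y.1) y.2) (by positivity)
      (hlink W _ _ (by omega)) fun x _ => h₂ _ u ?_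
    have := card_union_le W (linkPoints x)
    have := hx x
    omega
  have h₄ : ∀ u : V × V × V × V, B * (B * (B * B)) ≤
      #{x : (Q × V × V × V) × (Q × V × V × V) × (Q × V × V × V) × Q × V × V × V |
        FreeLink T Z u.1 v₁ (quadPoints u) x.1 ∧
        FreeLink T Z u.2.1 v₂ (quadPoints u ∪ linkPoints x.1) x.2.1 ∧
        FreeLink T Z u.2.2.1 v₃ (quadPoints u ∪ linkPoints x.1 ∪ linkPoints x.2.1) x.2.2.1 ∧
        FreeLink T Z u.2.2.2 v₄ (quadPoints u ∪ linkPoints x.1 ∪ linkPoints x.2.1 ∪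
          linkPoints x.2.2.1) x.2.2.2} := by
    intro u
    refine mul_le_card_filter_prod (P := FreeLink T Z u.1 v₁ (quadPoints u))
      (R := fun x (y : (Q × V × V × V) × (Q × V × V × V) × Q × V × V × V) =>
        FreeLink T Z u.2.1 v₂ (quadPoints u ∪ linkPoints x) y.1 ∧
        FreeLink T Z u.2.2.1 v₃ (quadPoints u ∪ linkPoints x ∪ linkPoints y.1) y.2.1 ∧
        FreeLink T Z u.2.2.2 v₄ (quadPoints u ∪ linkPoints x ∪ linkPoints y.1 ∪
          linkPoints y.2.1) y.2.2) (by positivity)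
      (hlink _ _ _ ((hu u).trans (by norm_num))) fun x _ => h₃ _ u ?_
    have := card_union_le (quadPoints u) (linkPoints x)
    have := hx x
    have := hu u
    omega
  have key := mul_le_card_filter_prod
    (P := fun u : V × V × V × V => (i, u) ∈ T ∧ Disjoint (quadPoints u) Z) (A := n ^ 4 / 2)
    (B := B * (B * (B * B)))
    (R := fun u (x : (Q × V × V × V) × (Q × V × V × V) × (Q × V × V × V) × Q × V × V × V) =>
        FreeLink T Z u.1 v₁ (quadPoints u) x.1 ∧
        FreeLink T Z u.2.1 v₂ (quadPoints u ∪ linkPoints x.1) x.2.1 ∧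
        FreeLink T Z u.2.2.1 v₃ (quadPoints u ∪ linkPoints x.1 ∪ linkPoints x.2.1) x.2.2.1 ∧
        FreeLink T Z u.2.2.2 v₄ (quadPoints u ∪ linkPoints x.1 ∪ linkPoints x.2.1 ∪
          linkPoints x.2.2.1) x.2.2.2) (by positivity) hquad fun u _ => h₄ u
  have hcard : 1 / 131072 * (Fintype.card (Gadget Q V) : ℝ) = n ^ 4 / 2 * (B * (B * (B * B))) := by
    simp only [Fintype.card_prod, Nat.cast_mul, hm, ← hn, hB]
    ring
  rw [hcard]
  refine key.trans (Nat.cast_le.2 (card_le_card (subset_iff.2 fun a ha => ?_)))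
  rw [mem_filter_univ] at ha ⊢
  simp only [FreeLink] at ha
  obtain ⟨⟨q1, q2⟩, ⟨⟨l1, l1'⟩, d1⟩, ⟨⟨l2, l2'⟩, d2⟩, ⟨⟨l3, l3'⟩, d3⟩, ⟨⟨l4, l4'⟩, d4⟩⟩ := ha
  rw [disjoint_union_right] at d1 d2 d3 d4
  refine ⟨⟨card_quadPoints_of_card_tupleEdge (hT _ q1), ⟨l1, l2, l3, l4⟩, d1.2, d2.2, d3.2, d4.2⟩,
    ⟨q1, l1', l2', l3', l4'⟩, ?_⟩
  simp only [gadgetPoints, gadgetLinks, disjoint_union_left]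
  exact ⟨q2, ⟨⟨d1.1, d2.1⟩, d3.1⟩, d4.1⟩

end GadgetCount

section Absorbing

open Finset

lemma Tiled.biUnion {P ι α : Type*} [DecidableEq P] [DecidableEq α] {s : ι → Finset P}
    (S : Finset α) (f : α → Finset P) (hf : ∀ a ∈ S, Tiled s (f a))
    (hd : ∀ a ∈ S, ∀ b ∈ S, a ≠ b → Disjoint (f a) (f b)) : Tiled s (S.biUnion f) := by
  induction S using Finset.induction_on with
  | empty => exact Tiled.empty
  | insert a S ha ih =>
    rw [biUnion_insert]
    refine (hf a (mem_insert_self a S)).union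
      (ih (fun b hb => hf b (mem_insert_of_mem hb))
        fun b hb c hc => hd b (mem_insert_of_mem hb) c (mem_insert_of_mem hc)) ?_
    rw [disjoint_biUnion_right]
    intro b hb
    exact hd a (mem_insert_self a S) b (mem_insert_of_mem hb) (by rintro rfl; exact ha hb)

variable {Q V : Type*} [DecidableEq Q] [DecidableEq V]

lemma toLeft_tupleEdge (e : Q × V × V × V × V) : (tupleEdge e).toLeft = {e.1} := by
  ext j; simp [inl_mem_tupleEdge, eq_comm]

lemma toRight_tupleEdge (e : Q × V × V × V × V) :
    (tupleEdge e).toRight = {e.2.1, e.2.2.1, e.2.2.2.1, e.2.2.2.2} := by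
  ext j; simp [inr_mem_tupleEdge, eq_comm]

lemma card_toRight_tupleEdge {e : Q × V × V × V × V} (h : #(tupleEdge e) = 5) :
    #(tupleEdge e).toRight = 4 := by
  have := card_toLeft_add_card_toRight (u := tupleEdge e)
  rw [toLeft_tupleEdge, card_singleton] at this
  omega

lemma card_tupleEdge_of_card_eq_four {j : Q} {a b c d : V} (h : #{a, b, c, d} = 4) :
    #(tupleEdge (j, a, b, c, d)) = 5 := by
  rw [← card_toLeft_add_card_toRight, toLeft_tupleEdge, toRight_tupleEdge]
  simp [h]

variable {T : Finset (Q × V × V × V × V)}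

lemma Tiled.card_toRight (hT : ∀ e ∈ T, #(tupleEdge e) = 5) {A : Finset (Q ⊕ V)}
    (hA : Tiled (fun i : T => tupleEdge i.1) A) : #A.toRight = 4 * #A.toLeft := by
  induction hA with
  | empty => rfl
  | cons A i _ hd ih =>
    have h1 : Disjoint A.toLeft (tupleEdge i.1).toLeft := by
      rw [disjoint_left] at hd ⊢; intro x hx hy
      exact hd (mem_toLeft.1 hx) (mem_toLeft.1 hy)
    have h2 : Disjoint A.toRight (tupleEdge i.1).toRight := by
      rw [disjoint_left] at hd ⊢; intro x hx hy
      exact hd (mem_toRight.1 hx) (mem_toRight.1 hy)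
    rw [toLeft_union, toRight_union, card_union_of_disjoint h1, card_union_of_disjoint h2, ih,
      card_toRight_tupleEdge (hT _ i.2), toLeft_tupleEdge, card_singleton]
    ring

lemma exists_tuple_subset {L : Finset (Q ⊕ V)} (h1 : 0 < #L.toLeft) (h2 : 4 ≤ #L.toRight) :
    ∃ t : Q × V × V × V × V, #(tupleEdge t) = 5 ∧ tupleEdge t ⊆ L := by
  obtain ⟨j, hj⟩ := card_pos.1 h1
  obtain ⟨B, hB, hB4⟩ := exists_subset_card_eq h2
  obtain ⟨a, b, c, d, -, -, -, -, -, -, rfl⟩ := card_eq_four.1 hB4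
  refine ⟨(j, a, b, c, d), card_tupleEdge_of_card_eq_four hB4, ?_⟩
  rintro (i | v) h
  · rw [← mem_toLeft, toLeft_tupleEdge, mem_singleton] at h
    subst h
    exact mem_toLeft.1 hj
  · rw [← mem_toRight, toRight_tupleEdge] at h
    exact mem_toRight.1 (hB h)

open scoped Classical in
lemma tiled_union_biUnion {ι Ab : Type*} {s : ι → Finset (Q ⊕ V)} (supp : Ab → Finset (Q ⊕ V))
    (serves : Ab → Q × V × V × V × V → Prop) (r : ℕ) :
    ∀ (S : Finset Ab) (L : Finset (Q ⊕ V)), (∀ a ∈ S, Tiled s (supp a)) →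
    (∀ a ∈ S, ∀ t, serves a t → #(tupleEdge t) = 5 → Disjoint (tupleEdge t) (supp a) →
      Tiled s (tupleEdge t ∪ supp a)) →
    (∀ a ∈ S, ∀ b ∈ S, a ≠ b → Disjoint (supp a) (supp b)) →
    #L.toLeft = r → #L.toRight = 4 * r → (∀ a ∈ S, Disjoint L (supp a)) →
    (∀ t, r ≤ #{a ∈ S | serves a t}) → Tiled s (L ∪ S.biUnion supp) := by
  induction r with
  | zero =>
    intro S L hS hS' hd h1 h2 _ _
    have : #L = 0 := by rw [← card_toLeft_add_card_toRight, h1, h2]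
    rw [card_eq_zero.1 this, empty_union]
    exact Tiled.biUnion S _ hS hd
  | succ r ih =>
    intro S L hS hS' hd h1 h2 hL hserv
    obtain ⟨t, ht5, htL⟩ := exists_tuple_subset (L := L) (by omega) (by omega)
    obtain ⟨a, ha⟩ := card_pos.1 (lt_of_lt_of_le (Nat.succ_pos r) (hserv t))
    rw [mem_filter] at ha
    obtain ⟨haS, hat⟩ := ha
    have e1 : #(L \ tupleEdge t).toLeft = r := by
      rw [toLeft_sdiff, card_sdiff_of_subset (toLeft_subset_toLeft htL), h1, toLeft_tupleEdge,
        card_singleton]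
      omega
    have e2 : #(L \ tupleEdge t).toRight = 4 * r := by
      rw [toRight_sdiff, card_sdiff_of_subset (toRight_subset_toRight htL), h2,
        card_toRight_tupleEdge ht5]
      omega
    have hrec := ih (S.erase a) (L \ tupleEdge t) (fun b hb => hS b (mem_of_mem_erase hb))
      (fun b hb => hS' b (mem_of_mem_erase hb))
      (fun b hb c hc => hd b (mem_of_mem_erase hb) c (mem_of_mem_erase hc)) e1 e2
      (fun b hb => (hL b (mem_of_mem_erase hb)).mono_left sdiff_subset) ?_
    · have hLa := hL a haS
      have h3 := hS' a haS t hat ht5 (hLa.mono_left htL)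
      have e : L ∪ S.biUnion supp = ((L \ tupleEdge t) ∪ (S.erase a).biUnion supp) ∪
          (tupleEdge t ∪ supp a) := by
        conv_lhs => rw [← sdiff_union_of_subset htL, ← insert_erase haS, biUnion_insert]
        ext; simp only [mem_union]; tauto
      rw [e]
      refine hrec.union h3 ?_
      simp only [disjoint_union_left, disjoint_union_right, disjoint_biUnion_left]
      refine ⟨⟨sdiff_disjoint, fun b hb => ?_⟩, hLa.mono_left sdiff_subset, fun b hb => ?_⟩
      · exact ((hL b (mem_of_mem_erase hb)).mono_left htL).symm
      · exact hd b (mem_of_mem_erase hb) a haS (ne_of_mem_erase hb)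
    · intro t'
      have h3 := hserv t'
      have h4 : #{b ∈ S | serves b t'} ≤ #{b ∈ S.erase a | serves b t'} + 1 := by
        rw [filter_erase]
        have := pred_card_le_card_erase (s := {b ∈ S | serves b t'}) (a := a)
        omega
      omega

lemma gadgetPoints_nonempty (a : Gadget Q V) : (gadgetPoints a).Nonempty :=
  ⟨Sum.inr a.1.1, by simp [gadgetPoints, quadPoints]⟩

lemma card_gadgetPoints_le (a : Gadget Q V) : #(gadgetPoints a) ≤ 20 := by
  have h0 := card_quadPoints_le (Q := Q) a.1
  have h1 := card_linkPoints_le a.2.1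
  have h2 := card_linkPoints_le a.2.2.1
  have h3 := card_linkPoints_le a.2.2.2.1
  have h4 := card_linkPoints_le a.2.2.2.2
  have i1 := card_union_le (quadPoints a.1) (gadgetLinks a)
  have i2 := card_union_le (linkPoints a.2.1) (linkPoints a.2.2.1)
  have i3 := card_union_le (linkPoints a.2.1 ∪ linkPoints a.2.2.1) (linkPoints a.2.2.2.1)
  have i4 := card_union_le (linkPoints a.2.1 ∪ linkPoints a.2.2.1 ∪ linkPoints a.2.2.2.1)
    (linkPoints a.2.2.2.2)
  rw [← gadgetLinks] at i4
  rw [← gadgetPoints] at i1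
  omega

/-- Large systems of tuples contain a small tiled set that absorbs every small balanced set. -/
theorem exists_absorbing_set {ζ : ℝ} (hζ : 0 < ζ) (hζ' : ζ ≤ 1 / 256) :
    ∃ ξ : ℝ, 0 < ξ ∧ ∃ N₀ : ℕ, ∀ (Q V : Type) [Fintype Q] [Fintype V] [DecidableEq Q]
      [DecidableEq V] (T : Finset (Q × V × V × V × V)), Fintype.card V = 4 * Fintype.card Q →
      N₀ ≤ Fintype.card V → (∀ e ∈ T, #(tupleEdge e) = 5) →
      (∀ j v, 9 / 16 * (Fintype.card V : ℝ) ^ 3 ≤ #{p : V × V × V | (j, v, p) ∈ T}) →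
      ∃ Z : Finset (Q ⊕ V), (#Z : ℝ) ≤ ζ * Fintype.card V ∧
        Tiled (fun i : T => tupleEdge i.1) Z ∧
        ∀ L : Finset (Q ⊕ V), Disjoint L Z → #L.toRight = 4 * #L.toLeft →
          (#L : ℝ) ≤ ξ * Fintype.card V → Tiled (fun i : T => tupleEdge i.1) (L ∪ Z) := by
  have hlim := (isLittleO_pow_exp_pos_mul_atTop 5
    (by positivity : 0 < 1 / 131072 * ζ / 80)).def (by norm_num : (0 : ℝ) < 1 / 2)
  obtain ⟨x₀, hx₀⟩ := Filter.eventually_atTop.1 hlim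
  refine ⟨1 / 131072 * ζ / 80, by positivity, max ⌈x₀⌉₊ 4096, ?_⟩
  intro Q V _ _ _ _ T hV hN hT hdeg
  classical
  have hn4096 : (4096 : ℝ) ≤ Fintype.card V := by exact_mod_cast (le_max_right _ _).trans hN
  have hnx : x₀ ≤ Fintype.card V :=
    (Nat.le_ceil x₀).trans (by exact_mod_cast (le_max_left _ _).trans hN)
  have hexp := hx₀ _ hnx
  have hVne : Nonempty V := Fintype.card_pos_iff.1 (by
    have : 4096 ≤ Fintype.card V := by exact_mod_cast hn4096
    omega)
  have hQne : Nonempty Q := Fintype.card_pos_iff.1 (by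
    have : 4096 ≤ Fintype.card V := by exact_mod_cast hn4096
    omega)
  have hTg : (Fintype.card (Q × V × V × V × V) : ℝ) ≤ (Fintype.card V : ℝ) ^ 5 := by
    have : Fintype.card (Q × V × V × V × V) ≤ Fintype.card V ^ 5 := by
      simp only [Fintype.card_prod]
      calc _ ≤ Fintype.card V * (Fintype.card V * (Fintype.card V *
            (Fintype.card V * Fintype.card V))) := Nat.mul_le_mul_right _ (by omega)
        _ = _ := by ring
    exact_mod_cast this
  set n : ℝ := (Fintype.card V : ℝ) with hn
  set p : ℝ := 1 / 131072 with hp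
  have hNle : ((⌊ζ * n / 20⌋₊ : ℕ) : ℝ) ≤ ζ * n / 20 := Nat.floor_le (by positivity)
  have hNge : ζ * n / 20 < ⌊ζ * n / 20⌋₊ + 1 := Nat.lt_floor_add_one _
  set N := ⌊ζ * n / 20⌋₊ with hNdef
  obtain ⟨S, hSN, hSv, hSd, hSs⟩ := exists_disjoint_serving_family (K := 20) (N := N)
    (gadgetPoints : Gadget Q V → _) (GadgetValid T) (Serves T) (by norm_num : (0 : ℝ) < p)
    gadgetPoints_nonempty card_gadgetPoints_le inferInstance (fun Z t hZ => by
      have hZ' : (#Z : ℝ) ≤ 20 * N := by exact_mod_cast hZ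
      have : ζ * n ≤ 1 / 256 * n := by gcongr
      exact card_serving_gadgets_ge hV hT hdeg (by rw [← hn]; linarith) t)
  refine ⟨S.biUnion gadgetPoints, ?_, Tiled.biUnion S _ (fun a ha => (hSv a ha).tiled) hSd, ?_⟩
  · have h1 : #(S.biUnion gadgetPoints) ≤ #S * 20 :=
      card_biUnion_le_card_mul _ _ _ fun a _ => card_gadgetPoints_le a
    have h2 : #(S.biUnion gadgetPoints) ≤ N * 20 := h1.trans (Nat.mul_le_mul_right _ hSN)
    have h3 : (#(S.biUnion gadgetPoints) : ℝ) ≤ N * 20 := by exact_mod_cast h2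
    linarith
  · intro L hL hbal hLs
    refine tiled_union_biUnion gadgetPoints (Serves T) _ S L (fun a ha => (hSv a ha).tiled)
      (fun a ha t => (hSv a ha).tiled_union) hSd rfl hbal (fun a ha => ?_) fun t => ?_
    · exact hL.mono_right (subset_biUnion_of_mem gadgetPoints ha)
    · have h1 : (#L.toLeft : ℝ) ≤ p * ζ / 80 * n :=
        le_trans (by exact_mod_cast card_toLeft_le) hLs
      by_contra! hlt
      have hlt' : (#{a ∈ S | Serves T a t} : ℝ) ≤ p * ζ / 80 * n :=
        le_trans (by exact_mod_cast hlt.le) h1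
      have h2 := hSs t
      have h3 : (1 - p / 2) ^ N ≤ Real.exp (-(p / 2)) ^ N := by
        have := Real.add_one_le_exp (-(p / 2))
        exact pow_le_pow_left₀ (by norm_num [hp]) (by linarith) N
      rw [← Real.exp_nat_mul] at h3
      have h4 : Real.exp (-(p * ζ / 80 * n)) ≤ (1 / 2 : ℝ) ^ #{a ∈ S | Serves T a t} := by
        have h5 : Real.exp (-1) ≤ 1 / 2 := by
          rw [Real.exp_neg, one_div]
          exact inv_anti₀ (by norm_num) (by linarith [Real.add_one_le_exp (1 : ℝ)])
        calc Real.exp (-(p * ζ / 80 * n))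
            ≤ Real.exp (#{a ∈ S | Serves T a t} * (-1)) := Real.exp_le_exp.2 (by linarith)
          _ = Real.exp (-1) ^ #{a ∈ S | Serves T a t} := Real.exp_nat_mul _ _
          _ ≤ _ := pow_le_pow_left₀ (Real.exp_pos _).le h5 _
      have h6 : Real.exp (N * -(p / 2)) < Real.exp (-(p * ζ / 40 * n)) * 2 := by
        have h8 : Real.exp (p / 2) < 2 := by
          have h9 : Real.exp (p / 2) ≤ Real.exp (1 / 2) := Real.exp_le_exp.2 (by norm_num [hp])
          have h10 : Real.exp (1 / 2) ^ 2 < 2 ^ 2 := by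
            rw [← Real.exp_nat_mul]
            norm_num
            linarith [Real.exp_one_lt_d9]
          exact h9.trans_lt (lt_of_pow_lt_pow_left₀ 2 (by norm_num) h10)
        calc Real.exp (N * -(p / 2)) ≤ Real.exp (-(p * ζ / 40 * n) + p / 2) := by
              refine Real.exp_le_exp.2 ?_
              have : 0 < p := by norm_num [hp]
              nlinarith
          _ = Real.exp (-(p * ζ / 40 * n)) * Real.exp (p / 2) := Real.exp_add _ _
          _ < _ := by gcongr
      rw [Real.norm_of_nonneg (by positivity), Real.norm_of_nonneg (Real.exp_pos _).le] at hexp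
      have h11 : Real.exp (-(p * ζ / 40 * n)) * Real.exp (p * ζ / 80 * n) =
          Real.exp (-(p * ζ / 80 * n)) := by
        rw [← Real.exp_add]; congr 1; ring
      have : Real.exp (-(p * ζ / 80 * n)) < Real.exp (-(p * ζ / 80 * n)) := by
        calc Real.exp (-(p * ζ / 80 * n)) ≤ _ := h4.trans h2
          _ ≤ n ^ 5 * Real.exp (N * -(p / 2)) := by
              refine mul_le_mul hTg h3 (pow_nonneg (by norm_num [hp]) _) (by positivity)
          _ < n ^ 5 * (Real.exp (-(p * ζ / 40 * n)) * 2) := by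
              have : 0 < n ^ 5 := by positivity
              gcongr
          _ ≤ (1 / 2 * Real.exp (p * ζ / 80 * n)) * (Real.exp (-(p * ζ / 40 * n)) * 2) := by
              gcongr
          _ = Real.exp (-(p * ζ / 80 * n)) := by rw [← h11]; ring
      exact lt_irrefl _ this

end Absorbing

section NearlyComplete

open Finset

lemma card_apply_zero_eq {q : ℕ} (x : Fin q) : #{g : Fin 5 → Fin q | g 0 = x} = q ^ 4 := by
  have : ({g : Fin 5 → Fin q | g 0 = x} : Finset _) =
      Fintype.piFinset fun i => if i = 0 then {x} else univ := by
    ext g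
    simp only [mem_filter, mem_univ, true_and, Fintype.mem_piFinset]
    refine ⟨fun h i => ?_, fun h => by simpa using h 0⟩
    split_ifs with h1
    · simp [h1, h]
    · simp
  rw [this, Fintype.card_piFinset, Fin.prod_univ_five]
  simp [Fin.ext_iff]
  ring

lemma card_apply_eq_apply_le {q : ℕ} (x : Fin q) {a b : Fin 5} (hab : a < b) :
    #{g : Fin 5 → Fin q | g 0 = x ∧ g a = g b} ≤ q ^ 3 := by
  have hb : (0 : Fin 5) ≠ b := (lt_of_le_of_lt (Fin.zero_le a) hab).ne
  have h := card_two_points_le 0 b hb x x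
  rw [Fintype.card_fin] at h
  refine le_trans (card_le_card_of_injOn (fun g => Function.update g b x) ?_ ?_) h
  · intro g hg
    simp only [coe_filter, mem_univ, true_and, Set.mem_ofPred_eq] at hg ⊢
    simp [Function.update_of_ne hb, hg.1]
  · intro g hg g' hg' h
    simp only [coe_filter, mem_univ, true_and, Set.mem_ofPred_eq] at hg hg'
    have h1 : ∀ i, i ≠ b → g i = g' i := by
      intro i hi
      simpa [Function.update_of_ne hi] using congrFun h i
    funext i
    by_cases hi : i = b
    · rw [hi, ← hg.2, ← hg'.2]; exact h1 a hab.ne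
    · exact h1 i hi

/-- A `5`-partite system with few missing tuples at every point has a perfect matching. -/
theorem exists_perm_of_few_missing {q : ℕ} (hq : 50 < q) (G : (Fin 5 → Fin q) → Prop)
    [DecidablePred G]
    (h : ∀ p x, (#{f : Fin 5 → Fin q | f p = x ∧ ¬ G f} : ℝ) ≤ (q : ℝ) ^ 4 / 10) :
    ∃ π : Fin 5 → Equiv.Perm (Fin q), ∀ i, G fun p => π p i := by
  obtain ⟨π, hπ⟩ := Finite.exists_max
    fun π : Fin 5 → Equiv.Perm (Fin q) => #{i | G fun p => π p i}
  refine ⟨π, fun i₀ => ?_⟩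
  by_contra hi₀
  obtain ⟨g, hg0, hginj, hgG⟩ : ∃ g : Fin 5 → Fin q, g 0 = i₀ ∧ Function.Injective g ∧
      ∀ k, G fun p => π p (g (k + p)) := by
    by_contra! hno
    have hsub : ({g : Fin 5 → Fin q | g 0 = i₀} : Finset _) ⊆
        (({ab : Fin 5 × Fin 5 | ab.1 < ab.2} : Finset _).biUnion
          fun ab => {g : Fin 5 → Fin q | g 0 = i₀ ∧ g ab.1 = g ab.2}) ∪
        (univ : Finset (Fin 5)).biUnion
          fun k => {g : Fin 5 → Fin q | g 0 = i₀ ∧ ¬ G fun p => π p (g (k + p))} := by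
      intro g hg
      rw [mem_filter_univ] at hg
      rw [mem_union, mem_biUnion, mem_biUnion]
      by_cases hinj : Function.Injective g
      · obtain ⟨k, hk⟩ := hno g hg hinj
        exact Or.inr ⟨k, mem_univ k, by simp [hg, hk]⟩
      · left
        simp only [Function.Injective, not_forall] at hinj
        obtain ⟨a, b, hab, hne⟩ := hinj
        rcases lt_or_gt_of_ne hne with h' | h'
        · exact ⟨(a, b), by simpa using h', by simp [hg, hab]⟩
        · exact ⟨(b, a), by simpa using h', by simp [hg, hab]⟩
    have hk : ∀ k : Fin 5, (#{g : Fin 5 → Fin q | g 0 = i₀ ∧ ¬ G fun p => π p (g (k + p))} : ℝ) ≤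
        (q : ℝ) ^ 4 / 10 := by
      intro k
      refine le_trans ?_ (h (-k) (π (-k) i₀))
      refine Nat.cast_le.2 (card_le_card_of_injOn (fun g p => π p (g (k + p))) ?_ ?_)
      · intro g hg
        simp only [coe_filter, mem_univ, true_and, Set.mem_ofPred_eq] at hg ⊢
        exact ⟨by rw [add_neg_cancel, hg.1], hg.2⟩
      · intro g _ g' _ hgg
        funext i
        have := congrFun hgg (i - k)
        simpa using this
    have h1 : (#(({ab : Fin 5 × Fin 5 | ab.1 < ab.2} : Finset _).biUnion
        fun ab => {g : Fin 5 → Fin q | g 0 = i₀ ∧ g ab.1 = g ab.2}) : ℝ) ≤ 10 * q ^ 3 := by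
      have : #(({ab : Fin 5 × Fin 5 | ab.1 < ab.2} : Finset _).biUnion
          fun ab => {g : Fin 5 → Fin q | g 0 = i₀ ∧ g ab.1 = g ab.2}) ≤ 10 * q ^ 3 :=
        (card_biUnion_le_card_mul _ _ (q ^ 3) fun ab hab =>
          card_apply_eq_apply_le i₀ (mem_filter.1 hab).2).trans
          (Nat.mul_le_mul_right _ (le_of_eq (by decide)))
      exact_mod_cast this
    have h2 : (#((univ : Finset (Fin 5)).biUnion
        fun k => {g : Fin 5 → Fin q | g 0 = i₀ ∧ ¬ G fun p => π p (g (k + p))}) : ℝ) ≤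
        5 * ((q : ℝ) ^ 4 / 10) := by
      refine (Nat.cast_le.2 card_biUnion_le).trans ?_
      rw [Nat.cast_sum]
      refine (sum_le_sum fun k _ => hk k).trans ?_
      simp
    have h3 := (card_le_card hsub).trans (card_union_le _ _)
    rw [card_apply_zero_eq] at h3
    have h4 : ((q : ℝ)) ^ 4 ≤ 10 * q ^ 3 + 5 * ((q : ℝ) ^ 4 / 10) :=
      le_trans (by exact_mod_cast h3) (add_le_add h1 h2)
    have h5 : (50 : ℝ) < q := by exact_mod_cast hq
    have h6 : 0 < (q : ℝ) ^ 3 := by positivity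
    nlinarith
  set ι : Fin 5 ↪ Fin q := ⟨g, hginj⟩
  set π' : Fin 5 → Equiv.Perm (Fin q) := fun p =>
    ((Equiv.addRight p : Equiv.Perm (Fin 5)).viaEmbedding ι).trans (π p) with hπ'
  have hin : ∀ k, G fun p => π' p (g k) := by
    intro k
    convert hgG k using 2 with p
    have := Equiv.Perm.viaEmbedding_apply (Equiv.addRight p : Equiv.Perm (Fin 5)) ι k
    simp only [hπ', Equiv.trans_apply]
    rw [show g k = ι k from rfl, this]
    rfl
  have hout : ∀ i, i ∉ Set.range g → ∀ p, π' p i = π p i := by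
    intro i hi p
    simp only [hπ', Equiv.trans_apply]
    rw [Equiv.Perm.viaEmbedding_apply_of_notMem _ ι i hi]
  have hlt : #{i | G fun p => π p i} < #{i | G fun p => π' p i} := by
    refine card_lt_card (Finset.ssubset_iff_of_subset ?_ |>.2 ⟨i₀, ?_, ?_⟩)
    · intro i hi
      rw [mem_filter_univ] at hi ⊢
      by_cases hr : i ∈ Set.range g
      · obtain ⟨k, rfl⟩ := hr
        exact hin k
      · simpa only [hout i hr] using hi
    · rw [mem_filter_univ, ← hg0]; exact hin 0
    · rw [mem_filter_univ]; exact hi₀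
  exact absurd (hπ π') (not_le.2 hlt)

end NearlyComplete

section NearExtremal

open Finset

variable {Q V : Type*} [Fintype Q] [Fintype V] [DecidableEq Q] [DecidableEq V]

/-- The tuple system `T` is close to the system of all tuples meeting `W`. -/
structure NearExtremal (T : Finset (Q × V × V × V × V)) (W : Finset V) : Prop where
  card_eq : Fintype.card V = 4 * Fintype.card Q
  card_tupleEdge : ∀ e ∈ T, #(tupleEdge e) = 5
  swap_fst : ∀ {j a b c d}, (j, a, b, c, d) ∈ T → (j, b, a, c, d) ∈ T
  swap_snd : ∀ {j a b c d}, (j, a, b, c, d) ∈ T → (j, a, c, b, d) ∈ T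
  swap_thd : ∀ {j a b c d}, (j, a, b, c, d) ∈ T → (j, a, b, d, c) ∈ T
  degree_ge : ∀ j v, 36 * (Fintype.card Q : ℝ) ^ 3 ≤ #{p : V × V × V | (j, v, p) ∈ T}
  card_le : (#W : ℝ) ≤ Fintype.card Q + Fintype.card Q / 10 ^ 7
  le_card : (Fintype.card Q : ℝ) - Fintype.card Q / 10 ^ 7 ≤ #W
  missing_le : ∀ u, u ∉ W → (#{x : Q × V × V × V | x.2 ∉ Wᶜ ×ˢ Wᶜ ×ˢ Wᶜ ∧ (x.1, u, x.2) ∉ T} : ℝ) ≤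
    (Fintype.card Q : ℝ) ^ 4 / 500
  inside_le : ∀ u, u ∉ W → (#{x : Q × V × V × V | x.2 ∈ Wᶜ ×ˢ Wᶜ ×ˢ Wᶜ ∧ (x.1, u, x.2) ∈ T} : ℝ) ≤
    (Fintype.card Q : ℝ) ^ 4 / 500
  le_inside : ∀ w ∈ W, (Fintype.card Q : ℝ) ^ 4 / 2000 ≤
    (#{x : Q × V × V × V | x.2 ∈ Wᶜ ×ˢ Wᶜ ×ˢ Wᶜ ∧ (x.1, w, x.2) ∈ T} : ℝ)
  card_bad_vertices_le : (#{w ∈ W | (Fintype.card Q : ℝ) ^ 4 / 500 <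
    (#{x : Q × V × V × V | x.2 ∈ Wᶜ ×ˢ Wᶜ ×ˢ Wᶜ ∧ (x.1, w, x.2) ∉ T} : ℝ)} : ℝ) ≤
    Fintype.card Q / 10 ^ 7
  card_bad_colours_le : (#{j : Q | (Fintype.card Q : ℝ) ^ 4 / 500 <
    (#{p : V × V × V × V | p ∈ W ×ˢ Wᶜ ×ˢ Wᶜ ×ˢ Wᶜ ∧ (j, p) ∉ T} : ℝ)} : ℝ) ≤
    Fintype.card Q / 10 ^ 7
  link_ge : #W < Fintype.card Q → ∀ j u, u ∉ W →
    4 * ((Fintype.card Q : ℝ) - #W - 1) * (Fintype.card Q : ℝ) ^ 2 + 1 ≤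
      #{p : V × V × V | p ∈ Wᶜ ×ˢ Wᶜ ×ˢ Wᶜ ∧ (j, u, p) ∈ T}

variable {T : Finset (Q × V × V × V × V)} {W : Finset V}

lemma NearExtremal.tiled_compl (H : NearExtremal T W) {X : Finset (Q ⊕ V)}
    (hQ : ∀ j, Sum.inl j ∉ X → (#{p : V × V × V × V | p ∈ W ×ˢ Wᶜ ×ˢ Wᶜ ×ˢ Wᶜ ∧ (j, p) ∉ T} : ℝ) ≤
      (Fintype.card Q : ℝ) ^ 4 / 500)
    (hW : ∀ w ∈ W, Sum.inr w ∉ X →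
      (#{x : Q × V × V × V | x.2 ∈ Wᶜ ×ˢ Wᶜ ×ˢ Wᶜ ∧ (x.1, w, x.2) ∉ T} : ℝ) ≤
      (Fintype.card Q : ℝ) ^ 4 / 500)
    (hbal : #X.toRight = 4 * #X.toLeft) (hcard : #X.toLeft + #(W \ X.toRight) = Fintype.card Q)
    (hlarge : 9 / 10 * (Fintype.card Q : ℝ) ≤ #(W \ X.toRight)) (h50 : 50 < #(W \ X.toRight)) :
    Tiled (fun i : T => tupleEdge i.1) Xᶜ := by
  classical
  obtain ⟨q, hq⟩ : ∃ q, q = #(W \ X.toRight) := ⟨_, rfl⟩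
  rw [← hq] at hcard hlarge h50
  have hC : #(X.toLeft)ᶜ = q := by rw [card_compl]; omega
  have hU : #((W \ X.toRight) ∪ X.toRight)ᶜ = 3 * q := by
    rw [card_compl, card_union_of_disjoint sdiff_disjoint, ← hq, H.card_eq]; omega
  have eC : Fin q ≃ {x // x ∈ (X.toLeft)ᶜ} := Fintype.equivOfCardEq
    (by rw [Fintype.card_coe, hC, Fintype.card_fin])
  have eW : Fin q ≃ {x // x ∈ W \ X.toRight} := Fintype.equivOfCardEq
    (by rw [Fintype.card_coe, ← hq, Fintype.card_fin])
  have eU : Fin 3 × Fin q ≃ {x // x ∈ ((W \ X.toRight) ∪ X.toRight)ᶜ} :=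
    Fintype.equivOfCardEq (by rw [Fintype.card_coe, hU]; simp)
  have hCmem : ∀ a, Sum.inl (eC a).1 ∉ X := fun a => by
    have := (eC a).2
    rwa [mem_compl, mem_toLeft] at this
  have hWmem : ∀ a, (eW a).1 ∈ W ∧ Sum.inr (eW a).1 ∉ X := fun a => by
    have := (eW a).2
    rwa [mem_sdiff, mem_toRight] at this
  have hUmem : ∀ a, (eU a).1 ∉ W ∧ Sum.inr (eU a).1 ∉ X := fun a => by
    have := (eU a).2
    rw [mem_compl, mem_union, mem_sdiff, mem_toRight] at this
    tauto
  have hWU : ∀ a b, (eW a).1 ≠ (eU b).1 := fun a b h => (hUmem b).1 (h ▸ (hWmem a).1)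
  set tup : (Fin 5 → Fin q) → Q × V × V × V × V := fun f =>
    ((eC (f 0)).1, (eW (f 1)).1, (eU (0, f 2)).1, (eU (1, f 3)).1, (eU (2, f 4)).1) with htup
  have hfew : ∀ p x, (#{f : Fin 5 → Fin q | f p = x ∧ ¬ tup f ∈ T} : ℝ) ≤ (q : ℝ) ^ 4 / 10 := by
    intro p x
    have hm : (Fintype.card Q : ℝ) ^ 4 / 500 ≤ (q : ℝ) ^ 4 / 10 := by
      have h1 : (Fintype.card Q : ℝ) ≤ 10 / 9 * q := by linarith
      have h2 : (Fintype.card Q : ℝ) ^ 4 ≤ (10 / 9 * q) ^ 4 := by gcongr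
      have h3 : 0 ≤ (q : ℝ) ^ 4 := by positivity
      rw [mul_pow] at h2
      linarith
    refine le_trans ?_ hm
    fin_cases p
    · refine le_trans ?_ (hQ _ (hCmem x))
      refine Nat.cast_le.2 (card_le_card_of_injOn (fun f => (tup f).2) ?_ ?_)
      · intro f hf
        simp only [coe_filter, mem_univ, true_and, Set.mem_ofPred_eq, mem_product, mem_compl,
          htup] at hf ⊢
        obtain ⟨h1, h2⟩ := hf
        exact ⟨⟨(hWmem _).1, (hUmem _).1, (hUmem _).1, (hUmem _).1⟩, by rw [← h1]; exact h2⟩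
      · intro f hf g hg hfg
        simp only [coe_filter, mem_univ, true_and, Set.mem_ofPred_eq] at hf hg
        simp [htup] at hfg
        funext i
        fin_cases i
        · exact hf.1.trans hg.1.symm
        all_goals simp [hfg]
    · refine le_trans ?_ (hW _ (hWmem x).1 (hWmem x).2)
      refine Nat.cast_le.2 (card_le_card_of_injOn (fun f => ((tup f).1, (tup f).2.2)) ?_ ?_)
      · intro f hf
        simp only [coe_filter, mem_univ, true_and, Set.mem_ofPred_eq, mem_product, mem_compl,
          htup] at hf ⊢
        obtain ⟨h1, h2⟩ := hf
        exact ⟨⟨(hUmem _).1, (hUmem _).1, (hUmem _).1⟩, by rw [← h1]; exact h2⟩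
      · intro f hf g hg hfg
        simp only [coe_filter, mem_univ, true_and, Set.mem_ofPred_eq] at hf hg
        simp [htup] at hfg
        funext i
        fin_cases i
        rotate_left
        · exact hf.1.trans hg.1.symm
        all_goals simp [hfg]
    · refine le_trans ?_ (H.missing_le _ (hUmem (0, x)).1)
      refine Nat.cast_le.2 (card_le_card_of_injOn
        (fun f => ((tup f).1, (tup f).2.1, (tup f).2.2.2)) ?_ ?_)
      · intro f hf
        simp only [coe_filter, mem_univ, true_and, Set.mem_ofPred_eq, mem_product, mem_compl,
          htup] at hf ⊢
        obtain ⟨h1, h2⟩ := hf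
        refine ⟨fun h => h.1 (hWmem _).1, fun h => h2 ?_⟩
        rw [← h1] at h
        exact H.swap_fst h
      · intro f hf g hg hfg
        simp only [coe_filter, mem_univ, true_and, Set.mem_ofPred_eq] at hf hg
        simp [htup] at hfg
        funext i
        fin_cases i
        rotate_left 2
        · exact hf.1.trans hg.1.symm
        all_goals simp [hfg]
    · refine le_trans ?_ (H.missing_le _ (hUmem (1, x)).1)
      refine Nat.cast_le.2 (card_le_card_of_injOn
        (fun f => ((tup f).1, (tup f).2.1, (tup f).2.2.1, (tup f).2.2.2.2)) ?_ ?_)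
      · intro f hf
        simp only [coe_filter, mem_univ, true_and, Set.mem_ofPred_eq, mem_product, mem_compl,
          htup] at hf ⊢
        obtain ⟨h1, h2⟩ := hf
        refine ⟨fun h => h.1 (hWmem _).1, fun h => h2 ?_⟩
        rw [← h1] at h
        exact H.swap_snd (H.swap_fst h)
      · intro f hf g hg hfg
        simp only [coe_filter, mem_univ, true_and, Set.mem_ofPred_eq] at hf hg
        simp [htup] at hfg
        funext i
        fin_cases i
        rotate_left 3
        · exact hf.1.trans hg.1.symm
        all_goals simp [hfg]
    · refine le_trans ?_ (H.missing_le _ (hUmem (2, x)).1)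
      refine Nat.cast_le.2 (card_le_card_of_injOn
        (fun f => ((tup f).1, (tup f).2.1, (tup f).2.2.1, (tup f).2.2.2.1)) ?_ ?_)
      · intro f hf
        simp only [coe_filter, mem_univ, true_and, Set.mem_ofPred_eq, mem_product, mem_compl,
          htup] at hf ⊢
        obtain ⟨h1, h2⟩ := hf
        refine ⟨fun h => h.1 (hWmem _).1, fun h => h2 ?_⟩
        rw [← h1] at h
        exact H.swap_thd (H.swap_snd (H.swap_fst h))
      · intro f hf g hg hfg
        simp only [coe_filter, mem_univ, true_and, Set.mem_ofPred_eq] at hf hg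
        simp [htup] at hfg
        funext i
        fin_cases i
        rotate_left 4
        · exact hf.1.trans hg.1.symm
        all_goals simp [hfg]
  obtain ⟨π, hπ⟩ := exists_perm_of_few_missing h50 (fun f => tup f ∈ T) hfew
  have hunion : Xᶜ = univ.biUnion fun i => tupleEdge (tup fun p => π p i) := by
    ext y
    rw [mem_compl, mem_biUnion]
    constructor
    · intro hy
      rcases y with j | v
      · refine ⟨(π 0).symm (eC.symm ⟨j, by simpa using hy⟩), mem_univ _, ?_⟩
        rw [inl_mem_tupleEdge]
        simp [htup]
      · by_cases hv : v ∈ W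
        · refine ⟨(π 1).symm (eW.symm ⟨v, by simp [hv, hy]⟩), mem_univ _, ?_⟩
          rw [inr_mem_tupleEdge]
          simp [htup]
        · have hv' : v ∈ ((W \ X.toRight) ∪ X.toRight)ᶜ := by simp [hv, hy]
          obtain ⟨⟨r, a⟩, hra⟩ := eU.surjective ⟨v, hv'⟩
          have hra' : (eU (r, a)).1 = v := by rw [hra]
          refine ⟨(π (r.natAdd 2)).symm a, mem_univ _, ?_⟩
          rw [inr_mem_tupleEdge]
          fin_cases r
          · right; left; simpa [htup] using hra'
          · right; right; left; simpa [htup] using hra'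
          · right; right; right; simpa [htup] using hra'
    · rintro ⟨i, -, hi⟩ hy
      rcases y with j | v
      · rw [inl_mem_tupleEdge] at hi
        exact hCmem _ (hi ▸ hy)
      · rw [inr_mem_tupleEdge] at hi
        rcases hi with h | h | h | h
        · exact (hWmem _).2 (h ▸ hy)
        all_goals exact (hUmem _).2 (h ▸ hy)
  rw [hunion]
  refine Tiled.biUnion _ _ (fun i _ => tiled_of_mem (hπ i)) fun i _ k _ hik => ?_
  rw [disjoint_left]
  rintro (j | v) hi hk
  · rw [inl_mem_tupleEdge] at hi hk
    refine hik ((π 0).injective (eC.injective (Subtype.ext ?_)))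
    exact hi.trans hk.symm
  · rw [inr_mem_tupleEdge] at hi hk
    refine hik ?_
    simp only [htup] at hi hk
    rcases hi with rfl | rfl | rfl | rfl <;> rcases hk with hk | hk | hk | hk
    all_goals first
      | exact absurd hk (hWU _ _)
      | exact absurd hk.symm (hWU _ _)
      | (simp at hk; done)
      | (simp at hk; exact hk.symm)

end NearExtremal

section GreedyCover

open Finset

lemma exists_cover {P : Type*} [DecidableEq P] (Inv : Finset P → Prop) (k M : ℕ)
    (B : Finset P) : ∀ X₀ : Finset P, Inv X₀ → #X₀ + k * #B ≤ M →
    (∀ X, Inv X → #X ≤ M → ∀ p ∈ B, p ∉ X → ∃ Y : Finset P, p ∈ Y ∧ #Y ≤ k ∧ Inv (X ∪ Y)) →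
    ∃ X, Inv X ∧ X₀ ⊆ X ∧ B ⊆ X ∧ #X ≤ #X₀ + k * #B := by
  induction B using Finset.induction_on with
  | empty => exact fun X₀ h₀ _ _ => ⟨X₀, h₀, subset_rfl, empty_subset _, by simp⟩
  | insert p B hp ih =>
    intro X₀ h₀ hM h
    rw [card_insert_of_notMem hp] at hM ⊢
    have hM' : #X₀ + k + k * #B ≤ M := by rw [mul_add] at hM; omega
    obtain ⟨X₁, h₁, hX₁, hp₁, hc₁⟩ : ∃ X₁, Inv X₁ ∧ X₀ ⊆ X₁ ∧ p ∈ X₁ ∧ #X₁ ≤ #X₀ + k := by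
      by_cases hpX : p ∈ X₀
      · exact ⟨X₀, h₀, subset_rfl, hpX, by omega⟩
      · obtain ⟨Y, hpY, hY, hI⟩ := h X₀ h₀ (by omega) p (mem_insert_self p B) hpX
        exact ⟨X₀ ∪ Y, hI, subset_union_left, mem_union_right _ hpY,
          (card_union_le _ _).trans (by omega)⟩
    obtain ⟨X, hX, hsub, hB, hc⟩ := ih X₁ h₁ (by omega)
      fun Y hY hYM p' hp' => h Y hY hYM p' (mem_insert_of_mem hp')
    refine ⟨X, hX, hX₁.trans hsub, insert_subset (hsub hp₁) hB, ?_⟩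
    rw [mul_add]
    omega

lemma disjoint_toRight {Q V : Type*} {A B : Finset (Q ⊕ V)} (h : Disjoint A B) :
    Disjoint A.toRight B.toRight := by
  rw [disjoint_left] at h ⊢
  exact fun x hx hy => h (mem_toRight.1 hx) (mem_toRight.1 hy)

lemma disjoint_toLeft {Q V : Type*} {A B : Finset (Q ⊕ V)} (h : Disjoint A B) :
    Disjoint A.toLeft B.toLeft := by
  rw [disjoint_left] at h ⊢
  exact fun x hx hy => h (mem_toLeft.1 hx) (mem_toLeft.1 hy)

variable {Q V : Type*} [Fintype Q] [Fintype V] [DecidableEq Q] [DecidableEq V]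
  {T : Finset (Q × V × V × V × V)} {W : Finset V}

lemma exists_disjoint_linkPoints (hV : Fintype.card V = 4 * Fintype.card Q)
    (P : Q × V × V × V → Prop) [DecidablePred P] (X : Finset (Q ⊕ V))
    (h : 64 * (#X : ℝ) * (Fintype.card Q : ℝ) ^ 3 < #{x | P x}) :
    ∃ x, P x ∧ Disjoint (linkPoints x) X := by
  by_contra! hno
  have h1 : #{x | P x} ≤ #{x : Q × V × V × V | ¬ Disjoint (linkPoints x) X} := by
    refine card_le_card fun x hx => ?_
    simp only [mem_filter, mem_univ, true_and] at hx ⊢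
    exact hno x hx
  have h2 : (#{x | P x} : ℝ) ≤ #X * (4 * Fintype.card Q : ℝ) ^ 3 := by
    have := h1.trans (card_linkPoints_not_disjoint_le hV X)
    rw [hV] at this
    exact_mod_cast this
  linarith [show (#X : ℝ) * (4 * Fintype.card Q : ℝ) ^ 3 =
    64 * (#X : ℝ) * (Fintype.card Q : ℝ) ^ 3 by ring]

lemma disjoint_tupleEdge {x : Q × V × V × V} {v : V} {X : Finset (Q ⊕ V)}
    (hx : Disjoint (linkPoints x) X) (hv : Sum.inr v ∉ X) :
    Disjoint (tupleEdge (x.1, v, x.2)) X := by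
  rw [tupleEdge_eq_insert_linkPoints, disjoint_insert_left]
  exact ⟨hv, hx⟩

lemma NearExtremal.card_compl (H : NearExtremal T W) :
    (#Wᶜ : ℝ) = 4 * Fintype.card Q - #W := by
  have h1 : #W + #Wᶜ = 4 * Fintype.card Q := by rw [card_add_card_compl, H.card_eq]
  have h2 : (#W : ℝ) + #Wᶜ = 4 * Fintype.card Q := by exact_mod_cast h1
  linarith

lemma NearExtremal.exists_vertex (H : NearExtremal T W) (hm : 0 < Fintype.card Q)
    {X : Finset (Q ⊕ V)} (hX : (#X : ℝ) ≤ Fintype.card Q / 1000) :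
    ∃ u, u ∉ W ∧ Sum.inr u ∉ X := by
  by_contra! hno
  have h1 : Wᶜ ⊆ X.toRight := fun u hu => mem_toRight.2 (hno u (mem_compl.1 hu))
  have h2 : (#Wᶜ : ℝ) ≤ #X := by exact_mod_cast (card_le_card h1).trans card_toRight_le
  have hm' : (0 : ℝ) < Fintype.card Q := by exact_mod_cast hm
  have := H.card_le
  rw [H.card_compl] at h2
  linarith

lemma NearExtremal.exists_edge_of_colour (H : NearExtremal T W) (hm : 0 < Fintype.card Q)
    {X : Finset (Q ⊕ V)} (hX : (#X : ℝ) ≤ Fintype.card Q / 1000) {j : Q} (hj : Sum.inl j ∉ X) :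
    ∃ e ∈ T, Sum.inl j ∈ tupleEdge e ∧ Disjoint (tupleEdge e) X ∧
      #(W ∩ (tupleEdge e).toRight) ≤ 1 := by
  obtain ⟨u, huW, huX⟩ := H.exists_vertex hm hX
  have hm' : (0 : ℝ) < Fintype.card Q := by exact_mod_cast hm
  have hcW := H.card_le
  set Y := X.toRight
  have hY : (#Y : ℝ) ≤ Fintype.card Q / 1000 := le_trans (by exact_mod_cast card_toRight_le) hX
  set b₁ : Finset (V × V × V) := W ×ˢ W ×ˢ univ ∪ W ×ˢ univ ×ˢ W ∪ univ ×ˢ W ×ˢ W with hb₁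
  set b₂ : Finset (V × V × V) := Y ×ˢ univ ×ˢ univ ∪ univ ×ˢ Y ×ˢ univ ∪ univ ×ˢ univ ×ˢ Y with hb₂
  have h₁ : (#b₁ : ℝ) ≤ 12 * (#W : ℝ) ^ 2 * Fintype.card Q := by
    have : #b₁ ≤ 12 * #W ^ 2 * Fintype.card Q := by
      refine (card_union_le _ _).trans (Nat.add_le_add_right (card_union_le _ _) _) |>.trans ?_
      simp only [card_product, card_univ, H.card_eq]
      exact le_of_eq (by ring)
    exact_mod_cast this
  have h₂ : (#b₂ : ℝ) ≤ 48 * #Y * (Fintype.card Q : ℝ) ^ 2 := by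
    have : #b₂ ≤ 48 * #Y * Fintype.card Q ^ 2 := by
      refine (card_union_le _ _).trans (Nat.add_le_add_right (card_union_le _ _) _) |>.trans ?_
      simp only [card_product, card_univ, H.card_eq]
      exact le_of_eq (by ring)
    exact_mod_cast this
  obtain ⟨p, hp, hpb⟩ : ∃ p, (j, u, p) ∈ T ∧ p ∉ b₁ ∪ b₂ := by
    by_contra! hno
    have h3 : ({p : V × V × V | (j, u, p) ∈ T} : Finset _) ⊆ b₁ ∪ b₂ := fun p hp =>
      hno p (mem_filter.1 hp).2
    have h4 : (#{p : V × V × V | (j, u, p) ∈ T} : ℝ) ≤ #b₁ + #b₂ := by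
      exact_mod_cast (card_le_card h3).trans (card_union_le _ _)
    have h5 := H.degree_ge j u
    set m : ℝ := (Fintype.card Q : ℝ)
    have h6 : (#W : ℝ) ^ 2 ≤ (11 / 10 * m) ^ 2 := by
      gcongr
      linarith
    have h7 : 12 * (#W : ℝ) ^ 2 * m ≤ 12 * (11 / 10 * m) ^ 2 * m := by gcongr
    have h8 : 48 * (#Y : ℝ) * m ^ 2 ≤ 48 * (m / 1000) * m ^ 2 := by gcongr
    have h9 : 0 < m ^ 3 := by positivity
    have h10 : 12 * (11 / 10 * m) ^ 2 * m = 1452 / 100 * m ^ 3 := by ring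
    have h11 : 48 * (m / 1000) * m ^ 2 = 48 / 1000 * m ^ 3 := by ring
    linarith
  obtain ⟨b, c, d⟩ := p
  simp only [hb₁, hb₂, mem_union, mem_product, mem_univ, and_true, true_and, not_or] at hpb
  refine ⟨(j, u, b, c, d), hp, inl_mem_tupleEdge.2 rfl, ?_, ?_⟩
  · rw [disjoint_left]
    rintro (i | v) h
    · rw [inl_mem_tupleEdge] at h
      exact h ▸ hj
    · rw [inr_mem_tupleEdge] at h
      rcases h with rfl | rfl | rfl | rfl
      · exact huX
      · exact fun hv => hpb.2.1.1 (mem_toRight.2 hv)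
      · exact fun hv => hpb.2.1.2 (mem_toRight.2 hv)
      · exact fun hv => hpb.2.2 (mem_toRight.2 hv)
  · rw [card_le_one, toRight_tupleEdge]
    simp only [mem_inter, mem_insert, mem_singleton]
    rintro x ⟨hx, rfl | rfl | rfl | rfl⟩ y ⟨hy, rfl | rfl | rfl | rfl⟩ <;>
      first | rfl | (exfalso; tauto)

lemma NearExtremal.exists_edge_of_mem (H : NearExtremal T W) (hm : 0 < Fintype.card Q)
    {X : Finset (Q ⊕ V)} (hX : (#X : ℝ) ≤ Fintype.card Q / 200000) {w : V} (hw : w ∈ W)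
    (hwX : Sum.inr w ∉ X) : ∃ e ∈ T, Sum.inr w ∈ tupleEdge e ∧ Disjoint (tupleEdge e) X ∧
      #(W ∩ (tupleEdge e).toRight) ≤ 1 := by
  have hm' : (0 : ℝ) < Fintype.card Q := by exact_mod_cast hm
  obtain ⟨⟨j, b, c, d⟩, ⟨hxU, hxT⟩, hxX⟩ := exists_disjoint_linkPoints H.card_eq
    (fun x => x.2 ∈ Wᶜ ×ˢ Wᶜ ×ˢ Wᶜ ∧ (x.1, w, x.2) ∈ T) X (by
      refine lt_of_lt_of_le ?_ (H.le_inside w hw)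
      have h1 : 64 * (#X : ℝ) * (Fintype.card Q : ℝ) ^ 3 ≤
        64 * ((Fintype.card Q : ℝ) / 200000) * (Fintype.card Q : ℝ) ^ 3 := by gcongr
      have h2 : 0 < (Fintype.card Q : ℝ) ^ 4 := by positivity
      linarith [show 64 * ((Fintype.card Q : ℝ) / 200000) * (Fintype.card Q : ℝ) ^ 3 =
        64 / 200000 * (Fintype.card Q : ℝ) ^ 4 by ring])
  refine ⟨_, hxT, inr_mem_tupleEdge.2 (Or.inl rfl), disjoint_tupleEdge hxX hwX, ?_⟩
  simp only [mem_product, mem_compl] at hxU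
  rw [card_le_one, toRight_tupleEdge]
  simp only [mem_inter, mem_insert, mem_singleton]
  rintro x ⟨hx, rfl | rfl | rfl | rfl⟩ y ⟨hy, rfl | rfl | rfl | rfl⟩ <;>
    first | rfl | (exfalso; tauto)

lemma NearExtremal.exists_edge_two (H : NearExtremal T W) (hm : 0 < Fintype.card Q)
    {X : Finset (Q ⊕ V)} (hX : (#X : ℝ) ≤ Fintype.card Q / 1000) :
    ∃ e ∈ T, Disjoint (tupleEdge e) X ∧ #(W ∩ (tupleEdge e).toRight) = 2 := by
  obtain ⟨u, huW, huX⟩ := H.exists_vertex hm hX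
  have hm' : (0 : ℝ) < Fintype.card Q := by exact_mod_cast hm
  obtain ⟨⟨j, b, c, d⟩, ⟨hxU, hxT⟩, hxX⟩ := exists_disjoint_linkPoints H.card_eq
    (fun x => x.2 ∈ W ×ˢ W ×ˢ Wᶜ ∧ (x.1, u, x.2) ∈ T) X (by
      have h1 : ((univ : Finset Q) ×ˢ W ×ˢ W ×ˢ Wᶜ) ⊆
          univ.filter (fun x : Q × V × V × V => x.2 ∈ W ×ˢ W ×ˢ Wᶜ ∧ (x.1, u, x.2) ∈ T) ∪
          univ.filter (fun x : Q × V × V × V =>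
            x.2 ∉ Wᶜ ×ˢ Wᶜ ×ˢ Wᶜ ∧ (x.1, u, x.2) ∉ T) := by
        intro x hx
        simp only [mem_product, mem_univ, true_and, mem_compl, mem_union, mem_filter] at hx ⊢
        tauto
      have h2 := (card_le_card h1).trans (card_union_le _ _)
      simp only [card_product, card_univ] at h2
      have h3 : (Fintype.card Q : ℝ) * (#W * (#W * #Wᶜ)) ≤
          #{x : Q × V × V × V | x.2 ∈ W ×ˢ W ×ˢ Wᶜ ∧ (x.1, u, x.2) ∈ T} +
          #{x : Q × V × V × V | x.2 ∉ Wᶜ ×ˢ Wᶜ ×ˢ Wᶜ ∧ (x.1, u, x.2) ∉ T} := by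
        exact_mod_cast h2
      have h4 := H.missing_le u huW
      have h5 := H.card_compl
      have h6 := H.card_le
      have h7 := H.le_card
      set m : ℝ := (Fintype.card Q : ℝ)
      have h8 : m * (9 / 10 * m * (9 / 10 * m * (2 * m))) ≤ m * (#W * (#W * #Wᶜ)) := by
        gcongr <;> linarith
      have h9 : 64 * (#X : ℝ) * m ^ 3 ≤ 64 * (m / 1000) * m ^ 3 := by gcongr
      have h10 : 0 < m ^ 4 := by positivity
      have h11 : 64 * (m / 1000) * m ^ 3 = 64 / 1000 * m ^ 4 := by ring
      have h12 : m * (9 / 10 * m * (9 / 10 * m * (2 * m))) = 162 / 100 * m ^ 4 := by ring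
      linarith)
  refine ⟨_, hxT, disjoint_tupleEdge hxX huX, ?_⟩
  simp only [mem_product, mem_compl] at hxU
  have hbc : b ≠ c := by
    rintro rfl
    have h4 := card_toRight_tupleEdge (H.card_tupleEdge _ hxT)
    rw [toRight_tupleEdge] at h4
    simp only [mem_singleton, insert_eq_of_mem, mem_insert, true_or] at h4
    have := card_le_three (a := u) (b := b) (c := d)
    omega
  have : W ∩ (tupleEdge (j, u, b, c, d)).toRight = {b, c} := by
    rw [toRight_tupleEdge]
    ext x
    simp only [mem_inter, mem_insert, mem_singleton]
    constructor
    · rintro ⟨hx, rfl | rfl | rfl | rfl⟩ <;> tauto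
    · rintro (rfl | rfl) <;> tauto
  rw [this, card_pair hbc]

lemma card_toLeft_union_tupleEdge {X : Finset (Q ⊕ V)} {e : Q × V × V × V × V}
    (h : Disjoint (tupleEdge e) X) : #(X ∪ tupleEdge e).toLeft = #X.toLeft + 1 := by
  rw [toLeft_union, card_union_of_disjoint (disjoint_toLeft h.symm), toLeft_tupleEdge,
    card_singleton]

lemma card_inter_toRight_union {X Y : Finset (Q ⊕ V)} (h : Disjoint Y X) (W : Finset V) :
    #(W ∩ (X ∪ Y).toRight) = #(W ∩ X.toRight) + #(W ∩ Y.toRight) := by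
  rw [toRight_union, inter_union_distrib_left, card_union_of_disjoint]
  exact (disjoint_toRight h.symm).mono inter_subset_right inter_subset_right

lemma Tiled.union_tupleEdge {X : Finset (Q ⊕ V)} (hX : Tiled (fun i : T => tupleEdge i.1) X)
    {e : Q × V × V × V × V} (he : e ∈ T) (hd : Disjoint (tupleEdge e) X) :
    Tiled (fun i : T => tupleEdge i.1) (X ∪ tupleEdge e) :=
  hX.union (tiled_of_mem he) hd.symm

lemma NearExtremal.exists_balanced (H : NearExtremal T W) (hm : 0 < Fintype.card Q) (k : ℕ) :
    ∀ X : Finset (Q ⊕ V), Tiled (fun i : T => tupleEdge i.1) X →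
    Fintype.card Q + #(W ∩ X.toRight) + k = #W + #X.toLeft →
    (#X : ℝ) + 5 * k ≤ Fintype.card Q / 1000 →
    ∃ X', Tiled (fun i : T => tupleEdge i.1) X' ∧ X ⊆ X' ∧
      Fintype.card Q + #(W ∩ X'.toRight) = #W + #X'.toLeft ∧ #X' ≤ #X + 5 * k := by
  induction k with
  | zero => exact fun X hX h _ => ⟨X, hX, subset_rfl, h, le_rfl⟩
  | succ k ih =>
    intro X hX h hsize
    push_cast at hsize
    obtain ⟨e, he, hd, h2⟩ := H.exists_edge_two hm (X := X) (by linarith)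
    have hc : #(X ∪ tupleEdge e) ≤ #X + 5 := (card_union_le _ _).trans
      (by rw [H.card_tupleEdge e he])
    have hc' : (#(X ∪ tupleEdge e) : ℝ) ≤ #X + 5 := by exact_mod_cast hc
    obtain ⟨X', h3, h4, h5, h6⟩ := ih (X ∪ tupleEdge e) (hX.union_tupleEdge he hd)
      (by rw [card_toLeft_union_tupleEdge hd, card_inter_toRight_union hd, h2]; omega)
      (by linarith)
    exact ⟨X', h3, subset_union_left.trans h4, h5, by omega⟩

end GreedyCover

section InitialMatching

open Finset

lemma toLeft_empty {Q V : Type*} : (∅ : Finset (Q ⊕ V)).toLeft = ∅ := by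
  ext
  rw [mem_toLeft]
  simp

lemma toRight_empty {Q V : Type*} : (∅ : Finset (Q ⊕ V)).toRight = ∅ := by
  ext
  rw [mem_toRight]
  simp

lemma card_eq_five_mul_of_balanced {Q V : Type*} {X : Finset (Q ⊕ V)}
    (h : #X.toRight = 4 * #X.toLeft) :
    #X = 5 * #X.toLeft := by
  rw [← card_toLeft_add_card_toRight, h]
  ring

variable {Q V : Type*} [Fintype Q] [Fintype V] [DecidableEq Q] [DecidableEq V]
  {T : Finset (Q × V × V × V × V)} {W : Finset V}

lemma NearExtremal.exists_edge_compl (H : NearExtremal T W) (hm : 0 < Fintype.card Q)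
    {X : Finset (Q ⊕ V)} (hX : #X.toRight = 4 * #X.toLeft) (hXW : Disjoint W X.toRight)
    (hlt : #W + #X.toLeft < Fintype.card Q) :
    ∃ e ∈ T, Disjoint (tupleEdge e) X ∧ Disjoint W (tupleEdge e).toRight := by
  by_contra! hno
  have hm' : (0 : ℝ) < Fintype.card Q := by exact_mod_cast hm
  set I : V → Finset (Q × V × V × V) := fun v =>
    {x | x.2 ∈ Wᶜ ×ˢ Wᶜ ×ˢ Wᶜ ∧ (x.1, v, x.2) ∈ T} with hI
  set A : V → Finset (Q × V × V × V × V) := fun v =>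
    (I v).image (fun x => (x.1, v, x.2)) ∪ (I v).image (fun x => (x.1, x.2.1, v, x.2.2)) ∪
    (I v).image (fun x => (x.1, x.2.1, x.2.2.1, v, x.2.2.2)) ∪
    (I v).image (fun x => (x.1, x.2.1, x.2.2.1, x.2.2.2, v)) with hA
  have hAcard : ∀ v ∈ X.toRight, #(A v) ≤ 4 * (Fintype.card Q : ℝ) ^ 4 / 500 := by
    intro v hv
    have h1 : #(A v) ≤ 4 * #(I v) := by
      refine (card_union_le _ _).trans ?_
      have h2 := card_union_le ((I v).image (fun x => (x.1, v, x.2)) ∪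
        (I v).image (fun x => (x.1, x.2.1, v, x.2.2)))
        ((I v).image (fun x => (x.1, x.2.1, x.2.2.1, v, x.2.2.2)))
      have h3 := card_union_le ((I v).image (fun x => (x.1, v, x.2)))
        ((I v).image (fun x => (x.1, x.2.1, v, x.2.2)))
      have h4 := card_image_le (s := I v) (f := fun x => (x.1, v, x.2))
      have h5 := card_image_le (s := I v) (f := fun x => (x.1, x.2.1, v, x.2.2))
      have h6 := card_image_le (s := I v) (f := fun x => (x.1, x.2.1, x.2.2.1, v, x.2.2.2))
      have h7 := card_image_le (s := I v) (f := fun x => (x.1, x.2.1, x.2.2.1, x.2.2.2, v))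
      omega
    have h2 : (#(A v) : ℝ) ≤ 4 * #(I v) := by exact_mod_cast h1
    have h3 : (#(I v) : ℝ) ≤ _ := H.inside_le v (disjoint_right.1 hXW hv)
    linarith
  have hcover : ({e : Q × V × V × V × V | e.1 ∈ X.toLeftᶜ ∧ e.2.1 ∈ Wᶜ ∧
      e.2.2 ∈ Wᶜ ×ˢ Wᶜ ×ˢ Wᶜ ∧ e ∈ T} : Finset _) ⊆ X.toRight.biUnion A := by
    rintro ⟨j, a, b, c, d⟩ he
    simp only [mem_filter, mem_univ, true_and, mem_product, mem_compl, mem_toLeft] at he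
    obtain ⟨hj, ha, ⟨hb, hc, hd⟩, hT⟩ := he
    have hd' : ¬ Disjoint (tupleEdge (j, a, b, c, d)) X := by
      refine fun h => hno _ hT h ?_
      rw [disjoint_right, toRight_tupleEdge]
      simp only [mem_insert, mem_singleton]
      rintro x (rfl | rfl | rfl | rfl) <;> assumption
    rw [not_disjoint_iff] at hd'
    obtain ⟨i | v, hv, hvX⟩ := hd'
    · rw [inl_mem_tupleEdge] at hv
      subst hv
      exact absurd hvX hj
    · rw [mem_biUnion]
      refine ⟨v, mem_toRight.2 hvX, ?_⟩
      rw [inr_mem_tupleEdge] at hv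
      simp only [hA, hI, mem_union, mem_image, mem_filter, mem_univ, true_and, mem_product,
        mem_compl]
      rcases hv with rfl | rfl | rfl | rfl
      · exact Or.inl (Or.inl (Or.inl ⟨(j, b, c, d), ⟨⟨hb, hc, hd⟩, hT⟩, rfl⟩))
      · exact Or.inl (Or.inl (Or.inr ⟨(j, a, c, d), ⟨⟨ha, hc, hd⟩, H.swap_fst hT⟩, rfl⟩))
      · exact Or.inl (Or.inr ⟨(j, a, b, d), ⟨⟨ha, hb, hd⟩, H.swap_fst (H.swap_snd hT)⟩, rfl⟩)
      · exact Or.inr ⟨(j, a, b, c), ⟨⟨ha, hb, hc⟩,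
          H.swap_fst (H.swap_snd (H.swap_thd hT))⟩, rfl⟩
  have hupper : (#{e : Q × V × V × V × V | e.1 ∈ X.toLeftᶜ ∧ e.2.1 ∈ Wᶜ ∧
      e.2.2 ∈ Wᶜ ×ˢ Wᶜ ×ˢ Wᶜ ∧ e ∈ T} : ℝ) ≤
      4 * #X.toLeft * (4 * (Fintype.card Q : ℝ) ^ 4 / 500) := by
    calc (#{e : Q × V × V × V × V | e.1 ∈ X.toLeftᶜ ∧ e.2.1 ∈ Wᶜ ∧
          e.2.2 ∈ Wᶜ ×ˢ Wᶜ ×ˢ Wᶜ ∧ e ∈ T} : ℝ) ≤ ∑ v ∈ X.toRight, (#(A v) : ℝ) := by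
          exact_mod_cast (card_le_card hcover).trans card_biUnion_le
      _ ≤ ∑ v ∈ X.toRight, 4 * (Fintype.card Q : ℝ) ^ 4 / 500 := sum_le_sum hAcard
      _ = _ := by rw [sum_const, hX, nsmul_eq_mul]; push_cast; ring
  set s : ℝ := (Fintype.card Q : ℝ) - #W - 1 with hs
  have hlt' : (#X.toLeft : ℝ) ≤ s := by
    have : (#W : ℝ) + #X.toLeft + 1 ≤ Fintype.card Q := by exact_mod_cast hlt
    rw [hs]; linarith
  have hs0 : 0 ≤ s := le_trans (by positivity) hlt'
  have hsm : s ≤ (Fintype.card Q : ℝ) / 10 ^ 7 := by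
    have := H.le_card
    rw [hs]; linarith
  have hlower := mul_le_card_filter_prod (α := Q) (β := V × V × V × V)
    (P := fun j => j ∈ X.toLeftᶜ)
    (R := fun j q => q.1 ∈ Wᶜ ∧ q.2 ∈ Wᶜ ×ˢ Wᶜ ×ˢ Wᶜ ∧ (j, q) ∈ T)
    (A := 9 / 10 * Fintype.card Q)
    (B := 2 * Fintype.card Q * (4 * s * (Fintype.card Q : ℝ) ^ 2 + 1)) (by positivity)
    (by
      have h1 : #X.toLeft + #X.toLeftᶜ = Fintype.card Q := card_add_card_compl _
      have h2 : (#X.toLeft : ℝ) + #X.toLeftᶜ = Fintype.card Q := by exact_mod_cast h1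
      rw [filter_univ_mem]
      linarith)
    (fun j _ => mul_le_card_filter_prod (α := V) (β := V × V × V) (P := fun v => v ∈ Wᶜ)
      (R := fun v p => p ∈ Wᶜ ×ˢ Wᶜ ×ˢ Wᶜ ∧ (j, v, p) ∈ T) (by positivity)
      (by
        rw [filter_univ_mem, H.card_compl]
        have := H.card_le
        linarith)
      (fun v hv => by
        have := H.link_ge (by omega) j v (mem_compl.1 hv)
        exact this))
  have h := hlower.trans hupper
  set m : ℝ := (Fintype.card Q : ℝ)
  have h1 : 4 * (#X.toLeft : ℝ) * (4 * m ^ 4 / 500) ≤ 4 * s * (4 * m ^ 4 / 500) := by gcongr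
  have h2 : 0 ≤ s * m ^ 4 := by positivity
  have h3 : 0 < m ^ 2 := by positivity
  nlinarith [h, h1, h2, h3]

lemma NearExtremal.exists_initial (H : NearExtremal T W) (hm : 0 < Fintype.card Q) (t : ℕ)
    (ht : #W + t ≤ Fintype.card Q) : ∃ X : Finset (Q ⊕ V),
    Tiled (fun i : T => tupleEdge i.1) X ∧ #X.toLeft = t ∧ Disjoint W X.toRight := by
  induction t with
  | zero => exact ⟨∅, Tiled.empty, by rw [toLeft_empty, card_empty],
      by rw [toRight_empty]; exact disjoint_empty_right _⟩
  | succ t ih =>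
    obtain ⟨X, hX, hc, hW⟩ := ih (by omega)
    obtain ⟨e, he, hd, hWe⟩ := H.exists_edge_compl hm
      (Tiled.card_toRight H.card_tupleEdge hX) hW (by omega)
    refine ⟨_, hX.union_tupleEdge he hd, by rw [card_toLeft_union_tupleEdge hd, hc], ?_⟩
    rw [toRight_union, disjoint_union_right]
    exact ⟨hW, hWe⟩

lemma NearExtremal.exists_cover_bad (H : NearExtremal T W) (hm : 0 < Fintype.card Q) :
    ∃ X : Finset (Q ⊕ V), Tiled (fun i : T => tupleEdge i.1) X ∧
      Fintype.card Q + #(W ∩ X.toRight) ≤ #W + #X.toLeft ∧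
      (#X : ℝ) ≤ 15 * (Fintype.card Q : ℝ) / 10 ^ 7 ∧
      (∀ j, Sum.inl j ∉ X →
        (#{p : V × V × V × V | p ∈ W ×ˢ Wᶜ ×ˢ Wᶜ ×ˢ Wᶜ ∧ (j, p) ∉ T} : ℝ) ≤
        (Fintype.card Q : ℝ) ^ 4 / 500) ∧
      (∀ w ∈ W, Sum.inr w ∉ X →
        (#{x : Q × V × V × V | x.2 ∈ Wᶜ ×ˢ Wᶜ ×ˢ Wᶜ ∧ (x.1, w, x.2) ∉ T} : ℝ) ≤
        (Fintype.card Q : ℝ) ^ 4 / 500) := by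
  have hm' : (0 : ℝ) < Fintype.card Q := by exact_mod_cast hm
  obtain ⟨X₀, hX₀, hc₀, hb₀⟩ : ∃ X₀ : Finset (Q ⊕ V), Tiled (fun i : T => tupleEdge i.1) X₀ ∧
      (#X₀ : ℝ) ≤ 5 * (Fintype.card Q : ℝ) / 10 ^ 7 ∧
      Fintype.card Q + #(W ∩ X₀.toRight) ≤ #W + #X₀.toLeft := by
    rcases le_total (Fintype.card Q) #W with h | h
    · exact ⟨∅, Tiled.empty, by simp; positivity, by
        rw [toLeft_empty, toRight_empty, inter_empty, card_empty, card_empty]; omega⟩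
    · obtain ⟨X, hX, hc, hW⟩ := H.exists_initial hm (Fintype.card Q - #W) (by omega)
      refine ⟨X, hX, ?_, by rw [disjoint_iff_inter_eq_empty.1 hW, hc, card_empty]; omega⟩
      rw [card_eq_five_mul_of_balanced (Tiled.card_toRight H.card_tupleEdge hX), hc]
      push_cast [h]
      have := H.le_card
      linarith
  set bQ : Finset Q := {j : Q | (Fintype.card Q : ℝ) ^ 4 / 500 <
    (#{p : V × V × V × V | p ∈ W ×ˢ Wᶜ ×ˢ Wᶜ ×ˢ Wᶜ ∧ (j, p) ∉ T} : ℝ)} with hbQ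
  set bW : Finset V := {w ∈ W | (Fintype.card Q : ℝ) ^ 4 / 500 <
    (#{x : Q × V × V × V | x.2 ∈ Wᶜ ×ˢ Wᶜ ×ˢ Wᶜ ∧ (x.1, w, x.2) ∉ T} : ℝ)} with hbW
  have hcQ : (#bQ : ℝ) ≤ (Fintype.card Q : ℝ) / 10 ^ 7 := H.card_bad_colours_le
  have hcW : (#bW : ℝ) ≤ (Fintype.card Q : ℝ) / 10 ^ 7 := H.card_bad_vertices_le
  have hcB : (#(bQ.disjSum bW) : ℝ) ≤ 2 * ((Fintype.card Q : ℝ) / 10 ^ 7) := by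
    rw [card_disjSum]; push_cast; linarith
  have hsize : ((#X₀ + 5 * #(bQ.disjSum bW) : ℕ) : ℝ) ≤ 15 * (Fintype.card Q : ℝ) / 10 ^ 7 := by
    push_cast; linarith
  obtain ⟨X, ⟨hX, hb⟩, -, hB, hc⟩ := exists_cover
    (fun X : Finset (Q ⊕ V) => Tiled (fun i : T => tupleEdge i.1) X ∧
      Fintype.card Q + #(W ∩ X.toRight) ≤ #W + #X.toLeft) 5 (#X₀ + 5 * #(bQ.disjSum bW))
    (bQ.disjSum bW) X₀ ⟨hX₀, hb₀⟩ le_rfl (by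
      rintro X ⟨hX, hb⟩ hXc p hp hpX
      have hXc' : (#X : ℝ) ≤ 15 * (Fintype.card Q : ℝ) / 10 ^ 7 :=
        le_trans (by exact_mod_cast hXc) hsize
      obtain ⟨e, he, hpe, hd, h1⟩ : ∃ e ∈ T, p ∈ tupleEdge e ∧ Disjoint (tupleEdge e) X ∧
          #(W ∩ (tupleEdge e).toRight) ≤ 1 := by
        rcases p with j | w
        · exact H.exists_edge_of_colour hm (by linarith) hpX
        · rw [inr_mem_disjSum] at hp
          exact H.exists_edge_of_mem hm (by linarith) (mem_filter.1 hp).1 hpX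
      refine ⟨tupleEdge e, hpe, (H.card_tupleEdge e he).le, hX.union_tupleEdge he hd, ?_⟩
      rw [card_toLeft_union_tupleEdge hd, card_inter_toRight_union hd]
      omega)
  refine ⟨X, hX, hb, le_trans (by exact_mod_cast hc) hsize, fun j hj => ?_, fun w hw hwX => ?_⟩
  · by_contra! h
    exact hj (hB (inl_mem_disjSum.2 (mem_filter.2 ⟨mem_univ _, h⟩)))
  · by_contra! h
    exact hwX (hB (inr_mem_disjSum.2 (mem_filter.2 ⟨hw, h⟩)))

theorem NearExtremal.tiled_univ (H : NearExtremal T W) (hm : 100 ≤ Fintype.card Q) :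
    Tiled (fun i : T => tupleEdge i.1) univ := by
  have hm' : (100 : ℝ) ≤ Fintype.card Q := by exact_mod_cast hm
  obtain ⟨X₁, hX₁, hb₁, hc₁, hQ₁, hW₁⟩ := H.exists_cover_bad (by omega)
  obtain ⟨k, hk⟩ := Nat.exists_eq_add_of_le hb₁
  have hk' : (k : ℝ) ≤ 16 * (Fintype.card Q : ℝ) / 10 ^ 7 := by
    have h1 : (#W : ℝ) + #X₁.toLeft = Fintype.card Q + #(W ∩ X₁.toRight) + k := by
      exact_mod_cast hk
    have h2 : (#X₁.toLeft : ℝ) ≤ #X₁ := by exact_mod_cast card_toLeft_le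
    have h3 := H.card_le
    have h4 : (0 : ℝ) ≤ #(W ∩ X₁.toRight) := by positivity
    linarith
  obtain ⟨X, hX, hsub, hb, hc⟩ := H.exists_balanced (by omega) k X₁ hX₁ hk.symm (by linarith)
  have hc' : (#X : ℝ) ≤ #X₁ + 5 * k := by exact_mod_cast hc
  have hWX : #(W \ X.toRight) + #(W ∩ X.toRight) = #W := card_sdiff_add_card_inter _ _
  have hlarge : 9 / 10 * (Fintype.card Q : ℝ) ≤ #(W \ X.toRight) := by
    have h1 : (#(W \ X.toRight) : ℝ) + #(W ∩ X.toRight) = #W := by exact_mod_cast hWX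
    have h2 : (#(W ∩ X.toRight) : ℝ) ≤ #X := by
      exact_mod_cast (card_le_card inter_subset_right).trans card_toRight_le
    have h3 := H.le_card
    linarith
  have h := H.tiled_compl (X := X) (fun j hj => hQ₁ j fun h => hj (hsub h))
    (fun w hw hwX => hW₁ w hw fun h => hwX (hsub h))
    (Tiled.card_toRight H.card_tupleEdge hX) (by omega) hlarge (by
      have : (50 : ℝ) < #(W \ X.toRight) := by linarith
      exact_mod_cast this)
  simpa using hX.union h disjoint_compl_right

end InitialMatching

section SparseStructure

open Finset

lemma card_mul_le_of_sum_le {α : Type*} {s : Finset α} {f : α → ℝ} {c K : ℝ}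
    (hc : ∀ a ∈ s, c ≤ f a) (hK : ∑ a ∈ s, f a ≤ K) : #s * c ≤ K := by
  have := card_nsmul_le_sum s f c hc
  rw [nsmul_eq_mul] at this
  exact this.trans hK

variable {Q V : Type*} [Fintype Q] [Fintype V]

lemma sum_card_vertex (S : Finset V) (R : V → Q × V × V × V → Prop)
    [DecidableEq V] [∀ v, DecidablePred (R v)] :
    ∑ v ∈ S, (#{x | R v x} : ℝ) =
      #{e : Q × V × V × V × V | e.2.1 ∈ S ∧ R e.2.1 (e.1, e.2.2)} := by
  rw [← Nat.cast_sum]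
  congr 1
  simp only [card_filter, Fintype.sum_prod_type]
  rw [sum_comm (s := (univ : Finset Q))]
  conv_lhs => rw [← filter_univ_mem S, sum_filter]
  refine sum_congr rfl fun v _ => ?_
  by_cases h : v ∈ S <;> simp [h]

lemma sum_card_colour (R : Q → V × V × V × V → Prop) [∀ j, DecidablePred (R j)] :
    ∑ j, (#{p | R j p} : ℝ) = #{e : Q × V × V × V × V | R e.1 e.2} := by
  rw [← Nat.cast_sum]
  simp only [card_filter, Fintype.sum_prod_type]

variable [DecidableEq V]

lemma card_cube_change_aux (hV : Fintype.card V = 4 * Fintype.card Q) (D : Finset V) :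
    #{x : Q × V × V × V | x.2.1 ∈ D ∨ x.2.2.1 ∈ D ∨ x.2.2.2 ∈ D} ≤
      48 * #D * Fintype.card Q ^ 3 := by
  classical
  have h : ({x : Q × V × V × V | x.2.1 ∈ D ∨ x.2.2.1 ∈ D ∨ x.2.2.2 ∈ D} : Finset _) ⊆
      univ ×ˢ D ×ˢ univ ×ˢ univ ∪ univ ×ˢ univ ×ˢ D ×ˢ univ ∪ univ ×ˢ univ ×ˢ univ ×ˢ D := by
    intro x hx
    simp only [mem_filter, mem_univ, true_and, mem_union, mem_product, and_true] at hx ⊢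
    tauto
  refine (card_le_card h).trans ((card_union_le _ _).trans
    (Nat.add_le_add_right (card_union_le _ _) _)) |>.trans ?_
  simp only [card_product, card_univ, hV]
  exact le_of_eq (by ring)

lemma card_mem_cube_le (hV : Fintype.card V = 4 * Fintype.card Q) (U U' : Finset V)
    (P : Q × V × V × V → Prop) [DecidablePred P] :
    (#{x : Q × V × V × V | x.2 ∈ U ×ˢ U ×ˢ U ∧ P x} : ℝ) ≤
      #{x : Q × V × V × V | x.2 ∈ U' ×ˢ U' ×ˢ U' ∧ P x} +
        48 * #(U \ U') * (Fintype.card Q : ℝ) ^ 3 := by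
  classical
  have h : ({x : Q × V × V × V | x.2 ∈ U ×ˢ U ×ˢ U ∧ P x} : Finset _) ⊆
      univ.filter (fun x : Q × V × V × V => x.2 ∈ U' ×ˢ U' ×ˢ U' ∧ P x) ∪
      univ.filter (fun x : Q × V × V × V =>
        x.2.1 ∈ U \ U' ∨ x.2.2.1 ∈ U \ U' ∨ x.2.2.2 ∈ U \ U') := by
    intro x hx
    simp only [mem_filter, mem_univ, true_and, mem_union, mem_product, mem_sdiff] at hx ⊢
    tauto
  exact_mod_cast (card_le_card h).trans ((card_union_le _ _).trans
    (Nat.add_le_add_left (card_cube_change_aux hV (U \ U')) _))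

lemma card_notMem_cube_le (hV : Fintype.card V = 4 * Fintype.card Q) (U U' : Finset V)
    (P : Q × V × V × V → Prop) [DecidablePred P] :
    (#{x : Q × V × V × V | x.2 ∉ U ×ˢ U ×ˢ U ∧ P x} : ℝ) ≤
      #{x : Q × V × V × V | x.2 ∉ U' ×ˢ U' ×ˢ U' ∧ P x} +
        48 * #(U' \ U) * (Fintype.card Q : ℝ) ^ 3 := by
  classical
  have h : ({x : Q × V × V × V | x.2 ∉ U ×ˢ U ×ˢ U ∧ P x} : Finset _) ⊆
      univ.filter (fun x : Q × V × V × V => x.2 ∉ U' ×ˢ U' ×ˢ U' ∧ P x) ∪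
      univ.filter (fun x : Q × V × V × V =>
        x.2.1 ∈ U' \ U ∨ x.2.2.1 ∈ U' \ U ∨ x.2.2.2 ∈ U' \ U) := by
    intro x hx
    simp only [mem_filter, mem_univ, true_and, mem_union, mem_product, mem_sdiff] at hx ⊢
    tauto
  exact_mod_cast (card_le_card h).trans ((card_union_le _ _).trans
    (Nat.add_le_add_left (card_cube_change_aux hV (U' \ U)) _))

lemma card_cube {U : Finset V} (hU : #U = 3 * Fintype.card Q) :
    (#{x : Q × V × V × V | x.2 ∈ U ×ˢ U ×ˢ U} : ℝ) = 27 * (Fintype.card Q : ℝ) ^ 4 := by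
  have : ({x : Q × V × V × V | x.2 ∈ U ×ˢ U ×ˢ U} : Finset _) = univ ×ˢ U ×ˢ U ×ˢ U := by
    ext x
    simp
  rw [this]
  simp only [card_product, card_univ, hU]
  push_cast
  ring

variable [DecidableEq Q] {T : Finset (Q × V × V × V × V)} {U : Finset V}

lemma card_missing_le_card_inside (hV : Fintype.card V = 4 * Fintype.card Q)
    (hU : #U = 3 * Fintype.card Q)
    (hdeg : ∀ j v, 37 * (Fintype.card Q : ℝ) ^ 3 - 100 * (Fintype.card Q : ℝ) ^ 2 ≤
      #{p : V × V × V | (j, v, p) ∈ T}) (v : V) :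
    (#{x : Q × V × V × V | x.2 ∉ U ×ˢ U ×ˢ U ∧ (x.1, v, x.2) ∉ T} : ℝ) ≤
      #{x : Q × V × V × V | x.2 ∈ U ×ˢ U ×ˢ U ∧ (x.1, v, x.2) ∈ T} +
        100 * (Fintype.card Q : ℝ) ^ 3 := by
  have h1 : (Fintype.card Q : ℝ) * (37 * (Fintype.card Q : ℝ) ^ 3 -
      100 * (Fintype.card Q : ℝ) ^ 2) ≤ #{x : Q × V × V × V | (x.1, v, x.2) ∈ T} := by
    have e : (#{x : Q × V × V × V | (x.1, v, x.2) ∈ T} : ℝ) =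
        ∑ j : Q, (#{p : V × V × V | (j, v, p) ∈ T} : ℝ) := by
      rw [← Nat.cast_sum]
      simp only [card_filter, Fintype.sum_prod_type]
    rw [e]
    calc _ = ∑ j : Q, (37 * (Fintype.card Q : ℝ) ^ 3 - 100 * (Fintype.card Q : ℝ) ^ 2) := by
          rw [sum_const, card_univ, nsmul_eq_mul]
      _ ≤ _ := sum_le_sum fun j _ => hdeg j v
  have h2 : #{x : Q × V × V × V | x.2 ∈ U ×ˢ U ×ˢ U} +
      #{x : Q × V × V × V | x.2 ∉ U ×ˢ U ×ˢ U} = 64 * Fintype.card Q ^ 4 := by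
    rw [card_filter_add_card_filter_not]
    simp only [card_univ, Fintype.card_prod, hV]
    ring
  have h2' : (#{x : Q × V × V × V | x.2 ∈ U ×ˢ U ×ˢ U} : ℝ) +
      #{x : Q × V × V × V | x.2 ∉ U ×ˢ U ×ˢ U} = 64 * (Fintype.card Q : ℝ) ^ 4 := by
    exact_mod_cast h2
  rw [card_cube hU] at h2'
  have h3 : #{x : Q × V × V × V | x.2 ∉ U ×ˢ U ×ˢ U ∧ (x.1, v, x.2) ∈ T} +
      #{x : Q × V × V × V | x.2 ∉ U ×ˢ U ×ˢ U ∧ (x.1, v, x.2) ∉ T} =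
      #{x : Q × V × V × V | x.2 ∉ U ×ˢ U ×ˢ U} := by
    rw [← filter_filter, ← filter_filter]
    exact card_filter_add_card_filter_not _
  have h3' : (#{x : Q × V × V × V | x.2 ∉ U ×ˢ U ×ˢ U ∧ (x.1, v, x.2) ∈ T} : ℝ) +
      #{x : Q × V × V × V | x.2 ∉ U ×ˢ U ×ˢ U ∧ (x.1, v, x.2) ∉ T} =
      #{x : Q × V × V × V | x.2 ∉ U ×ˢ U ×ˢ U} := by exact_mod_cast h3
  have h4 : #{x : Q × V × V × V | (x.1, v, x.2) ∈ T} ≤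
      #{x : Q × V × V × V | x.2 ∈ U ×ˢ U ×ˢ U ∧ (x.1, v, x.2) ∈ T} +
      #{x : Q × V × V × V | x.2 ∉ U ×ˢ U ×ˢ U ∧ (x.1, v, x.2) ∈ T} := by
    refine (card_le_card fun x hx => ?_).trans (card_union_le _ _)
    simp only [mem_union, mem_filter, mem_univ, true_and] at hx ⊢
    tauto
  have h4' : (#{x : Q × V × V × V | (x.1, v, x.2) ∈ T} : ℝ) ≤
      #{x : Q × V × V × V | x.2 ∈ U ×ˢ U ×ˢ U ∧ (x.1, v, x.2) ∈ T} +
      #{x : Q × V × V × V | x.2 ∉ U ×ˢ U ×ˢ U ∧ (x.1, v, x.2) ∈ T} := by exact_mod_cast h4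
  linarith [show (Fintype.card Q : ℝ) * (37 * (Fintype.card Q : ℝ) ^ 3 -
    100 * (Fintype.card Q : ℝ) ^ 2) = 37 * (Fintype.card Q : ℝ) ^ 4 -
    100 * (Fintype.card Q : ℝ) ^ 3 by ring]

lemma sum_inside_le {α : ℝ}
    (hsparse : (#{e ∈ T | e.2.1 ∈ U ∧ e.2.2.1 ∈ U ∧ e.2.2.2.1 ∈ U ∧ e.2.2.2.2 ∈ U} : ℝ) ≤
      α * (Fintype.card Q : ℝ) ^ 5) :
    ∑ v ∈ U, (#{x : Q × V × V × V | x.2 ∈ U ×ˢ U ×ˢ U ∧ (x.1, v, x.2) ∈ T} : ℝ) ≤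
      α * (Fintype.card Q : ℝ) ^ 5 := by
  refine le_trans ?_ hsparse
  rw [sum_card_vertex U fun v x => x.2 ∈ U ×ˢ U ×ˢ U ∧ (x.1, v, x.2) ∈ T]
  refine Nat.cast_le.2 (card_le_card fun e he => ?_)
  simp only [mem_filter, mem_univ, true_and, mem_product] at he ⊢
  tauto

lemma sum_outside_missing_le {α : ℝ} (hV : Fintype.card V = 4 * Fintype.card Q)
    (hswap : ∀ {j a b c d}, (j, a, b, c, d) ∈ T → (j, b, a, c, d) ∈ T)
    (hU : #U = 3 * Fintype.card Q)
    (hdeg : ∀ j v, 37 * (Fintype.card Q : ℝ) ^ 3 - 100 * (Fintype.card Q : ℝ) ^ 2 ≤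
      #{p : V × V × V | (j, v, p) ∈ T})
    (hsparse : (#{e ∈ T | e.2.1 ∈ U ∧ e.2.2.1 ∈ U ∧ e.2.2.2.1 ∈ U ∧ e.2.2.2.2 ∈ U} : ℝ) ≤
      α * (Fintype.card Q : ℝ) ^ 5)
    (hm : 300 ≤ α * Fintype.card Q) :
    ∑ v ∈ Uᶜ, (#{x : Q × V × V × V | x.2 ∈ U ×ˢ U ×ˢ U ∧ (x.1, v, x.2) ∉ T} : ℝ) ≤
      2 * α * (Fintype.card Q : ℝ) ^ 5 := by
  calc ∑ v ∈ Uᶜ, (#{x : Q × V × V × V | x.2 ∈ U ×ˢ U ×ˢ U ∧ (x.1, v, x.2) ∉ T} : ℝ)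
      ≤ ∑ v ∈ U, (#{x : Q × V × V × V | x.2 ∉ U ×ˢ U ×ˢ U ∧ (x.1, v, x.2) ∉ T} : ℝ) := by
        rw [sum_card_vertex Uᶜ fun v x => x.2 ∈ U ×ˢ U ×ˢ U ∧ (x.1, v, x.2) ∉ T,
          sum_card_vertex U fun v x => x.2 ∉ U ×ˢ U ×ˢ U ∧ (x.1, v, x.2) ∉ T]
        refine Nat.cast_le.2 (card_le_card_of_injOn
          (fun e => (e.1, e.2.2.1, e.2.1, e.2.2.2)) ?_ ?_)
        · rintro ⟨j, a, b, c, d⟩ he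
          simp only [coe_filter, mem_univ, true_and, Set.mem_ofPred_eq, mem_product,
            mem_compl] at he ⊢
          exact ⟨he.2.1.1, fun h => he.1 h.1, fun h => he.2.2 (hswap h)⟩
        · rintro ⟨j, a, b, c, d⟩ _ ⟨j', a', b', c', d'⟩ _ h
          simp only [Prod.mk.injEq] at h ⊢
          tauto
    _ ≤ ∑ v ∈ U, ((#{x : Q × V × V × V | x.2 ∈ U ×ˢ U ×ˢ U ∧ (x.1, v, x.2) ∈ T} : ℝ) +
        100 * (Fintype.card Q : ℝ) ^ 3) :=
        sum_le_sum fun v _ => card_missing_le_card_inside hV hU hdeg v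
    _ ≤ α * (Fintype.card Q : ℝ) ^ 5 + 300 * (Fintype.card Q : ℝ) ^ 4 := by
        rw [sum_add_distrib, sum_const, hU, nsmul_eq_mul]
        have := sum_inside_le hsparse
        push_cast
        linarith [show 3 * (Fintype.card Q : ℝ) * (100 * (Fintype.card Q : ℝ) ^ 3) =
          300 * (Fintype.card Q : ℝ) ^ 4 by ring]
    _ ≤ α * (Fintype.card Q : ℝ) ^ 5 + α * Fintype.card Q * (Fintype.card Q : ℝ) ^ 4 := by
        gcongr
    _ = _ := by ring

end SparseStructure

section SparseImpliesNearExtremal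

open Finset

variable {Q V : Type*} [Fintype Q] [Fintype V] [DecidableEq Q] [DecidableEq V]
  {T : Finset (Q × V × V × V × V)} {U : Finset V}

set_option maxHeartbeats 2000000 in
theorem exists_nearExtremal_of_sparse (hV : Fintype.card V = 4 * Fintype.card Q)
    (hT : ∀ e ∈ T, #(tupleEdge e) = 5)
    (hswap₁ : ∀ {j a b c d}, (j, a, b, c, d) ∈ T → (j, b, a, c, d) ∈ T)
    (hswap₂ : ∀ {j a b c d}, (j, a, b, c, d) ∈ T → (j, a, c, b, d) ∈ T)
    (hswap₃ : ∀ {j a b c d}, (j, a, b, c, d) ∈ T → (j, a, b, d, c) ∈ T)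
    (hdeg : ∀ j v, 37 * (Fintype.card Q : ℝ) ^ 3 - 100 * (Fintype.card Q : ℝ) ^ 2 ≤
      #{p : V × V × V | (j, v, p) ∈ T})
    (hlink : ∀ W : Finset V, #W < Fintype.card Q → ∀ j u, u ∉ W →
      4 * ((Fintype.card Q : ℝ) - #W - 1) * (Fintype.card Q : ℝ) ^ 2 + 1 ≤
        #{p : V × V × V | p ∈ Wᶜ ×ˢ Wᶜ ×ˢ Wᶜ ∧ (j, u, p) ∈ T})
    (hU : #U = 3 * Fintype.card Q)
    (hsparse : (#{e ∈ T | e.2.1 ∈ U ∧ e.2.2.1 ∈ U ∧ e.2.2.2.1 ∈ U ∧ e.2.2.2.2 ∈ U} : ℝ) ≤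
      1 / 10 ^ 15 * (Fintype.card Q : ℝ) ^ 5)
    (hm : 3 * 10 ^ 17 ≤ (Fintype.card Q : ℝ)) : ∃ W, NearExtremal T W := by
  have hmiss := card_missing_le_card_inside hV hU hdeg
  have hin := sum_inside_le hsparse
  have hout := sum_outside_missing_le hV hswap₁ hU hdeg hsparse (by linarith)
  have htot : ∀ v, (#{x : Q × V × V × V | x.2 ∈ U ×ˢ U ×ˢ U ∧ (x.1, v, x.2) ∈ T} : ℝ) +
      #{x : Q × V × V × V | x.2 ∈ U ×ˢ U ×ˢ U ∧ (x.1, v, x.2) ∉ T} =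
      27 * (Fintype.card Q : ℝ) ^ 4 := by
    intro v
    rw [← card_cube hU, ← filter_filter, ← filter_filter]
    exact_mod_cast card_filter_add_card_filter_not _
  set m : ℝ := (Fintype.card Q : ℝ) with hm_def
  have hm0 : 0 < m := by linarith
  have hm3 : 0 < m ^ 3 := by positivity
  have hm4 : 0 < m ^ 4 := by positivity
  have hm34 : 3 * 10 ^ 17 * m ^ 3 ≤ m ^ 4 := by
    rw [show m ^ 4 = m * m ^ 3 by ring]
    gcongr
  obtain ⟨D, hD⟩ : ∃ D : V → ℝ, ∀ v, D v =
    (#{x : Q × V × V × V | x.2 ∈ U ×ˢ U ×ˢ U ∧ (x.1, v, x.2) ∈ T} : ℝ) := ⟨_, fun _ => rfl⟩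
  obtain ⟨B, hB⟩ : ∃ B : V → ℝ, ∀ v, B v =
    (#{x : Q × V × V × V | x.2 ∈ U ×ˢ U ×ˢ U ∧ (x.1, v, x.2) ∉ T} : ℝ) := ⟨_, fun _ => rfl⟩
  simp only [← hD, ← hB] at hmiss hin hout htot
  have hD0 : ∀ v, 0 ≤ D v := fun v => hD v ▸ Nat.cast_nonneg _
  have hB0 : ∀ v, 0 ≤ B v := fun v => hB v ▸ Nat.cast_nonneg _
  set W : Finset V := {v | m ^ 4 / 1000 ≤ D v} with hW
  have hmemW : ∀ v, v ∈ W ↔ m ^ 4 / 1000 ≤ D v := fun v => by simp [hW]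
  have hWU : (#(U \ Wᶜ) : ℝ) ≤ 1000 / 10 ^ 15 * m := by
    have h1 : #(U \ Wᶜ) * (m ^ 4 / 1000) ≤ 1 / 10 ^ 15 * m ^ 5 := by
      refine card_mul_le_of_sum_le (f := D) (fun v hv => ?_) (le_trans ?_ hin)
      · rw [mem_sdiff, mem_compl, not_not, hmemW] at hv
        exact hv.2
      · exact sum_le_sum_of_subset_of_nonneg sdiff_subset fun v _ _ => hD0 v
    refine le_of_mul_le_mul_right ?_ hm4
    linarith [show 1000 / 10 ^ 15 * m * m ^ 4 = 1000 * (1 / 10 ^ 15 * m ^ 5) by ring]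
  have hUW : (#(Wᶜ \ U) : ℝ) ≤ 1 / 10 ^ 15 * m := by
    have h1 : #(Wᶜ \ U) * (26 * m ^ 4) ≤ 2 * (1 / 10 ^ 15) * m ^ 5 := by
      refine card_mul_le_of_sum_le (f := B) (fun v hv => ?_) (le_trans ?_ hout)
      · rw [mem_sdiff, mem_compl, hmemW, not_le] at hv
        linarith [htot v]
      · refine sum_le_sum_of_subset_of_nonneg (fun v hv => ?_) fun v _ _ => hB0 v
        exact mem_compl.2 (mem_sdiff.1 hv).2
    refine le_of_mul_le_mul_right ?_ hm4
    have : 0 ≤ (#(Wᶜ \ U) : ℝ) * m ^ 4 := by positivity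
    nlinarith [show 1 / 10 ^ 15 * m * m ^ 4 = 1 / 10 ^ 15 * m ^ 5 by ring]
  have hcW : (#W : ℝ) + #Wᶜ = 4 * m := by
    have : #W + #Wᶜ = 4 * Fintype.card Q := by rw [card_add_card_compl, hV]
    rw [hm_def]
    exact_mod_cast this
  have hc1 : (#Wᶜ : ℝ) + #(U \ Wᶜ) = 3 * m + #(Wᶜ \ U) := by
    have h1 := card_sdiff_add_card_inter U Wᶜ
    have h2 := card_sdiff_add_card_inter Wᶜ U
    rw [inter_comm] at h2
    rw [hm_def]
    have : #Wᶜ + #(U \ Wᶜ) = 3 * Fintype.card Q + #(Wᶜ \ U) := by omega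
    exact_mod_cast this
  have p1 : (0 : ℝ) ≤ #(U \ Wᶜ) := Nat.cast_nonneg _
  have p2 : (0 : ℝ) ≤ #(Wᶜ \ U) := Nat.cast_nonneg _
  have hch1 : 48 * (#(U \ Wᶜ) : ℝ) * m ^ 3 ≤ 48000 / 10 ^ 15 * m ^ 4 := by
    calc _ ≤ 48 * (1000 / 10 ^ 15 * m) * m ^ 3 := by gcongr
      _ = _ := by ring
  have hch2 : 48 * (#(Wᶜ \ U) : ℝ) * m ^ 3 ≤ 48 / 10 ^ 15 * m ^ 4 := by
    calc _ ≤ 48 * (1 / 10 ^ 15 * m) * m ^ 3 := by gcongr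
      _ = _ := by ring
  have hBW : ∀ w, (#{x : Q × V × V × V | x.2 ∈ Wᶜ ×ˢ Wᶜ ×ˢ Wᶜ ∧ (x.1, w, x.2) ∉ T} : ℝ) ≤
      B w + 48 / 10 ^ 15 * m ^ 4 := fun w =>
    (card_mem_cube_le hV Wᶜ U fun x => (x.1, w, x.2) ∉ T).trans (by
      rw [← hm_def, ← hB]
      exact add_le_add_right hch2 _)
  have hsumW : ∑ w ∈ W \ U, B w ≤ 2 * (1 / 10 ^ 15) * m ^ 5 := by
    refine le_trans (sum_le_sum_of_subset_of_nonneg (fun v hv => ?_) fun v _ _ => hB0 v) hout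
    exact mem_compl.2 (mem_sdiff.1 hv).2
  have hWU' : (#(W ∩ U) : ℝ) ≤ 1000 / 10 ^ 15 * m := by
    refine le_trans (Nat.cast_le.2 (card_le_card fun v hv => ?_)) hWU
    rw [mem_inter] at hv
    rw [mem_sdiff, mem_compl, not_not]
    exact ⟨hv.2, hv.1⟩
  refine ⟨W, hV, hT, hswap₁, hswap₂, hswap₃, fun j v => ?_, by linarith, by linarith,
    fun u hu => ?_, fun u hu => ?_, fun w hw => ?_, ?_, ?_, hlink W⟩
  · refine le_trans ?_ (hdeg j v)
    have : 100 * m ^ 2 ≤ m * m ^ 2 := by gcongr; linarith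
    linarith [show m * m ^ 2 = m ^ 3 by ring]
  · rw [hmemW, not_le] at hu
    have h1 := card_notMem_cube_le hV Wᶜ U fun x => (x.1, u, x.2) ∉ T
    have h2 := hmiss u
    rw [← hm_def] at h1
    linarith [hD u]
  · rw [hmemW, not_le] at hu
    have h1 := card_mem_cube_le hV Wᶜ U fun x => (x.1, u, x.2) ∈ T
    rw [← hm_def] at h1
    linarith [hD u]
  · rw [hmemW] at hw
    have h1 := card_mem_cube_le hV U Wᶜ fun x => (x.1, w, x.2) ∈ T
    rw [← hm_def] at h1
    linarith [hD w]
  · set S := W.filter fun w => m ^ 4 / 500 <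
      (#{x : Q × V × V × V | x.2 ∈ Wᶜ ×ˢ Wᶜ ×ˢ Wᶜ ∧ (x.1, w, x.2) ∉ T} : ℝ) with hS
    have h1 : #(S \ U) * (m ^ 4 / 1000) ≤ 2 * (1 / 10 ^ 15) * m ^ 5 := by
      refine card_mul_le_of_sum_le (f := B) (fun v hv => ?_) (le_trans ?_ hsumW)
      · rw [mem_sdiff, hS, mem_filter] at hv
        linarith [hBW v, hv.1.2]
      · exact sum_le_sum_of_subset_of_nonneg (sdiff_subset_sdiff (filter_subset _ _) subset_rfl)
          fun v _ _ => hB0 v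
    have h2 : (#(S \ U) : ℝ) ≤ 2000 / 10 ^ 15 * m := by
      refine le_of_mul_le_mul_right ?_ hm4
      linarith [show 2000 / 10 ^ 15 * m * m ^ 4 = 2000 * (1 / 10 ^ 15 * m ^ 5) by ring]
    have h3 : (#S : ℝ) ≤ #(S \ U) + #(W ∩ U) := by
      have h4 := card_sdiff_add_card_inter S U
      have h5 : #(S ∩ U) ≤ #(W ∩ U) :=
        card_le_card (inter_subset_inter (filter_subset _ _) subset_rfl)
      have : #S ≤ #(S \ U) + #(W ∩ U) := by omega
      exact_mod_cast this
    linarith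
  · set S : Finset Q := univ.filter fun j => m ^ 4 / 500 <
      (#{p : V × V × V × V | p ∈ W ×ˢ Wᶜ ×ˢ Wᶜ ×ˢ Wᶜ ∧ (j, p) ∉ T} : ℝ) with hS
    have h1 : ∑ j, (#{p : V × V × V × V | p ∈ W ×ˢ Wᶜ ×ˢ Wᶜ ×ˢ Wᶜ ∧ (j, p) ∉ T} : ℝ) =
        ∑ w ∈ W, (#{x : Q × V × V × V | x.2 ∈ Wᶜ ×ˢ Wᶜ ×ˢ Wᶜ ∧ (x.1, w, x.2) ∉ T} : ℝ) := by
      rw [sum_card_colour fun j p => p ∈ W ×ˢ Wᶜ ×ˢ Wᶜ ×ˢ Wᶜ ∧ (j, p) ∉ T,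
        sum_card_vertex W fun w x => x.2 ∈ Wᶜ ×ˢ Wᶜ ×ˢ Wᶜ ∧ (x.1, w, x.2) ∉ T]
      congr 2
      ext e
      simp only [mem_filter, mem_univ, true_and, mem_product]
      tauto
    have h2 : ∑ w ∈ W \ U,
        (#{x : Q × V × V × V | x.2 ∈ Wᶜ ×ˢ Wᶜ ×ˢ Wᶜ ∧ (x.1, w, x.2) ∉ T} : ℝ) ≤
        2 * (1 / 10 ^ 15) * m ^ 5 + 2 * m * (48 / 10 ^ 15 * m ^ 4) := by
      calc _ ≤ ∑ w ∈ W \ U, (B w + 48 / 10 ^ 15 * m ^ 4) := sum_le_sum fun w _ => hBW w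
        _ = ∑ w ∈ W \ U, B w + #(W \ U) * (48 / 10 ^ 15 * m ^ 4) := by
            rw [sum_add_distrib, sum_const, nsmul_eq_mul]
        _ ≤ _ := by
            gcongr
            have : (#(W \ U) : ℝ) ≤ #W := by exact_mod_cast card_le_card sdiff_subset
            linarith
    have h3 : ∑ w ∈ W ∩ U,
        (#{x : Q × V × V × V | x.2 ∈ Wᶜ ×ˢ Wᶜ ×ˢ Wᶜ ∧ (x.1, w, x.2) ∉ T} : ℝ) ≤
        1000 / 10 ^ 15 * m * (28 * m ^ 4) := by
      calc _ ≤ ∑ w ∈ W ∩ U, 28 * m ^ 4 := sum_le_sum fun w _ => by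
            linarith [hBW w, htot w, hD0 w]
        _ = #(W ∩ U) * (28 * m ^ 4) := by rw [sum_const, nsmul_eq_mul]
        _ ≤ _ := by gcongr
    have h4 : #S * (m ^ 4 / 500) ≤ 29000 / 10 ^ 15 * m ^ 5 := by
      refine card_mul_le_of_sum_le
        (f := fun j => (#{p : V × V × V × V | p ∈ W ×ˢ Wᶜ ×ˢ Wᶜ ×ˢ Wᶜ ∧ (j, p) ∉ T} : ℝ))
        (fun j hj => (mem_filter.1 hj).2.le) ?_
      refine (sum_le_sum_of_subset_of_nonneg (subset_univ S)
        fun j _ _ => Nat.cast_nonneg _).trans ?_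
      rw [h1, ← sum_sdiff (inter_subset_left : W ∩ U ⊆ W), sdiff_inter_self_left]
      have : 0 < m ^ 5 := by positivity
      linarith [show 2 * m * (48 / 10 ^ 15 * m ^ 4) = 96 / 10 ^ 15 * m ^ 5 by ring,
        show 1000 / 10 ^ 15 * m * (28 * m ^ 4) = 28000 / 10 ^ 15 * m ^ 5 by ring]
    refine le_of_mul_le_mul_right (le_trans ?_ (?_ : 500 * (29000 / 10 ^ 15 * m ^ 5) ≤ _)) hm4
    · linarith
    · have : 0 < m ^ 5 := by positivity
      linarith [show m / 10 ^ 7 * m ^ 4 = 1 / 10 ^ 7 * m ^ 5 by ring]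

end SparseImpliesNearExtremal

section Binomials

lemma two_mul_choose_two (n : ℕ) : 2 * (n + 1).choose 2 = (n + 1) * n := by
  induction n with
  | zero => rfl
  | succ n ih =>
    rw [Nat.choose_succ_succ' (n + 1) 1, Nat.choose_one_right, mul_add, ih]
    ring

lemma six_mul_choose_three (n : ℕ) : 6 * (n + 2).choose 3 = (n + 2) * (n + 1) * n := by
  induction n with
  | zero => rfl
  | succ n ih =>
    rw [Nat.choose_succ_succ' (n + 2) 2, mul_add, ih]
    have := two_mul_choose_two (n + 1)
    linear_combination 3 * this

lemma choose_three_add_le (a k : ℕ) :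
    a.choose 3 + k * a.choose 2 ≤ (a + k).choose 3 := by
  induction k with
  | zero => simp
  | succ k ih =>
    rw [← add_assoc, Nat.choose_succ_succ' (a + k) 2, add_mul, show 2 + 1 = 3 from rfl]
    have := Nat.choose_le_choose 2 (Nat.le_add_right a k)
    omega

end Binomials

section OrderedTuples

open Finset

lemma card_edges_in {V : Type*} [DecidableEq V] (S : Finset V) {v : V} (hv : v ∈ S) :
    #{e ∈ powersetCard 4 S | v ∈ e} = (#S - 1).choose 3 := by
  have : ({e ∈ powersetCard 4 S | v ∈ e} : Finset _) =
      (powersetCard 3 (S.erase v)).image (insert v) := by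
    ext e
    simp only [mem_filter, mem_powersetCard, mem_image]
    constructor
    · rintro ⟨⟨hS, hc⟩, hve⟩
      exact ⟨e.erase v, ⟨erase_subset_erase v hS, by rw [card_erase_of_mem hve, hc]⟩,
        insert_erase hve⟩
    · rintro ⟨f, ⟨hS, hc⟩, rfl⟩
      have hvf : v ∉ f := fun h => by simpa using hS h
      exact ⟨⟨insert_subset hv (hS.trans (erase_subset v S)),
        by rw [card_insert_of_notMem hvf, hc]⟩, mem_insert_self v f⟩
  rw [this, card_image_of_injOn, card_powersetCard, card_erase_of_mem hv]
  intro f hf g hg hfg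
  have hvf : ∀ f ∈ powersetCard 3 (S.erase v), v ∉ f := fun f hf h => by
    simpa using (mem_powersetCard.1 hf).1 h
  rw [← erase_insert (hvf f hf), ← erase_insert (hvf g hg)]
  exact congrArg (fun s => erase s v) hfg

variable {Q V : Type*} [Fintype V] [DecidableEq V]

lemma card_edges_in_ge {F : Q → Finset (Finset V)} (hF : ∀ j, ∀ e ∈ F j, #e = 4) (S : Finset V)
    (j : Q) {v : V}
    (hv : v ∈ S) : #{e ∈ F j | v ∈ e} + (#S - 1).choose 3 ≤
      #{e ∈ F j | v ∈ e ∧ e ⊆ S} + (Fintype.card V - 1).choose 3 := by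
  rw [← card_edges_in S hv, ← card_univ (α := V), ← card_edges_in univ (mem_univ v),
    ← card_union_add_card_inter]
  rw [add_comm]
  refine add_le_add (card_le_card fun e he => ?_) (card_le_card fun e he => ?_)
  · simp only [mem_inter, mem_filter, mem_powersetCard] at he ⊢
    exact ⟨he.1.1, he.1.2, he.2.1.1⟩
  · simp only [mem_union, mem_filter, mem_powersetCard] at he ⊢
    rcases he with he | he
    · exact ⟨⟨subset_univ e, hF j e he.1⟩, he.2⟩
    · exact ⟨⟨subset_univ e, he.1.2⟩, he.2⟩

variable [Fintype Q]

/-- The ordered versions of the edges of the 4-graphs `F j`, labelled by their colours. -/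
def orderedTuples (F : Q → Finset (Finset V)) : Finset (Q × V × V × V × V) :=
  {e | ({e.2.1, e.2.2.1, e.2.2.2.1, e.2.2.2.2} : Finset V) ∈ F e.1}

variable {F : Q → Finset (Finset V)}

lemma mem_orderedTuples {j : Q} {a b c d : V} :
    (j, a, b, c, d) ∈ orderedTuples F ↔ ({a, b, c, d} : Finset V) ∈ F j := by
  simp [orderedTuples]

lemma six_mul_card_le_card_ordered [DecidableEq Q] (hF : ∀ j, ∀ e ∈ F j, #e = 4) (S : Finset V)
    (j : Q) {v : V} (hv : v ∈ S) :
    6 * #{e ∈ F j | v ∈ e ∧ e ⊆ S} ≤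
      #{p : V × V × V | p ∈ S ×ˢ S ×ˢ S ∧ (j, v, p) ∈ orderedTuples F} := by
  have hmaps : ∀ p ∈ ({p : V × V × V | p ∈ S ×ˢ S ×ˢ S ∧ (j, v, p) ∈ orderedTuples F} :
      Finset (V × V × V)), ({v, p.1, p.2.1, p.2.2} : Finset V) ∈
      ({e ∈ F j | v ∈ e ∧ e ⊆ S} : Finset (Finset V)) := by
    rintro ⟨b, c, d⟩ hp
    simp only [mem_filter, mem_univ, true_and, mem_product, mem_orderedTuples] at hp ⊢
    refine ⟨hp.2, mem_insert_self _ _, ?_⟩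
    intro x
    simp only [mem_insert, mem_singleton]
    rintro (rfl | rfl | rfl | rfl) <;> tauto
  rw [card_eq_sum_card_fiberwise hmaps, mul_comm, ← smul_eq_mul]
  refine card_nsmul_le_sum _ _ _ fun e he => ?_
  rw [mem_filter] at he
  obtain ⟨heF, hve, heS⟩ := he
  have h3 : #(e.erase v) = 3 := by rw [card_erase_of_mem hve, hF j e heF]
  obtain ⟨x, y, z, hxy, hxz, hyz, hxyz⟩ := card_eq_three.1 h3
  have he' : e = {v, x, y, z} := by rw [← hxyz, insert_erase hve]
  have hsub : ({(x, y, z), (x, z, y), (y, x, z), (y, z, x), (z, x, y), (z, y, x)} :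
      Finset (V × V × V)) ⊆ {p ∈ ({p : V × V × V | p ∈ S ×ˢ S ×ˢ S ∧
        (j, v, p) ∈ orderedTuples F} : Finset (V × V × V)) |
        ({v, p.1, p.2.1, p.2.2} : Finset V) = e} := by
    have hx : x ∈ S := heS (by rw [he']; simp)
    have hy : y ∈ S := heS (by rw [he']; simp)
    have hz : z ∈ S := heS (by rw [he']; simp)
    have key : ∀ p : V × V × V, p ∈ S ×ˢ S ×ˢ S → ({v, p.1, p.2.1, p.2.2} : Finset V) = e →
        p ∈ ({p ∈ ({p : V × V × V | p ∈ S ×ˢ S ×ˢ S ∧ (j, v, p) ∈ orderedTuples F} :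
          Finset (V × V × V)) | ({v, p.1, p.2.1, p.2.2} : Finset V) = e} : Finset _) := by
      rintro ⟨b, c, d⟩ hp hpe
      rw [mem_filter, mem_filter, mem_orderedTuples]
      exact ⟨⟨mem_univ _, hp, hpe ▸ heF⟩, hpe⟩
    intro p hp
    simp only [mem_insert, mem_singleton] at hp
    rcases hp with rfl | rfl | rfl | rfl | rfl | rfl <;>
      (refine key _ (by simp [hx, hy, hz]) (Eq.trans ?_ he'.symm); ext t; grind)
  refine le_trans (le_of_eq ?_) (card_le_card hsub)
  symm
  rw [card_insert_of_notMem, card_insert_of_notMem, card_insert_of_notMem,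
    card_insert_of_notMem, card_insert_of_notMem, card_singleton] <;>
    simp only [mem_insert, mem_singleton, Prod.mk.injEq] <;> tauto

variable [DecidableEq Q]

lemma orderedTuples_degree_ge (hV : Fintype.card V = 4 * Fintype.card Q)
    (hm : 1 ≤ Fintype.card Q) (hF : ∀ j, ∀ e ∈ F j, #e = 4)
    (hdeg : ∀ j v, (Fintype.card V - 1).choose 3 - (3 * Fintype.card Q).choose 3 <
      #{e ∈ F j | v ∈ e}) (j : Q) (v : V) :
    37 * (Fintype.card Q : ℝ) ^ 3 - 100 * (Fintype.card Q : ℝ) ^ 2 ≤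
      #{p : V × V × V | (j, v, p) ∈ orderedTuples F} := by
  have h1 := six_mul_card_le_card_ordered hF univ j (mem_univ v)
  simp only [univ_product_univ, mem_univ, true_and, subset_univ, and_true] at h1
  have h2 := hdeg j v
  obtain ⟨k, hk⟩ := Nat.exists_eq_add_of_le' hm
  rw [hV, hk] at h2
  have h3 := six_mul_choose_three (4 * k + 1)
  have h4 := six_mul_choose_three (3 * k + 1)
  rw [show 4 * (k + 1) - 1 = 4 * k + 1 + 2 by omega, show 3 * (k + 1) = 3 * k + 1 + 2 by ring] at h2
  have h5 : (4 * k + 1 + 2) * (4 * k + 1 + 1) * (4 * k + 1) ≤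
      #{p : V × V × V | (j, v, p) ∈ orderedTuples F} +
        (3 * k + 1 + 2) * (3 * k + 1 + 1) * (3 * k + 1) := by
    rw [← h3, ← h4]
    omega
  have h6 : (((4 * k + 1 + 2) * (4 * k + 1 + 1) * (4 * k + 1) : ℕ) : ℝ) ≤
      #{p : V × V × V | (j, v, p) ∈ orderedTuples F} +
        ((3 * k + 1 + 2) * (3 * k + 1 + 1) * (3 * k + 1) : ℕ) := by exact_mod_cast h5
  rw [hk]
  push_cast at h6 ⊢
  have : (0 : ℝ) ≤ k := Nat.cast_nonneg k
  nlinarith [h6]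

lemma orderedTuples_link_ge (hV : Fintype.card V = 4 * Fintype.card Q)
    (hm : 3 ≤ Fintype.card Q) (hF : ∀ j, ∀ e ∈ F j, #e = 4)
    (hdeg : ∀ j v, (Fintype.card V - 1).choose 3 - (3 * Fintype.card Q).choose 3 <
      #{e ∈ F j | v ∈ e}) (W : Finset V) (hW : #W < Fintype.card Q) (j : Q) (u : V)
    (hu : u ∉ W) :
    4 * ((Fintype.card Q : ℝ) - #W - 1) * (Fintype.card Q : ℝ) ^ 2 + 1 ≤
      #{p : V × V × V | p ∈ Wᶜ ×ˢ Wᶜ ×ˢ Wᶜ ∧ (j, u, p) ∈ orderedTuples F} := by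
  have h1 := six_mul_card_le_card_ordered hF Wᶜ j (mem_compl.2 hu)
  have h2 := card_edges_in_ge hF Wᶜ j (mem_compl.2 hu)
  have h3 := hdeg j u
  obtain ⟨k, hk⟩ : ∃ k, Fintype.card Q = #W + k + 1 := ⟨Fintype.card Q - #W - 1, by omega⟩
  have h4 : #Wᶜ - 1 = 3 * Fintype.card Q + k := by
    rw [card_compl, hV]
    omega
  have h5 := choose_three_add_le (3 * Fintype.card Q) k
  rw [h4] at h2
  have h6 : 4 * Fintype.card Q ^ 2 ≤ (3 * Fintype.card Q).choose 2 := by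
    obtain ⟨l, hl⟩ := Nat.exists_eq_add_of_le' hm
    have := two_mul_choose_two (3 * l + 8)
    rw [hl, show 3 * (l + 3) = 3 * l + 8 + 1 by ring]
    nlinarith
  have h7 : k * (4 * Fintype.card Q ^ 2) ≤ k * (3 * Fintype.card Q).choose 2 :=
    Nat.mul_le_mul_left k h6
  have h8 : k * (4 * Fintype.card Q ^ 2) + 1 ≤
      #{p : V × V × V | p ∈ Wᶜ ×ˢ Wᶜ ×ˢ Wᶜ ∧ (j, u, p) ∈ orderedTuples F} := by omega
  have h9 : (k : ℝ) * (4 * (Fintype.card Q : ℝ) ^ 2) + 1 ≤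
      #{p : V × V × V | p ∈ Wᶜ ×ˢ Wᶜ ×ˢ Wᶜ ∧ (j, u, p) ∈ orderedTuples F} := by
    exact_mod_cast h8
  have h10 : (Fintype.card Q : ℝ) - #W - 1 = k := by
    rw [hk]
    push_cast
    ring
  rw [h10]
  linarith

end OrderedTuples

section Extraction

open Finset

variable {Q V : Type*} [Fintype Q] [Fintype V] [DecidableEq Q] [DecidableEq V]

lemma exists_rainbow_of_tiled {F : Q → Finset (Finset V)} {A : Finset (Q ⊕ V)}
    (hA : Tiled (fun i : orderedTuples F => tupleEdge i.1) A) :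
    ∃ e : Q → Finset V, (∀ j ∈ A.toLeft, e j ∈ F j ∧ e j ⊆ A.toRight) ∧
      ∀ i ∈ A.toLeft, ∀ j ∈ A.toLeft, i ≠ j → Disjoint (e i) (e j) := by
  induction hA with
  | empty => exact ⟨fun _ => ∅, by simp [mem_toLeft], by simp [mem_toLeft]⟩
  | cons A t hA hd ih =>
    obtain ⟨e, he, hdisj⟩ := ih
    obtain ⟨⟨k, a, b, c, d⟩, ht⟩ := t
    rw [mem_orderedTuples] at ht
    have hk : k ∉ A.toLeft := fun h =>
      disjoint_left.1 hd (mem_toLeft.1 h) (inl_mem_tupleEdge.2 rfl)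
    have hnew : Disjoint A.toRight {a, b, c, d} := by
      have := disjoint_toRight hd
      rwa [toRight_tupleEdge] at this
    have hmem : ∀ j, j ∈ (A ∪ tupleEdge (k, a, b, c, d)).toLeft ↔ j ∈ A.toLeft ∨ j = k := by
      intro j
      rw [toLeft_union, mem_union, toLeft_tupleEdge, mem_singleton]
    have hne : ∀ j ∈ A.toLeft, j ≠ k := fun j hj h => hk (h ▸ hj)
    refine ⟨Function.update e k {a, b, c, d}, fun j hj => ?_, fun i hi j hj hij => ?_⟩
    · dsimp only at hj
      rw [toRight_union, toRight_tupleEdge]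
      rcases (hmem j).1 hj with hj | rfl
      · rw [Function.update_of_ne (hne j hj)]
        exact ⟨(he j hj).1, (he j hj).2.trans subset_union_left⟩
      · rw [Function.update_self]
        exact ⟨ht, subset_union_right⟩
    · dsimp only at hi hj
      rcases (hmem i).1 hi with hi' | rfl <;> rcases (hmem j).1 hj with hj' | rfl
      · rw [Function.update_of_ne (hne i hi'), Function.update_of_ne (hne j hj')]
        exact hdisj i hi' j hj' hij
      · rw [Function.update_of_ne (hne i hi'), Function.update_self]
        exact hnew.mono_left (he i hi').2
      · rw [Function.update_of_ne (hne j hj'), Function.update_self]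
        exact (hnew.mono_left (he j hj').2).symm
      · exact absurd rfl hij

end Extraction

section Restriction

open Finset

lemma Tiled.image {P P' ι κ : Type*} [DecidableEq P] [DecidableEq P'] {s : ι → Finset P}
    {t : κ → Finset P'} {f : P' → P} (hf : Function.Injective f)
    (h : ∀ k, ∃ i, s i = (t k).image f) {A : Finset P'} (hA : Tiled t A) :
    Tiled s (A.image f) := by
  induction hA with
  | empty => simpa using Tiled.empty
  | cons A k _ hd ih =>
    obtain ⟨i, hi⟩ := h k
    rw [image_union, ← hi]
    refine Tiled.cons _ i ih ?_
    rw [hi]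
    exact (disjoint_image hf).2 hd

/-- The map on tuples induced by a map on colours and a map on vertices. -/
def mapTuple {Q Q' V V' : Type*} (f : Q' → Q) (g : V' → V) (e : Q' × V' × V' × V' × V') :
    Q × V × V × V × V := (f e.1, g e.2.1, g e.2.2.1, g e.2.2.2.1, g e.2.2.2.2)

lemma tupleEdge_mapTuple {Q Q' V V' : Type*} [DecidableEq Q] [DecidableEq V] [DecidableEq Q']
    [DecidableEq V'] (f : Q' → Q) (g : V' → V) (e : Q' × V' × V' × V' × V') :
    tupleEdge (mapTuple f g e) = (tupleEdge e).image (Sum.map f g) := by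
  rw [tupleEdge, tupleEdge, image_image]
  congr 1
  funext i
  fin_cases i <;> rfl

variable {Q V : Type*} [Fintype Q] [Fintype V] [DecidableEq Q] [DecidableEq V]
  {T : Finset (Q × V × V × V × V)}

lemma exists_sparse_of_card_le (hV : Fintype.card V = 4 * Fintype.card Q) (U : Finset V) (r : ℕ)
    (hr : 3 * Fintype.card Q ≤ #U + r) : ∃ U₀ : Finset V, #U₀ = 3 * Fintype.card Q ∧
      #{e ∈ T | e.2.1 ∈ U₀ ∧ e.2.2.1 ∈ U₀ ∧ e.2.2.2.1 ∈ U₀ ∧ e.2.2.2.2 ∈ U₀} ≤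
      #{e ∈ T | e.2.1 ∈ U ∧ e.2.2.1 ∈ U ∧ e.2.2.2.1 ∈ U ∧ e.2.2.2.2 ∈ U} +
        256 * r * Fintype.card Q ^ 4 := by
  rcases le_total (3 * Fintype.card Q) #U with h | h
  · obtain ⟨U₀, hU₀, hc⟩ := exists_subset_card_eq h
    refine ⟨U₀, hc, le_trans (card_le_card fun e he => ?_) (Nat.le_add_right _ _)⟩
    rw [mem_filter] at he ⊢
    exact ⟨he.1, hU₀ he.2.1, hU₀ he.2.2.1, hU₀ he.2.2.2.1, hU₀ he.2.2.2.2⟩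
  · obtain ⟨U₀, hU₀, -, hc⟩ := exists_subsuperset_card_eq (subset_univ U) h
      (by rw [card_univ, hV]; omega)
    refine ⟨U₀, hc, ?_⟩
    have hD : #(U₀ \ U) ≤ r := by
      have := card_sdiff_add_card_eq_card hU₀
      omega
    set D := U₀ \ U with hD_def
    have hsub : ({e ∈ T | e.2.1 ∈ U₀ ∧ e.2.2.1 ∈ U₀ ∧ e.2.2.2.1 ∈ U₀ ∧ e.2.2.2.2 ∈ U₀} :
        Finset _) ⊆ T.filter (fun e =>
          e.2.1 ∈ U ∧ e.2.2.1 ∈ U ∧ e.2.2.2.1 ∈ U ∧ e.2.2.2.2 ∈ U) ∪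
        (univ ×ˢ D ×ˢ univ ×ˢ univ ×ˢ univ ∪ univ ×ˢ univ ×ˢ D ×ˢ univ ×ˢ univ ∪
          (univ ×ˢ univ ×ˢ univ ×ˢ D ×ˢ univ ∪ univ ×ˢ univ ×ˢ univ ×ˢ univ ×ˢ D)) := by
      intro e he
      simp only [mem_filter, mem_union, mem_product, mem_univ, true_and, and_true, hD_def,
        mem_sdiff] at he ⊢
      tauto
    refine (card_le_card hsub).trans ((card_union_le _ _).trans (Nat.add_le_add_left ?_ _))
    refine (card_union_le _ _).trans (add_le_add (card_union_le _ _) (card_union_le _ _)) |>.trans ?_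
    simp only [card_product, card_univ, hV]
    calc _ = 256 * #D * Fintype.card Q ^ 4 := by ring
      _ ≤ _ := by gcongr

variable (T) in
/-- The tuples of `T` whose colour lies in `C` and whose vertices lie in `S`. -/
def restrictTuples (C : Finset Q) (S : Finset V) : Finset (C × S × S × S × S) :=
  {e | mapTuple Subtype.val Subtype.val e ∈ T}

variable {C : Finset Q} {S : Finset V}

lemma mem_restrictTuples {e : C × S × S × S × S} :
    e ∈ restrictTuples T C S ↔ mapTuple Subtype.val Subtype.val e ∈ T := by
  simp [restrictTuples]

lemma sumMap_val_injective :
    Function.Injective (Sum.map Subtype.val Subtype.val : C ⊕ S → Q ⊕ V) :=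
  Function.Injective.sumMap Subtype.val_injective Subtype.val_injective

lemma card_tupleEdge_restrictTuples (hT : ∀ e ∈ T, #(tupleEdge e) = 5) :
    ∀ e ∈ restrictTuples T C S, #(tupleEdge e) = 5 := by
  intro e he
  have := hT _ (mem_restrictTuples.1 he)
  rwa [tupleEdge_mapTuple, card_image_of_injective _ sumMap_val_injective] at this

set_option synthInstance.maxSize 1000 in
lemma restrictTuples_degree_ge (hV : Fintype.card V = 4 * Fintype.card Q) (j : C) (v : S) :
    (#{p : V × V × V | (j.1, v.1, p) ∈ T} : ℝ) ≤
      #{p : S × S × S | (j, v, p) ∈ restrictTuples T C S} +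
        48 * #Sᶜ * (Fintype.card Q : ℝ) ^ 2 := by
  have hsub : ({p : V × V × V | (j.1, v.1, p) ∈ T} : Finset _) ⊆
      ({p : S × S × S | (j, v, p) ∈ restrictTuples T C S} : Finset (S × S × S)).image
        (fun p => (p.1.1, p.2.1.1, p.2.2.1)) ∪
      (Sᶜ ×ˢ univ ×ˢ univ ∪ univ ×ˢ Sᶜ ×ˢ univ ∪ univ ×ˢ univ ×ˢ Sᶜ) := by
    rintro ⟨b, c, d⟩ hp
    rw [mem_union]
    by_cases h : b ∈ S ∧ c ∈ S ∧ d ∈ S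
    · refine Or.inl (mem_image.2 ⟨(⟨b, h.1⟩, ⟨c, h.2.1⟩, ⟨d, h.2.2⟩), ?_, rfl⟩)
      rw [mem_filter] at hp ⊢
      exact ⟨mem_univ _, mem_restrictTuples.2 hp.2⟩
    · right
      simp only [mem_union, mem_product, mem_univ, and_true, true_and, mem_compl]
      tauto
  have h1 := (card_le_card hsub).trans ((card_union_le _ _).trans
    (add_le_add card_image_le ((card_union_le _ _).trans
      (Nat.add_le_add_right (card_union_le _ _) _))))
  simp only [card_product, card_univ, hV] at h1
  have h2 : #Sᶜ * (4 * Fintype.card Q * (4 * Fintype.card Q)) +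
      4 * Fintype.card Q * (#Sᶜ * (4 * Fintype.card Q)) +
      4 * Fintype.card Q * (4 * Fintype.card Q * #Sᶜ) = 48 * #Sᶜ * Fintype.card Q ^ 2 := by ring
  rw [h2] at h1
  exact_mod_cast h1

lemma card_inside_le_restrictTuples (hV : Fintype.card V = 4 * Fintype.card Q) (U : Finset S) :
    #{e ∈ T | e.2.1 ∈ U.map (.subtype _) ∧ e.2.2.1 ∈ U.map (.subtype _) ∧
      e.2.2.2.1 ∈ U.map (.subtype _) ∧ e.2.2.2.2 ∈ U.map (.subtype _)} ≤
    #{e ∈ restrictTuples T C S | e.2.1 ∈ U ∧ e.2.2.1 ∈ U ∧ e.2.2.2.1 ∈ U ∧ e.2.2.2.2 ∈ U} +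
      256 * #Cᶜ * Fintype.card Q ^ 4 := by
  have hsub : ({e ∈ T | e.2.1 ∈ U.map (.subtype _) ∧ e.2.2.1 ∈ U.map (.subtype _) ∧
      e.2.2.2.1 ∈ U.map (.subtype _) ∧ e.2.2.2.2 ∈ U.map (.subtype _)} : Finset _) ⊆
      ((restrictTuples T C S).filter fun e =>
        e.2.1 ∈ U ∧ e.2.2.1 ∈ U ∧ e.2.2.2.1 ∈ U ∧ e.2.2.2.2 ∈ U).image
        (mapTuple Subtype.val Subtype.val) ∪ Cᶜ ×ˢ univ := by
    rintro ⟨j, a, b, c, d⟩ he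
    simp only [mem_filter, mem_map, Function.Embedding.subtype_apply] at he
    obtain ⟨hT, ⟨a, ha, rfl⟩, ⟨b, hb, rfl⟩, ⟨c, hc, rfl⟩, ⟨d, hd, rfl⟩⟩ := he
    rw [mem_union]
    by_cases hj : j ∈ C
    · refine Or.inl (mem_image.2 ⟨(⟨j, hj⟩, a, b, c, d), ?_, rfl⟩)
      rw [mem_filter, mem_restrictTuples]
      exact ⟨hT, ha, hb, hc, hd⟩
    · exact Or.inr (mem_product.2 ⟨mem_compl.2 hj, mem_univ _⟩)
  refine (card_le_card hsub).trans ((card_union_le _ _).trans (add_le_add card_image_le ?_))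
  simp only [card_product, card_univ, Fintype.card_prod, hV]
  exact le_of_eq (by ring)

lemma Tiled.image_restrictTuples {A : Finset (C ⊕ S)}
    (hA : Tiled (fun i : restrictTuples T C S => tupleEdge i.1) A) :
    Tiled (fun i : T => tupleEdge i.1) (A.image (Sum.map Subtype.val Subtype.val)) :=
  hA.image sumMap_val_injective fun k =>
    ⟨⟨_, mem_restrictTuples.1 k.2⟩, tupleEdge_mapTuple _ _ _⟩

end Restriction

section Assembly

open Finset

variable {Q V : Type} [Fintype Q] [Fintype V] [DecidableEq Q] [DecidableEq V]
  {T : Finset (Q × V × V × V × V)}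

lemma tiled_univ_of_absorbed (hV : Fintype.card V = 4 * Fintype.card Q)
    (hT : ∀ e ∈ T, #(tupleEdge e) = 5) {ξ : ℝ} {Z : Finset (Q ⊕ V)}
    (hZ : Tiled (fun i : T => tupleEdge i.1) Z)
    (habs : ∀ L : Finset (Q ⊕ V), Disjoint L Z → #L.toRight = 4 * #L.toLeft → (#L : ℝ) ≤ ξ →
      Tiled (fun i : T => tupleEdge i.1) (L ∪ Z))
    {A : Finset ((Z.toLeftᶜ : Finset Q) ⊕ (Z.toRightᶜ : Finset V))}
    (hA : Tiled (fun i : restrictTuples T Z.toLeftᶜ Z.toRightᶜ => tupleEdge i.1) Aᶜ)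
    (hξ : (#A : ℝ) ≤ ξ) : Tiled (fun i : T => tupleEdge i.1) univ := by
  set f : (Z.toLeftᶜ : Finset Q) ⊕ (Z.toRightᶜ : Finset V) → Q ⊕ V :=
    Sum.map Subtype.val Subtype.val with hf
  have hinj : Function.Injective f := sumMap_val_injective
  have hrange : ∀ x, x ∉ Z → ∃ y, f y = x := by
    rintro (q | v) hx
    · exact ⟨Sum.inl ⟨q, by simpa using hx⟩, rfl⟩
    · exact ⟨Sum.inr ⟨v, by simpa using hx⟩, rfl⟩
  have hnot : ∀ y, f y ∉ Z := by
    rintro (⟨q, hq⟩ | ⟨v, hv⟩)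
    · simpa [hf] using hq
    · simpa [hf] using hv
  have hR : Tiled (fun i : T => tupleEdge i.1) (Aᶜ.image f) := hA.image_restrictTuples
  have hLZ : Disjoint (A.image f) Z := by
    rw [disjoint_left]
    intro x hx
    obtain ⟨y, -, rfl⟩ := mem_image.1 hx
    exact hnot y
  have hRZ : Disjoint (Aᶜ.image f) Z := by
    rw [disjoint_left]
    intro x hx
    obtain ⟨y, -, rfl⟩ := mem_image.1 hx
    exact hnot y
  have hLR : Disjoint (A.image f) (Aᶜ.image f) := (disjoint_image hinj).2 disjoint_compl_right
  have huniv : A.image f ∪ Z ∪ Aᶜ.image f = univ := by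
    refine eq_univ_of_forall fun x => ?_
    by_cases hx : x ∈ Z
    · exact mem_union_left _ (mem_union_right _ hx)
    · obtain ⟨y, rfl⟩ := hrange x hx
      by_cases hy : y ∈ A
      · exact mem_union_left _ (mem_union_left _ (mem_image_of_mem _ hy))
      · exact mem_union_right _ (mem_image_of_mem _ (mem_compl.2 hy))
  have hdisj : Disjoint (A.image f ∪ Z) (Aᶜ.image f) :=
    disjoint_union_left.2 ⟨hLR, hRZ.symm⟩
  have hl : #(A.image f).toLeft + #Z.toLeft + #(Aᶜ.image f).toLeft = Fintype.card Q := by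
    rw [← card_union_of_disjoint (disjoint_toLeft hLZ), ← toLeft_union,
      ← card_union_of_disjoint (disjoint_toLeft hdisj), ← toLeft_union, huniv]
    simp
  have hr : #(A.image f).toRight + #Z.toRight + #(Aᶜ.image f).toRight = Fintype.card V := by
    rw [← card_union_of_disjoint (disjoint_toRight hLZ), ← toRight_union,
      ← card_union_of_disjoint (disjoint_toRight hdisj), ← toRight_union, huniv]
    simp
  have hzb := Tiled.card_toRight hT hZ
  have hrb := Tiled.card_toRight hT hR
  rw [← huniv]
  refine (habs _ hLZ (by omega) ?_).union hR hdisj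
  rwa [card_image_of_injective _ hinj]

set_option synthInstance.maxSize 1000 in
/-- A dense symmetric family of coloured tuples is perfectly tiled once it has enough tuples at
every colour and vertex, also after deleting any set of fewer vertices than there are colours. -/
theorem exists_tiled_univ : ∃ N : ℕ, ∀ (Q V : Type) [Fintype Q] [Fintype V] [DecidableEq Q]
    [DecidableEq V] (T : Finset (Q × V × V × V × V)), Fintype.card V = 4 * Fintype.card Q →
    N ≤ Fintype.card Q → (∀ e ∈ T, #(tupleEdge e) = 5) →
    (∀ {j a b c d}, (j, a, b, c, d) ∈ T → (j, b, a, c, d) ∈ T) →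
    (∀ {j a b c d}, (j, a, b, c, d) ∈ T → (j, a, c, b, d) ∈ T) →
    (∀ {j a b c d}, (j, a, b, c, d) ∈ T → (j, a, b, d, c) ∈ T) →
    (∀ j v, 37 * (Fintype.card Q : ℝ) ^ 3 - 100 * (Fintype.card Q : ℝ) ^ 2 ≤
      #{p : V × V × V | (j, v, p) ∈ T}) →
    (∀ W : Finset V, #W < Fintype.card Q → ∀ j u, u ∉ W →
      4 * ((Fintype.card Q : ℝ) - #W - 1) * (Fintype.card Q : ℝ) ^ 2 + 1 ≤
        #{p : V × V × V | p ∈ Wᶜ ×ˢ Wᶜ ×ˢ Wᶜ ∧ (j, u, p) ∈ T}) →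
    Tiled (fun i : T => tupleEdge i.1) univ := by
  obtain ⟨ξ, hξ, N₀, hN₀⟩ := exists_absorbing_set (ζ := 1 / 10 ^ 23) (by norm_num) (by norm_num)
  obtain ⟨N₁, hN₁⟩ := exists_almost_tiled_or_sparse (ε := 1 / 10 ^ 22) (ξ := ξ) (by norm_num)
    (by norm_num) hξ
  refine ⟨N₀ + N₁ + 10 ^ 24, ?_⟩
  intro Q V _ _ _ _ T hV hN hT hswap₁ hswap₂ hswap₃ hdeg hlink
  set m : ℝ := (Fintype.card Q : ℝ) with hm_def
  have hVm : (Fintype.card V : ℝ) = 4 * m := by rw [hV, hm_def]; push_cast; ring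
  have hm : (10 : ℝ) ^ 24 ≤ m := by
    have : 10 ^ 24 ≤ Fintype.card Q := by omega
    rw [hm_def]
    exact_mod_cast this
  have hm0 : 0 < m := lt_of_lt_of_le (by norm_num) hm
  have hm23 : (10 : ℝ) ^ 24 * m ^ 2 ≤ m ^ 3 := by
    nlinarith [mul_le_mul_of_nonneg_right hm (sq_nonneg m)]
  obtain ⟨Z, hZcard, hZ, habs⟩ := hN₀ Q V T hV (by omega) hT (by
    intro j v
    refine le_trans ?_ (hdeg j v)
    rw [hVm]
    nlinarith [sq_nonneg m])
  rw [hVm] at hZcard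
  have hZb := Tiled.card_toRight hT hZ
  have hZlr : #Z.toLeft + #Z.toRight = #Z := card_toLeft_add_card_toRight
  have hZl : (#Z.toLeft : ℝ) ≤ 4 / 10 ^ 23 * m := by
    have : (#Z.toLeft : ℝ) ≤ #Z := by exact_mod_cast (by omega : #Z.toLeft ≤ #Z)
    linarith
  have hZr : (#Z.toRight : ℝ) ≤ 4 / 10 ^ 23 * m := by
    have : (#Z.toRight : ℝ) ≤ #Z := by exact_mod_cast (by omega : #Z.toRight ≤ #Z)
    linarith
  have hlQ : #Z.toLeft ≤ Fintype.card Q := card_le_univ _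
  have hC : Fintype.card (Z.toLeftᶜ : Finset Q) = Fintype.card Q - #Z.toLeft := by
    rw [Fintype.card_coe, card_compl]
  have hS : Fintype.card (Z.toRightᶜ : Finset V) =
      4 * Fintype.card (Z.toLeftᶜ : Finset Q) := by
    rw [hC, Fintype.card_coe, card_compl]
    omega
  have hSm : (Fintype.card (Z.toRightᶜ : Finset V) : ℝ) = 4 * (m - #Z.toLeft) := by
    rw [hS, hC, hm_def]
    push_cast [hlQ]
    ring
  have hSm_le : (Fintype.card (Z.toRightᶜ : Finset V) : ℝ) ≤ 4 * m := by
    rw [hSm]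
    linarith [Nat.cast_nonneg (α := ℝ) #Z.toLeft]
  have hNS : N₁ ≤ Fintype.card (Z.toRightᶜ : Finset V) := by
    have h1 : (N₁ : ℝ) ≤ m := by
      have : N₁ ≤ Fintype.card Q := by omega
      rw [hm_def]
      exact_mod_cast this
    have h2 : (N₁ : ℝ) ≤ (Fintype.card (Z.toRightᶜ : Finset V) : ℝ) := by
      rw [hSm]
      linarith
    exact_mod_cast h2
  rcases hN₁ (Z.toLeftᶜ : Finset Q) (Z.toRightᶜ : Finset V)
      (restrictTuples T Z.toLeftᶜ Z.toRightᶜ) hS hNS (card_tupleEdge_restrictTuples hT) (by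
        intro j v
        have h1 := (hdeg j.1 v.1).trans (restrictTuples_degree_ge (T := T) hV j v)
        rw [compl_compl] at h1
        have h2 : ((37 : ℝ) / 64 - 1 / 10 ^ 22) *
            (Fintype.card (Z.toRightᶜ : Finset V) : ℝ) ^ 3 ≤
            (37 / 64 - 1 / 10 ^ 22) * (4 * m) ^ 3 := by
          gcongr
        have h3 : 48 * (#Z.toRight : ℝ) * m ^ 2 ≤ 48 * (4 / 10 ^ 23 * m) * m ^ 2 := by gcongr
        refine h2.trans ?_
        nlinarith) with ⟨A, hA, hAc⟩ | ⟨U, hU, hUT⟩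
  · refine tiled_univ_of_absorbed hV hT (ξ := ξ * Fintype.card V) hZ habs hA (hAc.trans ?_)
    rw [hVm]
    gcongr
  · have hcol := card_inside_le_restrictTuples (T := T) (C := Z.toLeftᶜ) hV U
    rw [compl_compl] at hcol
    set U' : Finset V := U.map (.subtype _) with hU'
    have hU'c : #U' = #U := card_map _
    have hle : ((3 * Fintype.card Q - #U' : ℕ) : ℝ) ≤ (48 / 10 ^ 23 + 16000 / 10 ^ 22) * m := by
      have h1 : (3 * m - #U : ℝ) ≤ (48 / 10 ^ 23 + 16000 / 10 ^ 22) * m := by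
        rw [hSm] at hU
        nlinarith [Nat.cast_nonneg (α := ℝ) #Z.toLeft]
      rw [hU'c]
      rcases le_total (#U) (3 * Fintype.card Q) with h | h
      · push_cast [h]
        exact h1
      · rw [Nat.sub_eq_zero_of_le h, Nat.cast_zero]
        positivity
    obtain ⟨U₀, hU₀, hU₀T⟩ := exists_sparse_of_card_le (T := T) hV U'
      (3 * Fintype.card Q - #U') (by omega)
    have hsum := hU₀T.trans (Nat.add_le_add_right hcol _)
    have hsumR : (#{e ∈ T | e.2.1 ∈ U₀ ∧ e.2.2.1 ∈ U₀ ∧ e.2.2.2.1 ∈ U₀ ∧ e.2.2.2.2 ∈ U₀} : ℝ) ≤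
        #{e ∈ restrictTuples T Z.toLeftᶜ Z.toRightᶜ |
          e.2.1 ∈ U ∧ e.2.2.1 ∈ U ∧ e.2.2.2.1 ∈ U ∧ e.2.2.2.2 ∈ U} +
        256 * #Z.toLeft * m ^ 4 + 256 * ((3 * Fintype.card Q - #U' : ℕ) : ℝ) * m ^ 4 := by
      rw [hm_def]
      exact_mod_cast hsum
    obtain ⟨W, hW⟩ := exists_nearExtremal_of_sparse hV hT hswap₁ hswap₂ hswap₃ hdeg hlink hU₀ (by
      refine hsumR.trans ?_
      have h1 : 17 * (1 / 10 ^ 22 : ℝ) * (Fintype.card (Z.toRightᶜ : Finset V) : ℝ) ^ 5 ≤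
          17 * (1 / 10 ^ 22) * (4 * m) ^ 5 := by gcongr
      have h2 : 256 * (#Z.toLeft : ℝ) * m ^ 4 ≤ 256 * (4 / 10 ^ 23 * m) * m ^ 4 := by gcongr
      have h3 : 256 * ((3 * Fintype.card Q - #U' : ℕ) : ℝ) * m ^ 4 ≤
          256 * ((48 / 10 ^ 23 + 16000 / 10 ^ 22) * m) * m ^ 4 := by gcongr
      have h4 : (0 : ℝ) ≤ m ^ 5 := by positivity
      calc _ ≤ 17 * (1 / 10 ^ 22) * (4 * m) ^ 5 + 256 * (4 / 10 ^ 23 * m) * m ^ 4 +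
            256 * ((48 / 10 ^ 23 + 16000 / 10 ^ 22) * m) * m ^ 4 :=
            add_le_add (add_le_add (hUT.trans h1) h2) h3
        _ = (17 * (1 / 10 ^ 22) * 4 ^ 5 + 256 * (4 / 10 ^ 23) +
            256 * (48 / 10 ^ 23 + 16000 / 10 ^ 22)) * m ^ 5 := by ring
        _ ≤ _ := by
            gcongr
            norm_num) (le_trans (by norm_num) hm)
    exact hW.tiled_univ (by omega)

end Assembly

end RainbowMatching

open Finset RainbowMatching in
/-- For sufficiently large `n` divisible by 4, if `F₁, …, F_{n/4}` are
4-uniform hypergraphs on `[n]` with minimum vertex degree greater than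
`C(n-1,3) - C(3n/4,3)`, then the family admits a rainbow matching. -/
theorem rainbow_matching_four_uniform :
    ∃ N : ℕ, ∀ n : ℕ, N ≤ n → 4 ∣ n →
    ∀ F : Fin (n / 4) → Finset (Finset (Fin n)),
      (∀ i : Fin (n / 4), ∀ e ∈ F i, e.card = 4) →
      (∀ i : Fin (n / 4), ∀ v : Fin n,
        Nat.choose (n - 1) 3 - Nat.choose (3 * n / 4) 3
          < ((F i).filter (fun e => v ∈ e)).card) →
      ∃ e : Fin (n / 4) → Finset (Fin n),
        (∀ i, e i ∈ F i) ∧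
        (∀ i j, i ≠ j → Disjoint (e i) (e j)) := by
  obtain ⟨N, hN⟩ := exists_tiled_univ
  refine ⟨4 * (N + 3), fun n hn hdvd F hF hdeg => ?_⟩
  have hQ : Fintype.card (Fin (n / 4)) = n / 4 := Fintype.card_fin _
  have hV : Fintype.card (Fin n) = 4 * Fintype.card (Fin (n / 4)) := by
    rw [hQ, Fintype.card_fin]
    omega
  have hdeg' : ∀ j v, (Fintype.card (Fin n) - 1).choose 3 -
      (3 * Fintype.card (Fin (n / 4))).choose 3 < #{e ∈ F j | v ∈ e} := by
    intro j v
    have h := hdeg j v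
    rw [show 3 * n / 4 = 3 * (n / 4) by omega] at h
    rwa [hQ, Fintype.card_fin]
  have hswap : ∀ {j a b c d a' b' c' d'}, (j, a, b, c, d) ∈ orderedTuples F →
      ({a, b, c, d} : Finset (Fin n)) = {a', b', c', d'} →
      (j, a', b', c', d') ∈ orderedTuples F := by
    intro j a b c d a' b' c' d' h heq
    rw [mem_orderedTuples] at h ⊢
    rwa [← heq]
  have htiled := hN (Fin (n / 4)) (Fin n) (orderedTuples F) hV (by rw [hQ]; omega)
    (by
      rintro ⟨j, a, b, c, d⟩ he
      exact card_tupleEdge_of_card_eq_four (hF j _ (mem_orderedTuples.1 he)))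
    (fun h => hswap h (by ext; simp; tauto)) (fun h => hswap h (by ext; simp; tauto))
    (fun h => hswap h (by ext; simp; tauto))
    (orderedTuples_degree_ge hV (by rw [hQ]; omega) hF hdeg')
    (orderedTuples_link_ge hV (by rw [hQ]; omega) hF hdeg')
  obtain ⟨e, he, hd⟩ := exists_rainbow_of_tiled htiled
  have hmem : ∀ j, j ∈ (univ : Finset (Fin (n / 4) ⊕ Fin n)).toLeft := fun j => by simp
  exact ⟨e, fun i => (he i (hmem i)).1, fun i j hij => hd i (hmem i) j (hmem j) hij⟩
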